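/- arXiv:2601.00179 — 4 statements merged into one kernel-verified Lean document; each statement's English description precedes it below -/
import Mathlib

section
/- For every integer N ≥ 2 and all real numbers x_1,…,x_{N−1}, there exist real numbers y_1,…,y_{N−1} with y_i − x_i ∈ ℚ and 0 < y_i ≤ 1/N for each i, and a regular Toeplitz subshift X ⊆ ({1,…,N})^ℤ which is uniquely ergodic — the shift σ restricted to X has exactly one invariant Borel probability measure μ — such that μ({z ∈ X : z(0) = i}) = y_i for every 1 ≤ i ≤ N−1, and the set {∫_X f dμ : f ∈ C(X,ℤ)} equals the ℚ-linear span of {1, x_1, …, x_{N−1}} in ℝ. -/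
open MeasureTheory TopologicalSpace Topology

def zOrbit {X : Type*} (φ : X → X) (x : X) : Set X :=
  {y | ∃ n : ℕ, φ^[n] x = y ∨ φ^[n] y = x}

def shift {A : Type*} : (ℤ → A) → (ℤ → A) := fun x n => x (n + 1)

def IsToeplitz {A : Type*} (x : ℤ → A) : Prop :=
  ∀ k : ℤ, ∃ p : ℕ, 1 ≤ p ∧ ∀ n : ℤ, x (k + n * p) = x k

noncomputable def toeplitzDelta {A : Type*} (x : ℤ → A) (p : ℕ) : ℝ :=
  ({k : ℤ | 0 ≤ k ∧ k < (p : ℤ) ∧ ∀ n : ℤ, x (k + n * p) = x k}.ncard : ℝ) / p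

def IsRegularToeplitz {A : Type*} (x : ℤ → A) : Prop :=
  IsToeplitz x ∧ sSup {d : ℝ | ∃ p : ℕ, 1 ≤ p ∧ d = toeplitzDelta x p} = 1

def IsRegularToeplitzSubshift {A : Type*} [TopologicalSpace A] (X : Set (ℤ → A)) : Prop :=
  ∃ x : ℤ → A, IsRegularToeplitz x ∧ X = closure (zOrbit shift x)

/-- A probability measure on `A^ℤ` is an invariant probability measure for the subsystem
`(X, σ|X)` iff it is shift-invariant and gives `X` full measure. -/
def IsInvariantOn {A : Type*} [MeasurableSpace A] (X : Set (ℤ → A))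
    (μ : ProbabilityMeasure (ℤ → A)) : Prop :=
  (∀ B : Set (ℤ → A), MeasurableSet B → μ.toMeasure (shift ⁻¹' B) = μ.toMeasure B) ∧
    μ.toMeasure X = 1

/-- Krylov–Bogolyubov: a closed set containing a forward orbit of a continuous map of a compact
space carries an invariant probability measure. -/
theorem exists_invariant_probabilityMeasure {E : Type*} [TopologicalSpace E] [CompactSpace E]
    [T2Space E] [HasOuterApproxClosed E] [MeasurableSpace E] [BorelSpace E]
    {φ : E → E} (hφ : Continuous φ) (x₀ : E)
    {X : Set E} (hX : IsClosed X) (hx : ∀ n : ℕ, φ^[n] x₀ ∈ X) :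
    ∃ μ : ProbabilityMeasure E, μ.toMeasure.map φ = μ.toMeasure ∧ μ.toMeasure X = 1 := by
  let m : ℕ → Measure E := fun n =>
    ((n + 1 : ℕ) : ENNReal)⁻¹ • ∑ i ∈ Finset.range (n + 1), Measure.dirac (φ^[i] x₀)
  have hcancel : ∀ n : ℕ, ((n + 1 : ℕ) : ENNReal)⁻¹ * ((n + 1 : ℕ) : ENNReal) = 1 := fun n =>
    ENNReal.inv_mul_cancel (by simp) (by simp)
  have hm : ∀ n, IsProbabilityMeasure (m n) := by
    intro n
    refine ⟨?_⟩
    simp only [m, Measure.smul_apply, Measure.coe_finsetSum, Finset.sum_apply, measure_univ,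
      Finset.sum_const, Finset.card_range, smul_eq_mul, nsmul_eq_mul, mul_one]
    exact hcancel n
  have hmX : ∀ n, m n X = 1 := by
    intro n
    simp only [m, Measure.smul_apply, Measure.coe_finsetSum, Finset.sum_apply, smul_eq_mul]
    rw [Finset.sum_congr rfl (fun i _ => Measure.dirac_apply_of_mem (hx i))]
    simpa using hcancel n
  let P : ℕ → ProbabilityMeasure E := fun n => ⟨m n, hm n⟩
  obtain ⟨μ, -, hμ⟩ := isCompact_univ.ultrafilter_le_nhds (Ultrafilter.map P (Filter.hyperfilter ℕ))
    (by simp)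
  have hlim : Filter.Tendsto P (Filter.hyperfilter ℕ) (𝓝 μ) := hμ
  have hat : (Filter.hyperfilter ℕ : Filter ℕ) ≤ Filter.atTop := by
    rw [← Nat.cofinite_eq_atTop]; exact Filter.hyperfilter_le_cofinite
  refine ⟨μ, ?_, ?_⟩
  · have : IsProbabilityMeasure (μ.toMeasure.map φ) :=
      Measure.isProbabilityMeasure_map hφ.aemeasurable
    refine ext_of_forall_integral_eq_of_IsFiniteMeasure fun f => ?_
    rw [integral_map hφ.aemeasurable f.continuous.aestronglyMeasurable]
    have h1 := (ProbabilityMeasure.tendsto_iff_forall_integral_tendsto.1 hlim) f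
    have h2 := (ProbabilityMeasure.tendsto_iff_forall_integral_tendsto.1 hlim)
      (f.compContinuous ⟨φ, hφ⟩)
    have hint : ∀ (g : BoundedContinuousFunction E ℝ) (n : ℕ), ∫ z, g z ∂(P n : Measure E) =
        (n + 1 : ℝ)⁻¹ * ∑ i ∈ Finset.range (n + 1), g (φ^[i] x₀) := by
      intro g n
      change ∫ z, g z ∂(m n) = _
      simp only [m]
      rw [integral_smul_measure, integral_finsetSum_measure]
      · have h6 : (((n + 1 : ℕ) : ENNReal)⁻¹).toReal = (n + 1 : ℝ)⁻¹ := by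
          rw [ENNReal.toReal_inv, ENNReal.toReal_natCast]
          norm_cast
        rw [h6]
        simp only [integral_dirac, smul_eq_mul]
      · intro i _
        exact g.integrable _
    have h3 : Filter.Tendsto (fun n : ℕ => (n + 1 : ℝ)⁻¹ * (f (φ^[n + 1] x₀) - f x₀))
        Filter.atTop (𝓝 0) := by
      have h4 : Filter.Tendsto (fun n : ℕ => (n + 1 : ℝ)⁻¹ * (2 * ‖f‖)) Filter.atTop (𝓝 0) := by
        simpa using (tendsto_one_div_add_atTop_nhds_zero_nat (𝕜 := ℝ)).mul_const (2 * ‖f‖)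
      refine squeeze_zero_norm (fun n => ?_) h4
      rw [norm_mul, Real.norm_of_nonneg (by positivity : (0:ℝ) ≤ (n + 1 : ℝ)⁻¹)]
      gcongr
      calc ‖f (φ^[n + 1] x₀) - f x₀‖ ≤ ‖f (φ^[n + 1] x₀)‖ + ‖f x₀‖ := norm_sub_le _ _
        _ ≤ ‖f‖ + ‖f‖ := add_le_add (f.norm_coe_le_norm _) (f.norm_coe_le_norm _)
        _ = 2 * ‖f‖ := by ring
    have h5 := tendsto_nhds_unique (h2.sub h1) (f := fun n => _) (l := (Filter.hyperfilter ℕ : Filter ℕ))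
      (b := 0) (by
        refine (h3.mono_left hat).congr fun n => ?_
        rw [hint, hint, ← mul_sub, ← Finset.sum_sub_distrib]
        congr 1
        have := Finset.sum_range_sub (fun i => f (φ^[i] x₀)) (n + 1)
        simp only [Function.iterate_zero, id] at this
        rw [← this]
        refine Finset.sum_congr rfl fun i _ => ?_
        rw [Function.iterate_succ_apply']
        rfl)
    exact sub_eq_zero.1 h5
  · refine le_antisymm prob_le_one ?_
    have h := ProbabilityMeasure.limsup_measure_closed_le_of_tendsto hlim hX
    refine le_trans ?_ h
    have : (fun n => (P n : Measure E) X) = fun _ => 1 := funext hmX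
    rw [this]
    simp

/-- A hierarchy of words over `A`: the level `n + 1` words are obtained by filling the empty places
of the pattern `c n` of length `q n` with a level `n` letter. The sequence `X n` is the resulting
sequence seen at level `n`, and `f n` is the vector of letter frequencies in `X n`. -/
structure Tower (A : Type*) [DecidableEq A] [Fintype A] where
  q : ℕ → ℕ
  c : ℕ → ℕ → Option A
  f : ℕ → A → ℝ
  o : A
  X : ℕ → ℤ → A
  m : ℕ → ℕ
  m_eq : ∀ n, m n = ((Finset.range (q n)).filter fun t => c n t = none).card
  two_le : ∀ n, 2 ≤ q n
  head : ∀ n, c n 0 ≠ none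
  last : ∀ n, c n (q n - 1) ≠ none
  m_pos : ∀ n, 0 < m n
  two_mul_m_le : ∀ n, 2 * m n ≤ q n
  dvd_q : ∀ n, (n + 1) ∣ q n
  dvd_m : ∀ n, (n + 1) ∣ m n
  f_nonneg : ∀ n a, 0 ≤ f n a
  sum_f : ∀ n, ∑ a, f n a = 1
  freq : ∀ n a, (q n : ℝ) * f n a =
    (((Finset.range (q n)).filter fun t => c n t = some a).card : ℝ) + m n * f (n + 1) a
  marker : ∀ n, ∃ R ≤ q n, (∀ t < R, c n t = some o) ∧
    ∀ t, 0 < t → t < q n → ∃ u, t ≤ u ∧ u < t + R ∧ u < q n ∧ ∃ a, a ≠ o ∧ c n u = some a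
  X_eq : ∀ n b, X n b = (c n (b % (q n : ℤ)).toNat).getD (X (n + 1) (b / (q n : ℤ)))

namespace Tower

variable {A : Type*} [DecidableEq A] [Fintype A] (T : Tower A)

/-- The length of the words of level `n`. -/
def P (n : ℕ) : ℕ := ∏ k ∈ Finset.range n, T.q k

/-- The number of positions of a level `n` word that depend on the word. -/
def M (n : ℕ) : ℕ := ∏ k ∈ Finset.range n, T.m k

theorem q_pos (n : ℕ) : 0 < T.q n := lt_of_lt_of_le (by norm_num) (T.two_le n)

theorem P_pos (n : ℕ) : 0 < T.P n := Finset.prod_pos fun k _ => T.q_pos k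

theorem M_pos (n : ℕ) : 0 < T.M n := Finset.prod_pos fun k _ => T.m_pos k

theorem P_succ (n : ℕ) : T.P (n + 1) = T.P n * T.q n := Finset.prod_range_succ _ _

theorem M_succ (n : ℕ) : T.M (n + 1) = T.M n * T.m n := Finset.prod_range_succ _ _

theorem P_zero : T.P 0 = 1 := rfl

theorem two_pow_le_P (n : ℕ) : 2 ^ n ≤ T.P n := by
  induction n with
  | zero => simp [P]
  | succ n ih =>
    rw [P_succ, pow_succ]
    exact Nat.mul_le_mul ih (T.two_le n)

theorem two_pow_mul_M_le (n : ℕ) : 2 ^ n * T.M n ≤ T.P n := by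
  induction n with
  | zero => simp [P, M]
  | succ n ih =>
    rw [P_succ, M_succ, pow_succ]
    calc 2 ^ n * 2 * (T.M n * T.m n) = (2 ^ n * T.M n) * (2 * T.m n) := by ring
      _ ≤ T.P n * T.q n := Nat.mul_le_mul ih (T.two_mul_m_le n)

theorem X_block (n : ℕ) (b : ℤ) {t : ℕ} (ht : t < T.q n) :
    T.X n (b * T.q n + t) = (T.c n t).getD (T.X (n + 1) b) := by
  have hq : (0 : ℤ) < T.q n := by exact_mod_cast T.q_pos n
  have ht' : (t : ℤ) < T.q n := by exact_mod_cast ht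
  have h1 : (b * T.q n + t) % (T.q n : ℤ) = t := by
    rw [add_comm, Int.add_mul_emod_self_right]
    exact Int.emod_eq_of_lt (by positivity) ht'
  have h2 : (b * T.q n + t) / (T.q n : ℤ) = b := by
    rw [add_comm, Int.add_mul_ediv_right _ _ hq.ne', Int.ediv_eq_zero_of_lt (by positivity) ht',
      zero_add]
  rw [T.X_eq, h1, h2, Int.toNat_natCast]

theorem X_congr (n : ℕ) {r : ℕ} (hr : r < T.P n) {b b' : ℤ} (h : T.X n b = T.X n b') :
    T.X 0 (b * T.P n + r) = T.X 0 (b' * T.P n + r) := by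
  induction n generalizing r b b' with
  | zero =>
    have : r = 0 := by simpa [P] using hr
    simpa [this, P] using h
  | succ n ih =>
    rw [P_succ] at hr ⊢
    have ht : r / T.P n < T.q n := Nat.div_lt_of_lt_mul hr
    have hr' : r % T.P n < T.P n := Nat.mod_lt _ (T.P_pos n)
    have key : ∀ b : ℤ, b * ((T.P n * T.q n : ℕ) : ℤ) + r =
        (b * T.q n + (r / T.P n : ℕ)) * T.P n + (r % T.P n : ℕ) := by
      intro b
      have : (r : ℤ) = (T.P n : ℤ) * (r / T.P n : ℕ) + (r % T.P n : ℕ) := by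
        exact_mod_cast (Nat.div_add_mod r (T.P n)).symm
      rw [this]
      push_cast
      ring
    rw [key, key]
    refine ih hr' ?_
    rw [X_block _ _ _ ht, X_block _ _ _ ht, h]

theorem X_const (n : ℕ) {t r : ℕ} (ht : t < T.q n) (hr : r < T.P n) (hc : T.c n t ≠ none)
    (b b' : ℤ) :
    T.X 0 (b * T.P (n + 1) + (t * T.P n + r)) = T.X 0 (b' * T.P (n + 1) + (t * T.P n + r)) := by
  have key : ∀ b : ℤ, b * (T.P (n + 1) : ℤ) + (t * T.P n + r) =
        (b * T.q n + t) * T.P n + r := by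
    intro b
    rw [P_succ]
    push_cast
    ring
  rw [key, key]
  refine T.X_congr n hr ?_
  rw [X_block _ _ _ ht, X_block _ _ _ ht]
  obtain ⟨a, ha⟩ := Option.ne_none_iff_exists'.1 hc
  simp [ha]

theorem X_head (n : ℕ) {r : ℕ} (hr : r < T.P n) (b b' : ℤ) :
    T.X 0 (b * T.P (n + 1) + r) = T.X 0 (b' * T.P (n + 1) + r) := by
  simpa using T.X_const n (T.q_pos n) hr (T.head n) b b'

theorem X_last (n : ℕ) {r : ℕ} (hr : T.P (n + 1) ≤ r + T.P n) (hr' : r < T.P (n + 1)) (b b' : ℤ) :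
    T.X 0 (b * T.P (n + 1) + r) = T.X 0 (b' * T.P (n + 1) + r) := by
  have hq := T.q_pos n
  obtain ⟨s, rfl⟩ : ∃ s, r = (T.q n - 1) * T.P n + s := by
    refine ⟨r - (T.q n - 1) * T.P n, ?_⟩
    rw [Nat.add_sub_cancel']
    rw [P_succ] at hr
    rw [Nat.sub_mul, mul_comm (T.q n)]
    omega
  have hs : s < T.P n := by
    rw [P_succ] at hr'
    have : T.P n * T.q n = (T.q n - 1) * T.P n + T.P n := by
      obtain ⟨q, hq⟩ : ∃ q, T.q n = q + 1 := ⟨T.q n - 1, by omega⟩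
      rw [hq]; simp; ring
    omega
  simpa using T.X_const n (by omega) hs (T.last n) b b'

theorem isToeplitz : IsToeplitz (T.X 0) := by
  intro k
  obtain ⟨n, hn⟩ : ∃ n, k.natAbs < T.P n :=
    ⟨k.natAbs, lt_of_lt_of_le Nat.lt_two_pow_self (T.two_pow_le_P _)⟩
  refine ⟨T.P (n + 1), T.P_pos _, fun j => ?_⟩
  have hle : T.P n ≤ T.P (n + 1) := by
    rw [P_succ]; exact Nat.le_mul_of_pos_right _ (T.q_pos n)
  rcases le_or_gt 0 k with hk | hk
  · have h := T.X_head n hn j 0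
    have e : ((k.natAbs : ℕ) : ℤ) = k := by omega
    rw [e] at h
    rw [add_comm, h]
    simp
  · have h := T.X_last n (r := T.P (n + 1) - k.natAbs) (by omega) (by omega) (j - 1) (-1)
    have e : ((T.P (n + 1) - k.natAbs : ℕ) : ℤ) = T.P (n + 1) + k := by omega
    rw [e] at h
    convert h using 2 <;> ring

/-- The residues modulo `P n` that are not periods of the sequence. -/
def holes (n : ℕ) : Set ℕ :=
  {r | r < T.P n ∧ ¬ ∀ b : ℤ, T.X 0 (r + b * T.P n) = T.X 0 r}

theorem holes_finite (n : ℕ) : (T.holes n).Finite :=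
  (Set.finite_lt_nat (T.P n)).subset fun _ h => h.1

theorem holes_ncard_le (n : ℕ) : (T.holes n).ncard ≤ T.M n := by
  induction n with
  | zero =>
    refine (Set.ncard_le_ncard (t := {0}) ?_).trans (by simp [M])
    intro r hr
    have := hr.1
    simpa [P] using this
  | succ n ih =>
    set S : Set ℕ := ↑((Finset.range (T.q n)).filter fun t => T.c n t = none) with hS
    have hsub : T.holes (n + 1) ⊆ (fun p : ℕ × ℕ => p.2 * T.P n + p.1) '' (T.holes n ×ˢ S) := by
      intro r hr
      have hr1 : r < T.P n * T.q n := by have := hr.1; rwa [P_succ] at this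
      have ht : r / T.P n < T.q n := Nat.div_lt_of_lt_mul hr1
      have hr' : r % T.P n < T.P n := Nat.mod_lt _ (T.P_pos n)
      have hdm : r / T.P n * T.P n + r % T.P n = r := Nat.div_add_mod' r (T.P n)
      have hdm' : (r : ℤ) = (r / T.P n : ℕ) * (T.P n : ℤ) + (r % T.P n : ℕ) := by
        exact_mod_cast hdm.symm
      refine ⟨(r % T.P n, r / T.P n), ⟨⟨hr', fun h => hr.2 fun b => ?_⟩, ?_⟩, hdm⟩
      · have h1 := h (b * T.q n + (r / T.P n : ℕ))
        have h2 := h (r / T.P n : ℕ)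
        rw [hdm', P_succ]
        push_cast at h1 h2 ⊢
        rw [add_comm] at h2
        rw [h2, ← h1]
        congr 1
        ring
      · rw [hS]
        simp only [Finset.coe_filter, Finset.mem_range, Set.mem_ofPred_eq]
        refine ⟨ht, ?_⟩
        by_contra hc
        refine hr.2 fun b => ?_
        have := T.X_const n ht hr' hc b 0
        rw [← hdm'] at this
        rw [add_comm, this]
        simp
    have hfin : (T.holes n ×ˢ S).Finite := (T.holes_finite n).prod (Finset.finite_toSet _)
    calc (T.holes (n + 1)).ncard ≤ _ := Set.ncard_le_ncard hsub (hfin.image _)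
      _ ≤ (T.holes n ×ˢ S).ncard := Set.ncard_image_le hfin
      _ = (T.holes n).ncard * T.m n := by
        rw [Set.ncard_prod, hS, Set.ncard_coe_finset, T.m_eq]
      _ ≤ T.M n * T.m n := Nat.mul_le_mul_right _ ih
      _ = _ := (T.M_succ n).symm

theorem isRegularToeplitz : IsRegularToeplitz (T.X 0) := by
  refine ⟨T.isToeplitz, IsLUB.csSup_eq ⟨?_, ?_⟩ ⟨_, 1, le_rfl, rfl⟩⟩
  · rintro _ ⟨p, hp, rfl⟩
    unfold toeplitzDelta
    have hp' : (0 : ℝ) < p := by exact_mod_cast hp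
    rw [div_le_one hp']
    have : {k : ℤ | 0 ≤ k ∧ k < (p : ℤ) ∧ ∀ n : ℤ, T.X 0 (k + n * p) = T.X 0 k} ⊆
        (Finset.Ico (0 : ℤ) p : Set ℤ) := by
      intro k hk
      simpa using ⟨hk.1, hk.2.1⟩
    have h := Set.ncard_le_ncard this (Finset.finite_toSet _)
    rw [Set.ncard_coe_finset] at h
    simp only [Int.card_Ico, sub_zero, Int.toNat_natCast] at h
    exact_mod_cast h
  · intro d hd
    have hbound : ∀ n : ℕ, 1 - (1 / 2 : ℝ) ^ n ≤ toeplitzDelta (T.X 0) (T.P n) := by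
      intro n
      unfold toeplitzDelta
      have hP : (0 : ℝ) < T.P n := by exact_mod_cast T.P_pos n
      rw [le_div_iff₀ hP]
      set S := {k : ℤ | 0 ≤ k ∧ k < (T.P n : ℤ) ∧ ∀ b : ℤ, T.X 0 (k + b * T.P n) = T.X 0 k} with hS
      have hSf : S.Finite := (Set.finite_Ico (0 : ℤ) (T.P n)).subset fun k hk => ⟨hk.1, hk.2.1⟩
      have hcov : (Finset.Ico (0 : ℤ) (T.P n) : Set ℤ) ⊆ S ∪ (fun r : ℕ => (r : ℤ)) '' T.holes n := by
        intro k hk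
        simp only [Finset.coe_Ico, Set.mem_Ico] at hk
        by_cases h : ∀ b : ℤ, T.X 0 (k + b * T.P n) = T.X 0 k
        · exact Or.inl ⟨hk.1, hk.2, h⟩
        · right
          have e : ((k.toNat : ℕ) : ℤ) = k := Int.toNat_of_nonneg hk.1
          refine ⟨k.toNat, ⟨by omega, ?_⟩, e⟩
          rwa [e]
      have h1 := Set.ncard_le_ncard hcov (hSf.union ((T.holes_finite n).image _))
      rw [Set.ncard_coe_finset] at h1
      simp only [Int.card_Ico, sub_zero, Int.toNat_natCast] at h1
      have h2 := h1.trans ((Set.ncard_union_le _ _).trans (Nat.add_le_add_left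
        ((Set.ncard_image_le (T.holes_finite n)).trans (T.holes_ncard_le n)) _))
      have h3 : (T.P n : ℝ) ≤ S.ncard + T.M n := by exact_mod_cast h2
      have h4 : (2 : ℝ) ^ n * T.M n ≤ T.P n := by exact_mod_cast T.two_pow_mul_M_le n
      have h5 : (T.M n : ℝ) ≤ (1 / 2 : ℝ) ^ n * T.P n := by
        rw [one_div, inv_pow, inv_mul_eq_div, le_div_iff₀ (by positivity)]
        linarith
      linarith
    have hlim : Filter.Tendsto (fun n : ℕ => 1 - (1 / 2 : ℝ) ^ n) Filter.atTop (𝓝 (1 - 0)) :=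
      tendsto_const_nhds.sub (tendsto_pow_atTop_nhds_zero_of_lt_one (by norm_num) (by norm_num))
    rw [sub_zero] at hlim
    exact le_of_tendsto' hlim fun n => (hbound n).trans (hd ⟨T.P n, T.P_pos n, rfl⟩)

end Tower

/-- The sequence `u` has mean `α`, uniformly in the position of the averaging window. -/
def HasUniformMean (u : ℤ → ℝ) (α : ℝ) : Prop :=
  ∀ ε : ℝ, 0 < ε → ∃ M : ℕ, 0 < M ∧
    ∀ k : ℤ, |∑ i ∈ Finset.range M, u (k + i) - M * α| ≤ M * ε

theorem HasUniformMean.comp_add_right {u : ℤ → ℝ} {α : ℝ} (h : HasUniformMean u α) (s : ℤ) :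
    HasUniformMean (fun i => u (i + s)) α := by
  intro ε hε
  obtain ⟨M, hM, H⟩ := h ε hε
  refine ⟨M, hM, fun k => ?_⟩
  have e : ∀ i : ℕ, k + i + s = k + s + i := fun i => by ring
  simpa only [e] using H (k + s)

theorem sum_range_mul_split (F : ℤ → ℝ) (k : ℤ) (q M : ℕ) :
    ∑ i ∈ Finset.range (q * M), F (k + i) =
      ∑ s ∈ Finset.range q, ∑ j ∈ Finset.range M,
        F (((k + s) / (q : ℤ) + j) * q + (k + s) % (q : ℤ)) := by
  induction M with
  | zero => simp
  | succ M ih =>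
    rw [Nat.mul_succ, Finset.sum_range_add, ih]
    simp only [Finset.sum_range_succ, Finset.sum_add_distrib]
    congr 1
    refine Finset.sum_congr rfl fun s _ => congrArg F ?_
    have := Int.mul_ediv_add_emod (k + s) q
    push_cast
    linear_combination -this

theorem sum_range_emod (h : ℤ → ℝ) (k : ℤ) {q : ℕ} (hq : 0 < q) :
    ∑ s ∈ Finset.range q, h ((k + s) % (q : ℤ)) = ∑ t ∈ Finset.range q, h t := by
  have hq' : (0 : ℤ) < q := by exact_mod_cast hq
  have step : ∀ k : ℤ, ∑ s ∈ Finset.range q, h ((k + 1 + s) % (q : ℤ)) =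
      ∑ s ∈ Finset.range q, h ((k + s) % (q : ℤ)) := by
    intro k
    obtain ⟨p, rfl⟩ : ∃ p, q = p + 1 := ⟨q - 1, by omega⟩
    rw [Finset.sum_range_succ, Finset.sum_range_succ' _ p]
    congr 1
    · refine Finset.sum_congr rfl fun s _ => ?_
      congr 2
      push_cast
      ring
    · congr 1
      have : k + 1 + (p : ℤ) = k + (0 : ℕ) + ((p + 1 : ℕ) : ℤ) := by push_cast; ring
      rw [this, Int.add_emod_right]
  have base : ∑ s ∈ Finset.range q, h ((0 + s : ℤ) % (q : ℤ)) = ∑ t ∈ Finset.range q, h t := by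
    refine Finset.sum_congr rfl fun s hs => ?_
    rw [zero_add, Int.emod_eq_of_lt (by positivity) (by exact_mod_cast Finset.mem_range.1 hs)]
  induction k with
  | zero => exact base
  | succ i ih => rw [step, ih]
  | pred i ih =>
    rw [← ih, ← step, sub_add_cancel]

namespace Tower

variable {A : Type*} [DecidableEq A] [Fintype A] (T : Tower A)

theorem f_le_one (n : ℕ) (a : A) : T.f n a ≤ 1 := by
  rw [← T.sum_f n]
  exact Finset.single_le_sum (fun i _ => T.f_nonneg n i) (Finset.mem_univ a)

theorem abs_count_sub_le (a : A) (j : ℕ) : ∀ (n : ℕ) (k : ℤ),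
    |∑ i ∈ Finset.range (∏ l ∈ Finset.range j, T.q (n + l)),
        (if T.X n (k + i) = a then (1 : ℝ) else 0) -
      ((∏ l ∈ Finset.range j, T.q (n + l) : ℕ) : ℝ) * T.f n a| ≤
      ((∏ l ∈ Finset.range j, T.m (n + l) : ℕ) : ℝ) := by
  induction j with
  | zero =>
    intro n k
    have h0 := T.f_nonneg n a
    have h1 := T.f_le_one n a
    simp only [Finset.range_zero, Finset.prod_empty, Finset.range_one, Finset.sum_singleton]
    rw [abs_le]
    split_ifs <;> constructor <;> push_cast <;> linarith
  | succ j ih =>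
    intro n k
    have hq : (0 : ℤ) < T.q n := by exact_mod_cast T.q_pos n
    set Q := ∏ l ∈ Finset.range j, T.q (n + 1 + l) with hQ
    set E := ∏ l ∈ Finset.range j, T.m (n + 1 + l) with hE
    have e1 : ∏ l ∈ Finset.range (j + 1), T.q (n + l) = T.q n * Q := by
      rw [Finset.prod_range_succ', mul_comm, hQ]
      congr 1
      exact Finset.prod_congr rfl fun l _ => by congr 1; ring
    have e2 : ∏ l ∈ Finset.range (j + 1), T.m (n + l) = T.m n * E := by
      rw [Finset.prod_range_succ', mul_comm, hE]
      congr 1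
      exact Finset.prod_congr rfl fun l _ => by congr 1; ring
    rw [e1, e2, sum_range_mul_split fun i => if T.X n i = a then (1 : ℝ) else 0]
    let v : ℤ → ℝ := fun t => Q * (if T.c n t.toNat = some a then (1 : ℝ) else 0) +
      (if T.c n t.toNat = none then (1 : ℝ) else 0) * (Q * T.f (n + 1) a)
    let w : ℤ → ℝ := fun t => (if T.c n t.toNat = none then (1 : ℝ) else 0) * E
    have hv : ∑ s ∈ Finset.range (T.q n), v ((k + s) % (T.q n : ℤ)) =
        ((T.q n * Q : ℕ) : ℝ) * T.f n a := by
      rw [sum_range_emod v k (T.q_pos n)]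
      simp only [v, Int.toNat_natCast]
      rw [Finset.sum_add_distrib, ← Finset.mul_sum, ← Finset.sum_mul, Finset.sum_boole,
        Finset.sum_boole, ← T.m_eq]
      push_cast
      linear_combination (-(Q : ℝ)) * T.freq n a
    have hw : ∑ s ∈ Finset.range (T.q n), w ((k + s) % (T.q n : ℤ)) =
        ((T.m n * E : ℕ) : ℝ) := by
      rw [sum_range_emod w k (T.q_pos n)]
      simp only [w, Int.toNat_natCast]
      rw [← Finset.sum_mul, Finset.sum_boole, ← T.m_eq]
      push_cast
      ring
    rw [← hv, ← hw, ← Finset.sum_sub_distrib]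
    refine (Finset.abs_sum_le_sum_abs _ _).trans (Finset.sum_le_sum fun s _ => ?_)
    obtain ⟨t, ht⟩ : ∃ t : ℕ, (k + s) % (T.q n : ℤ) = t :=
      ⟨((k + s) % (T.q n : ℤ)).toNat, (Int.toNat_of_nonneg (Int.emod_nonneg _ hq.ne')).symm⟩
    have htq : t < T.q n := by
      have := Int.emod_lt_of_pos (k + s) hq
      rw [ht] at this
      exact_mod_cast this
    rw [ht]
    simp only [X_block _ _ _ htq, v, w, Int.toNat_natCast]
    rcases Option.eq_none_or_eq_some (T.c n t) with hc | ⟨a', hc⟩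
    · have := ih (n + 1) ((k + s) / (T.q n : ℤ))
      rw [← hQ, ← hE] at this
      simpa [hc] using this
    · by_cases h : a' = a <;> simp [hc, h]

theorem hasUniformMean (n : ℕ) {u : ℤ → ℝ} {G : ℕ → A → ℝ}
    (hu : ∀ (b : ℤ), ∀ r < T.P n, u (b * T.P n + r) = G r (T.X n b)) :
    HasUniformMean u ((∑ r ∈ Finset.range (T.P n), ∑ a, G r a * T.f n a) / T.P n) := by
  intro ε hε
  have hP : (0 : ℤ) < T.P n := by exact_mod_cast T.P_pos n
  have hPR : (0 : ℝ) < T.P n := by exact_mod_cast T.P_pos n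
  set C := ∑ r ∈ Finset.range (T.P n), ∑ a, |G r a| with hC
  have hC0 : 0 ≤ C := Finset.sum_nonneg fun _ _ => Finset.sum_nonneg fun _ _ => abs_nonneg _
  obtain ⟨j, hj⟩ : ∃ j : ℕ, C ≤ 2 ^ j * (T.P n * ε) := by
    obtain ⟨j, hj⟩ := pow_unbounded_of_one_lt (C / (T.P n * ε)) (one_lt_two)
    exact ⟨j, by rw [div_lt_iff₀ (by positivity)] at hj; exact hj.le⟩
  set Q := ∏ l ∈ Finset.range j, T.q (n + l) with hQ
  set E := ∏ l ∈ Finset.range j, T.m (n + l) with hE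
  have hQE : (2 : ℝ) ^ j * E ≤ Q := by
    have : 2 ^ j * E ≤ Q := by
      calc 2 ^ j * E = ∏ l ∈ Finset.range j, 2 * T.m (n + l) := by
            rw [Finset.prod_mul_distrib, Finset.prod_const, Finset.card_range]
        _ ≤ Q := Finset.prod_le_prod' fun l _ => T.two_mul_m_le _
    exact_mod_cast this
  have hQ0 : 0 < Q := Finset.prod_pos fun l _ => T.q_pos _
  refine ⟨T.P n * Q, Nat.mul_pos (T.P_pos n) hQ0, fun k => ?_⟩
  rw [sum_range_mul_split]
  let v : ℤ → ℝ := fun t => ∑ a, G t.toNat a * (Q * T.f n a)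
  let w : ℤ → ℝ := fun t => ∑ a, |G t.toNat a| * E
  have hv : ∑ s ∈ Finset.range (T.P n), v ((k + s) % (T.P n : ℤ)) = ((T.P n * Q : ℕ) : ℝ) *
      ((∑ r ∈ Finset.range (T.P n), ∑ a, G r a * T.f n a) / T.P n) := by
    rw [sum_range_emod v k (T.P_pos n)]
    simp only [v, Int.toNat_natCast]
    push_cast
    rw [mul_div_assoc', mul_comm (T.P n : ℝ), mul_assoc, mul_comm (T.P n : ℝ), ← mul_assoc,
      mul_div_assoc, div_self hPR.ne', mul_one, Finset.mul_sum]
    refine Finset.sum_congr rfl fun r _ => ?_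
    rw [Finset.mul_sum]
    exact Finset.sum_congr rfl fun a _ => by ring
  have hw : ∑ s ∈ Finset.range (T.P n), w ((k + s) % (T.P n : ℤ)) = C * E := by
    rw [sum_range_emod w k (T.P_pos n)]
    simp only [w, Int.toNat_natCast, hC, Finset.sum_mul]
  have hE' : C * E ≤ ((T.P n * Q : ℕ) : ℝ) * ε := by
    have hE0 : (0 : ℝ) ≤ E := Nat.cast_nonneg _
    calc C * E ≤ (2 ^ j * (T.P n * ε)) * E := by gcongr
      _ = (T.P n * ε) * (2 ^ j * E) := by ring
      _ ≤ (T.P n * ε) * Q := by gcongr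
      _ = _ := by push_cast; ring
  refine le_trans ?_ hE'
  rw [← hv, ← hw, ← Finset.sum_sub_distrib]
  refine (Finset.abs_sum_le_sum_abs _ _).trans (Finset.sum_le_sum fun s _ => ?_)
  obtain ⟨t, ht⟩ : ∃ t : ℕ, (k + s) % (T.P n : ℤ) = t :=
    ⟨((k + s) % (T.P n : ℤ)).toNat, (Int.toNat_of_nonneg (Int.emod_nonneg _ hP.ne')).symm⟩
  have htq : t < T.P n := by
    have := Int.emod_lt_of_pos (k + s) hP
    rw [ht] at this
    exact_mod_cast this
  rw [ht]
  simp only [hu _ _ htq, v, w, Int.toNat_natCast]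
  have hG : ∀ b : A, G t b = ∑ a, G t a * (if b = a then (1 : ℝ) else 0) := by
    intro b; simp
  rw [Finset.sum_congr rfl fun i _ => hG _, Finset.sum_comm, ← Finset.sum_sub_distrib]
  refine (Finset.abs_sum_le_sum_abs _ _).trans (Finset.sum_le_sum fun a _ => ?_)
  rw [← Finset.mul_sum, ← mul_sub, abs_mul]
  exact mul_le_mul_of_nonneg_left (T.abs_count_sub_le a j n _) (abs_nonneg _)

end Tower

/-- The translate by `k` of a two-sided sequence. -/
def shiftBy {A : Type*} (k : ℤ) (z : ℤ → A) : ℤ → A := fun j => z (j + k)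

theorem shiftBy_shiftBy {A : Type*} (k l : ℤ) (z : ℤ → A) :
    shiftBy k (shiftBy l z) = shiftBy (l + k) z := by
  funext j
  simp only [shiftBy]
  congr 1
  ring

/-- The function `F` depends only on the coordinates in `[-L, L]`. -/
def IsLocal {A β : Type*} (L : ℕ) (F : (ℤ → A) → β) : Prop :=
  ∀ z z' : ℤ → A, (∀ i : ℤ, |i| ≤ L → z i = z' i) → F z = F z'

namespace Tower

variable {A : Type*} [DecidableEq A] [Fintype A] (T : Tower A)

theorem exists_hasUniformMean_of_isLocal {L : ℕ} {F : (ℤ → A) → ℤ} (hF : IsLocal L F) :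
    ∃ n : ℕ, ∃ G : ℕ → A → ℤ, HasUniformMean (fun i => (F (shiftBy i (T.X 0)) : ℝ))
      ((∑ r ∈ Finset.range (T.P n), ∑ a, (G r a : ℝ) * T.f n a) / T.P n) := by
  obtain ⟨n, hn⟩ : ∃ n, 2 * L < T.P n :=
    ⟨2 * L, lt_of_lt_of_le Nat.lt_two_pow_self (T.two_pow_le_P _)⟩
  let u : ℤ → ℤ := fun i => F (shiftBy (i + L) (T.X 0))
  have hu : ∀ b b' : ℤ, T.X (n + 1) b = T.X (n + 1) b' → ∀ r < T.P (n + 1),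
      u (b * T.P (n + 1) + r) = u (b' * T.P (n + 1) + r) := by
    intro b b' h r hr
    refine hF _ _ fun i hi => ?_
    simp only [shiftBy]
    rw [abs_le] at hi
    obtain ⟨e, he⟩ : ∃ e : ℕ, (e : ℤ) = i + L := ⟨(i + L).toNat, Int.toNat_of_nonneg (by omega)⟩
    rcases lt_or_ge (r + e) (T.P (n + 1)) with hlt | hge
    · have h1 := T.X_congr (n + 1) hlt h
      push_cast at h1
      rw [he] at h1
      convert h1 using 2 <;> ring
    · obtain ⟨d, hd⟩ := Nat.exists_eq_add_of_le hge
      have h1 := T.X_head n (r := d) (by omega) (b + 1) (b' + 1)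
      have hd' : (d : ℤ) = r + (i + L) - T.P (n + 1) := by
        rw [← he]; zify at hd; linarith
      rw [hd'] at h1
      convert h1 using 2 <;> ring
  classical
  let G : ℕ → A → ℤ := fun r a =>
    if h : ∃ b, T.X (n + 1) b = a then u (h.choose * T.P (n + 1) + r) else 0
  have hG : ∀ b : ℤ, ∀ r < T.P (n + 1), (u (b * T.P (n + 1) + r) : ℝ) = G r (T.X (n + 1) b) := by
    intro b r hr
    have h : ∃ b', T.X (n + 1) b' = T.X (n + 1) b := ⟨b, rfl⟩
    simp only [G, dif_pos h]
    exact_mod_cast hu _ _ h.choose_spec.symm r hr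
  refine ⟨n + 1, G, ?_⟩
  have h := (T.hasUniformMean (n + 1) (u := fun i => (u i : ℝ))
    (G := fun r a => (G r a : ℝ)) hG).comp_add_right (-L)
  simpa [u] using h

theorem exists_recognition (n : ℕ) : ∃ L : ℕ, ∃ Φ : A → (ℤ → A) → Prop,
    (∀ a, IsLocal L (Φ a)) ∧
      ∀ a i, Φ a (shiftBy i (T.X 0)) ↔ ∃ b : ℤ, i = b * T.P n ∧ T.X n b = a := by
  induction n with
  | zero =>
    refine ⟨0, fun a z => z 0 = a, fun a z z' h => ?_, fun a i => ?_⟩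
    · simp only [h 0 (by simp)]
    · simp [shiftBy, P_zero]
  | succ n ih =>
    obtain ⟨L, Φ, hL, hΦ⟩ := ih
    obtain ⟨R, hR, hR1, hR2⟩ := T.marker n
    have hP : (T.P n : ℤ) ≠ 0 := by exact_mod_cast (T.P_pos n).ne'
    have hq : (0 : ℤ) < T.q n := by exact_mod_cast T.q_pos n
    obtain ⟨s, hs, hsc⟩ : ∃ s < T.q n, T.c n s = none := by
      have h := T.m_pos n
      rw [T.m_eq, Finset.card_pos] at h
      obtain ⟨s, hs⟩ := h
      rw [Finset.mem_filter, Finset.mem_range] at hs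
      exact ⟨s, hs⟩
    refine ⟨L + T.q n * T.P n, fun a z => (∀ t < R, Φ T.o (shiftBy (t * T.P n) z)) ∧
      Φ a (shiftBy (s * T.P n) z), fun a z z' h => ?_, fun a i => ?_⟩
    · have key : ∀ t ≤ T.q n, ∀ a, Φ a (shiftBy (t * T.P n) z) =
          Φ a (shiftBy (t * T.P n) z') := by
        intro t ht a
        refine hL a _ _ fun i hi => h _ ?_
        have h1 : (t : ℤ) * T.P n ≤ T.q n * T.P n := by
          exact_mod_cast Nat.mul_le_mul_right _ ht
        have h2 : (0 : ℤ) ≤ t * T.P n := by positivity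
        push_cast
        rw [abs_le] at hi ⊢
        constructor <;> linarith
      have h1 : (∀ t < R, Φ T.o (shiftBy (t * T.P n) z)) ↔
          ∀ t < R, Φ T.o (shiftBy (t * T.P n) z') :=
        forall₂_congr fun t ht => by rw [key t (by omega)]
      simp only [h1, key s hs.le]
    · simp only [shiftBy_shiftBy, hΦ]
      constructor
      · rintro ⟨h1, b₁, hb₁, hXa⟩
        set b₀ := b₁ - s with hb₀
        have hi : i = b₀ * T.P n := by rw [hb₀]; linear_combination hb₁
        have h1' : ∀ t < R, T.X n (b₀ + t) = T.o := by
          intro t ht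
          obtain ⟨b, hb, hX⟩ := h1 t ht
          have : b = b₀ + t := by
            apply mul_right_cancel₀ hP
            rw [← hb, hi]; ring
          rwa [← this]
        obtain ⟨t₀, ht₀⟩ : ∃ t : ℕ, b₀ % (T.q n : ℤ) = t :=
          ⟨(b₀ % (T.q n : ℤ)).toNat, (Int.toNat_of_nonneg (Int.emod_nonneg _ hq.ne')).symm⟩
        have ht₀q : t₀ < T.q n := by
          have := Int.emod_lt_of_pos b₀ hq
          rw [ht₀] at this
          exact_mod_cast this
        set β := b₀ / (T.q n : ℤ) with hβ
        have hb : b₀ = β * T.q n + t₀ := by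
          rw [← ht₀, hβ, mul_comm]
          exact (Int.mul_ediv_add_emod _ _).symm
        rcases Nat.eq_zero_or_pos t₀ with h0 | hpos
        · subst h0
          refine ⟨β, ?_, ?_⟩
          · rw [hi, hb, P_succ]; push_cast; ring
          · have h2 := T.X_block n β hs
            rw [hsc, Option.getD_none] at h2
            rw [← h2, ← hXa]
            congr 1
            have : b₁ = b₀ + s := by rw [hb₀]; ring
            rw [this, hb]; simp
        · obtain ⟨v, hv1, hv2, hv3, a', ha', hv⟩ := hR2 t₀ hpos ht₀q
          exfalso
          have h2 := T.X_block n β hv3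
          rw [hv, Option.getD_some] at h2
          have h3 := h1' (v - t₀) (by omega)
          rw [hb] at h3
          apply ha'
          rw [← h2, ← h3]
          congr 1
          push_cast [hv1]
          ring
      · rintro ⟨β, rfl, hX⟩
        refine ⟨fun t ht => ⟨β * T.q n + t, ?_, ?_⟩, β * T.q n + s, ?_, ?_⟩
        · rw [P_succ]; push_cast; ring
        · rw [T.X_block n β (by omega), hR1 t ht, Option.getD_some]
        · rw [P_succ]; push_cast; ring
        · rw [T.X_block n β hs, hsc, Option.getD_none, hX]

theorem exists_isLocal_hasUniformMean (n : ℕ) (a : A) : ∃ L : ℕ, ∃ F : (ℤ → A) → ℤ,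
    IsLocal L F ∧
      HasUniformMean (fun i => (F (shiftBy i (T.X 0)) : ℝ)) (T.f n a / T.P n) := by
  classical
  obtain ⟨L, Φ, hL, hΦ⟩ := T.exists_recognition n
  refine ⟨L, fun z => if Φ a z then 1 else 0, fun z z' h => ?_, ?_⟩
  · simp only [hL a z z' h]
  · have h := T.hasUniformMean n
      (u := fun i => (((if Φ a (shiftBy i (T.X 0)) then 1 else 0 : ℤ)) : ℝ))
      (G := fun r a' => if r = 0 then (if a' = a then 1 else 0) else 0) (by
        intro b r hr
        have hP : (0 : ℤ) < T.P n := by exact_mod_cast T.P_pos n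
        have key : (∃ b' : ℤ, b * T.P n + r = b' * T.P n ∧ T.X n b' = a) ↔
            r = 0 ∧ T.X n b = a := by
          constructor
          · rintro ⟨b', h1, h2⟩
            have h3 : (r : ℤ) = (b' - b) * T.P n := by linear_combination h1
            have h4 : (T.P n : ℤ) ∣ r := ⟨b' - b, by rw [h3]; ring⟩
            have h5 : r = 0 := Nat.eq_zero_of_dvd_of_lt (by exact_mod_cast h4) hr
            subst h5
            have : b = b' := mul_right_cancel₀ hP.ne' (by simpa using h1)
            exact ⟨rfl, this ▸ h2⟩
          · rintro ⟨rfl, h⟩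
            exact ⟨b, by simp, h⟩
        simp only [hΦ, key]
        by_cases h0 : r = 0 <;> by_cases h1 : T.X n b = a <;> simp [h0, h1])
    convert h using 2
    rw [Finset.sum_eq_single 0]
    · simp
    · intro r _ hr; simp [hr]
    · intro h0; exact absurd (Finset.mem_range.2 (T.P_pos n)) h0

theorem hasUniformMean_letter (a : A) :
    HasUniformMean (fun i => ((if T.X 0 i = a then 1 else 0 : ℤ) : ℝ)) (T.f 0 a) := by
  have h := T.hasUniformMean 0 (u := fun i => ((if T.X 0 i = a then 1 else 0 : ℤ) : ℝ))
    (G := fun _ a' => if a' = a then 1 else 0) (by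
      intro b r hr
      have : r = 0 := by simpa [P] using hr
      simp [this, P])
  simpa [P] using h

end Tower

@[simp] theorem shiftBy_zero {A : Type*} (z : ℤ → A) : shiftBy 0 z = z := by
  funext j
  simp [shiftBy]

theorem iterate_shift {A : Type*} (n : ℕ) (z : ℤ → A) : shift^[n] z = shiftBy n z := by
  induction n with
  | zero => simp
  | succ n ih =>
    rw [Function.iterate_succ_apply', ih]
    funext j
    simp only [shift, shiftBy]
    congr 1
    push_cast
    ring

theorem mem_zOrbit_shift_iff {A : Type*} (x y : ℤ → A) :
    y ∈ zOrbit shift x ↔ ∃ k : ℤ, y = shiftBy k x := by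
  constructor
  · rintro ⟨n, h | h⟩
    · exact ⟨n, by rw [← h, iterate_shift]⟩
    · refine ⟨-n, ?_⟩
      rw [← h, iterate_shift, shiftBy_shiftBy]
      simp
  · rintro ⟨k, rfl⟩
    obtain ⟨n, rfl | rfl⟩ := k.eq_nat_or_neg
    · exact ⟨n, Or.inl (iterate_shift n x)⟩
    · refine ⟨n, Or.inr ?_⟩
      rw [iterate_shift, shiftBy_shiftBy]
      simp

theorem shiftBy_mem_closure {A : Type*} [TopologicalSpace A] (x : ℤ → A) (k : ℤ) :
    shiftBy k x ∈ closure (zOrbit shift x) :=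
  subset_closure ((mem_zOrbit_shift_iff x _).2 ⟨k, rfl⟩)

theorem continuous_shiftBy {A : Type*} [TopologicalSpace A] (k : ℤ) :
    Continuous (shiftBy k : (ℤ → A) → ℤ → A) :=
  continuous_pi fun j => continuous_apply (j + k)

theorem continuous_shift {A : Type*} [TopologicalSpace A] :
    Continuous (shift : (ℤ → A) → ℤ → A) :=
  continuous_pi fun j => continuous_apply (j + 1)

theorem IsLocal.continuous {A β : Type*} [TopologicalSpace A] [DiscreteTopology A]
    [TopologicalSpace β] {L : ℕ} {F : (ℤ → A) → β} (hF : IsLocal L F) : Continuous F := by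
  rcases isEmpty_or_nonempty (ℤ → A) with h | ⟨⟨z₀⟩⟩
  · exact continuous_of_const fun z => (h.false z).elim
  let I : Finset ℤ := Finset.Icc (-L) L
  let g : (I → A) → β := fun w => F fun i => if h : i ∈ I then w ⟨i, h⟩ else z₀ i
  have hg : F = g ∘ fun z i => z i := by
    funext z
    refine hF _ _ fun i hi => ?_
    have : i ∈ I := Finset.mem_Icc.2 (abs_le.1 hi)
    simp [this]
  rw [hg]
  exact (continuous_of_discreteTopology (f := g)).comp
    (continuous_pi fun i => continuous_apply (i : ℤ))

/-- A continuous integer-valued function on a closed subset is the restriction of a function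
depending on finitely many coordinates. -/
theorem exists_isLocal_of_continuous {A : Type*} [Fintype A] [TopologicalSpace A]
    [DiscreteTopology A] {X : Set (ℤ → A)} (hX : IsClosed X) (f : C(X, ℤ)) :
    ∃ L : ℕ, ∃ F : (ℤ → A) → ℤ, IsLocal L F ∧ ∀ z : X, F z = f z := by
  have hXc : CompactSpace X := isCompact_iff_compactSpace.1 hX.isCompact
  let U : ℕ → Set X := fun L =>
    {z | ∀ z' : X, (∀ i : ℤ, |i| ≤ L → (z' : ℤ → A) i = (z : ℤ → A) i) → f z' = f z}
  have hcyl : ∀ (L : ℕ) (z : X),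
      {z' : X | ∀ i : ℤ, |i| ≤ L → (z' : ℤ → A) i = (z : ℤ → A) i} ∈ 𝓝 z := by
    intro L z
    have hloc : IsLocal L (fun w : ℤ → A => (∀ i : ℤ, |i| ≤ L → w i = (z : ℤ → A) i)) :=
      fun w w' h => propext (forall₂_congr fun i hi => by rw [h i hi])
    have hopen : IsOpen {w : ℤ → A | ∀ i : ℤ, |i| ≤ L → w i = (z : ℤ → A) i} := by
      let _ : TopologicalSpace Prop := ⊥
      have : DiscreteTopology Prop := ⟨rfl⟩
      have h := (isOpen_discrete ({True} : Set Prop)).preimage hloc.continuous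
      convert h using 1
      ext w
      simp
    exact (hopen.preimage continuous_subtype_val).mem_nhds fun i _ => rfl
  have hUo : ∀ L, IsOpen (U L) := by
    intro L
    refine isOpen_iff_mem_nhds.2 fun z hz => Filter.mem_of_superset (hcyl L z) fun z' hz' z'' hz'' => ?_
    rw [hz z'' fun i hi => (hz'' i hi).trans (hz' i hi), hz z' hz']
  have hUc : Set.univ ⊆ ⋃ L, U L := by
    intro z _
    have h1 : f ⁻¹' {f z} ∈ 𝓝 z := f.continuous.continuousAt.preimage_mem_nhds (by simp)
    rw [nhds_subtype_eq_comap, Filter.mem_comap, nhds_pi] at h1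
    obtain ⟨t, ht, hsub⟩ := h1
    obtain ⟨I, hI, s, hs, hIs⟩ := Filter.mem_pi.1 ht
    obtain ⟨B, hB⟩ := (hI.image fun i : ℤ => i.natAbs).bddAbove
    refine Set.mem_iUnion.2 ⟨B, fun z' hz' => hsub (hIs fun i hi => ?_)⟩
    have hiB : i.natAbs ≤ B := hB ⟨i, hi, rfl⟩
    rw [hz' i (by rw [Int.abs_eq_natAbs]; exact_mod_cast hiB)]
    exact mem_of_mem_nhds (hs i)
  have hdir : Directed (· ⊆ ·) U := directed_of_isDirected_le fun L L' hL z hz z' h =>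
    hz z' fun i hi => h i (hi.trans (by exact_mod_cast hL))
  obtain ⟨L, hL⟩ := isCompact_univ.elim_directed_cover U hUo hUc hdir
  classical
  let F : (ℤ → A) → ℤ := fun w =>
    if h : ∃ z : X, ∀ i : ℤ, |i| ≤ L → (z : ℤ → A) i = w i then f h.choose else 0
  have hFX : ∀ (z : X) (w : ℤ → A), (∀ i : ℤ, |i| ≤ L → (z : ℤ → A) i = w i) → F w = f z := by
    intro z w hw
    have h : ∃ z : X, ∀ i : ℤ, |i| ≤ L → (z : ℤ → A) i = w i := ⟨z, hw⟩
    simp only [F, dif_pos h]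
    exact hL (Set.mem_univ z) _ fun i hi => (h.choose_spec i hi).trans (hw i hi).symm
  refine ⟨L, F, fun w w' hw => ?_, fun z => hFX z z fun _ _ => rfl⟩
  by_cases h : ∃ z : X, ∀ i : ℤ, |i| ≤ L → (z : ℤ → A) i = w i
  · obtain ⟨z, hz⟩ := h
    rw [hFX z w hz, hFX z w' fun i hi => (hz i hi).trans (hw i hi)]
  · have h' : ¬ ∃ z : X, ∀ i : ℤ, |i| ≤ L → (z : ℤ → A) i = w' i := fun ⟨z, hz⟩ =>
      h ⟨z, fun i hi => (hz i hi).trans (hw i hi).symm⟩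
    simp only [F, dif_neg h, dif_neg h']

section Measure

variable {A : Type*} [Fintype A] [TopologicalSpace A] [DiscreteTopology A] [MeasurableSpace A]
  [BorelSpace A]

theorem IsLocal.integrable {L : ℕ} {F : (ℤ → A) → ℤ} (hF : IsLocal L F)
    (ν : ProbabilityMeasure (ℤ → A)) : Integrable (fun z => (F z : ℝ)) ν.toMeasure := by
  have hc : Continuous fun z => (F z : ℝ) :=
    (continuous_of_discreteTopology (f := fun n : ℤ => (n : ℝ))).comp hF.continuous
  exact (BoundedContinuousFunction.mkOfCompact ⟨_, hc⟩).integrable _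

theorem IsInvariantOn.measurePreserving {X : Set (ℤ → A)} {ν : ProbabilityMeasure (ℤ → A)}
    (hν : IsInvariantOn X ν) : MeasurePreserving shift ν.toMeasure ν.toMeasure :=
  ⟨continuous_shift.measurable, Measure.ext fun B hB => by
    rw [Measure.map_apply continuous_shift.measurable hB, hν.1 B hB]⟩

theorem integral_eq_of_hasUniformMean {x : ℤ → A} {ν : ProbabilityMeasure (ℤ → A)}
    (hν : IsInvariantOn (closure (zOrbit shift x)) ν) {L : ℕ} {F : (ℤ → A) → ℤ}
    (hF : IsLocal L F) {α : ℝ} (hα : HasUniformMean (fun i => (F (shiftBy i x) : ℝ)) α) :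
    ∫ z, (F z : ℝ) ∂ν.toMeasure = α := by
  have hc : Continuous fun z => (F z : ℝ) :=
    (continuous_of_discreteTopology (f := fun n : ℤ => (n : ℝ))).comp hF.continuous
  have hmp : ∀ i : ℕ, MeasurePreserving (shiftBy (i : ℤ)) ν.toMeasure ν.toMeasure := by
    intro i
    have := hν.measurePreserving.iterate i
    rwa [show shift^[i] = (shiftBy (i : ℤ) : (ℤ → A) → ℤ → A) from funext (iterate_shift i)] at this
  have hint : ∀ i : ℕ, Integrable (fun z => (F (shiftBy (i : ℤ) z) : ℝ)) ν.toMeasure := fun i =>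
    (BoundedContinuousFunction.mkOfCompact
      ⟨_, hc.comp (continuous_shiftBy (i : ℤ))⟩).integrable _
  have hval : ∀ i : ℕ, ∫ z, (F (shiftBy (i : ℤ) z) : ℝ) ∂ν.toMeasure =
      ∫ z, (F z : ℝ) ∂ν.toMeasure := by
    intro i
    conv_rhs => rw [← (hmp i).map_eq]
    rw [integral_map (hmp i).measurable.aemeasurable hc.aestronglyMeasurable]
  refine eq_of_abs_sub_le_all fun ε hε => ?_
  obtain ⟨M, hM, H⟩ := hα ε hε
  have hM' : (0 : ℝ) < M := by exact_mod_cast hM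
  have hK : IsClosed {z : ℤ → A |
      |∑ i ∈ Finset.range M, (F (shiftBy (i : ℤ) z) : ℝ) - M * α| ≤ M * ε} :=
    have hs : Continuous fun z : ℤ → A => ∑ i ∈ Finset.range M, (F (shiftBy (i : ℤ) z) : ℝ) :=
      continuous_finsetSum _ fun i _ => hc.comp (continuous_shiftBy (i : ℤ))
    isClosed_le (hs.sub continuous_const).abs continuous_const
  have hsub : closure (zOrbit shift x) ⊆ {z : ℤ → A |
      |∑ i ∈ Finset.range M, (F (shiftBy (i : ℤ) z) : ℝ) - M * α| ≤ M * ε} := by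
    refine closure_minimal (fun y hy => ?_) hK
    obtain ⟨k, rfl⟩ := (mem_zOrbit_shift_iff x y).1 hy
    simpa only [Set.mem_ofPred_eq, shiftBy_shiftBy] using H k
  have hae : ∀ᵐ z ∂ν.toMeasure, z ∈ closure (zOrbit shift x) :=
    (mem_ae_iff_prob_eq_one isClosed_closure.measurableSet).2 hν.2
  have hb := norm_integral_le_of_norm_le_const (μ := ν.toMeasure) (C := M * ε)
    (f := fun z => ∑ i ∈ Finset.range M, (F (shiftBy (i : ℤ) z) : ℝ) - M * α)
    (hae.mono fun z hz => by simpa [Real.norm_eq_abs] using hsub hz)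
  rw [integral_sub (integrable_finsetSum _ fun i _ => hint i) (integrable_const _),
    integral_finsetSum _ fun i _ => hint i] at hb
  simp only [hval, Finset.sum_const, Finset.card_range, nsmul_eq_mul, integral_const,
    probReal_univ, one_smul, mul_one, Real.norm_eq_abs] at hb
  rw [← mul_sub, abs_mul, abs_of_pos hM'] at hb
  exact le_of_mul_le_mul_left hb hM'

end Measure

theorem ext_of_integral_isLocal {A : Type*} [MeasurableSpace A] {μ ν : ProbabilityMeasure (ℤ → A)}
    (h : ∀ (L : ℕ) (F : (ℤ → A) → ℤ), IsLocal L F →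
      ∫ z, (F z : ℝ) ∂ν.toMeasure = ∫ z, (F z : ℝ) ∂μ.toMeasure) : ν = μ := by
  suffices H : ν.toMeasure = μ.toMeasure from Subtype.ext H
  refine ext_of_generate_finite (measurableCylinders fun _ : ℤ => A)
    generateFrom_measurableCylinders.symm isPiSystem_measurableCylinders (fun t ht => ?_)
    (by simp)
  have htm : MeasurableSet t := MeasurableSet.of_mem_measurableCylinders ht
  obtain ⟨s, S, hS, rfl⟩ := (mem_measurableCylinders t).1 ht
  obtain ⟨B, hB⟩ := (s.image fun i : ℤ => i.natAbs).bddAbove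
  have hloc : IsLocal B ((cylinder s S).indicator (1 : (ℤ → A) → ℤ)) := by
    intro z z' hz
    have hmem : z ∈ cylinder s S ↔ z' ∈ cylinder s S := by
      simp only [mem_cylinder]
      have : s.restrict z = s.restrict z' := by
        funext i
        refine hz i ?_
        rw [Int.abs_eq_natAbs]
        exact_mod_cast hB (Finset.mem_coe.2 (Finset.mem_image_of_mem _ i.2))
      rw [this]
    by_cases hzs : z ∈ cylinder s S
    · rw [Set.indicator_of_mem hzs, Set.indicator_of_mem (hmem.1 hzs)]; rfl
    · rw [Set.indicator_of_notMem hzs, Set.indicator_of_notMem (mt hmem.2 hzs)]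
  have hcast : (fun z => (((cylinder s S).indicator (1 : (ℤ → A) → ℤ) z : ℤ) : ℝ)) =
      (cylinder s S).indicator (1 : (ℤ → A) → ℝ) := by
    funext z
    by_cases hzs : z ∈ cylinder s S <;> simp [hzs]
  have h1 := h B _ hloc
  rw [hcast, integral_indicator_one htm, integral_indicator_one htm] at h1
  exact (measureReal_eq_measureReal_iff).1 h1

/-- Reading of a hierarchy of partial patterns: `read q c k n b` is the letter at place `b` of the
level `n` sequence found at most `k` levels higher, if any. -/
def readLetter {A : Type*} (q : ℕ → ℕ) (c : ℕ → ℕ → Option A) : ℕ → ℕ → ℤ → Option A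
  | 0, n, b => c n (b % (q n : ℤ)).toNat
  | k + 1, n, b => (c n (b % (q n : ℤ)).toNat).or (readLetter q c k (n + 1) (b / (q n : ℤ)))

theorem exists_sequence_of_patterns {A : Type*} (o : A) (q : ℕ → ℕ) (c : ℕ → ℕ → Option A) :
    ∃ X : ℕ → ℤ → A, ∀ n b,
      X n b = (c n (b % (q n : ℤ)).toNat).getD (X (n + 1) (b / (q n : ℤ))) := by
  classical
  let X : ℕ → ℤ → A := fun n b =>
    if h : ∃ a k, ∀ l, k ≤ l → readLetter q c l n b = some a then h.choose else o
  have hX : ∀ n b a, (∃ k, ∀ l, k ≤ l → readLetter q c l n b = some a) → X n b = a := by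
    intro n b a ha
    have h : ∃ a k, ∀ l, k ≤ l → readLetter q c l n b = some a := ⟨a, ha⟩
    simp only [X, dif_pos h]
    obtain ⟨k, hk⟩ := ha
    obtain ⟨k', hk'⟩ := h.choose_spec
    have h1 := hk _ (le_max_left k k')
    rw [hk' _ (le_max_right k k')] at h1
    exact Option.some_injective _ h1
  refine ⟨X, fun n b => ?_⟩
  cases hc : c n (b % (q n : ℤ)).toNat with
  | some a =>
    refine hX n b a ⟨0, fun l _ => ?_⟩
    cases l <;> simp [readLetter, hc]
  | none =>
    have hs : ∀ l, readLetter q c (l + 1) n b = readLetter q c l (n + 1) (b / (q n : ℤ)) := by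
      intro l
      simp [readLetter, hc]
    rw [Option.getD_none]
    by_cases h : ∃ a k, ∀ l, k ≤ l → readLetter q c l (n + 1) (b / (q n : ℤ)) = some a
    · obtain ⟨a, k, hk⟩ := h
      rw [hX (n + 1) _ a ⟨k, hk⟩]
      refine hX n b a ⟨k + 1, fun l hl => ?_⟩
      obtain ⟨l, rfl⟩ := Nat.exists_eq_add_of_le' (show 1 ≤ l by omega)
      rw [hs]
      exact hk l (by omega)
    · have h' : ¬ ∃ a k, ∀ l, k ≤ l → readLetter q c l n b = some a := by
        rintro ⟨a, k, hk⟩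
        exact h ⟨a, k, fun l hl => by rw [← hs]; exact hk _ (by omega)⟩
      simp only [X, dif_neg h, dif_neg h']

theorem sum_range_getElem?_eq_count {A : Type*} [DecidableEq A] (K : List A) (a : A) :
    ∑ i ∈ Finset.range K.length, (if K[i]? = some a then 1 else 0) = K.count a := by
  induction K with
  | nil => simp
  | cons b K ih =>
    rw [List.length_cons, Finset.sum_range_succ']
    simp only [List.getElem?_cons_succ, List.getElem?_cons_zero, ih, List.count_cons,
      Option.some_inj, beq_iff_eq]

theorem exists_list_count_eq {A : Type*} [DecidableEq A] [Fintype A] (e : A → ℕ) :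
    ∃ K : List A, (∀ a, K.count a = e a) ∧ K.length = ∑ a, e a := by
  refine ⟨(∑ a, Multiset.replicate (e a) a).toList, fun a => ?_, ?_⟩
  · rw [← Multiset.coe_count, Multiset.coe_toList, Multiset.count_sum']
    simp [Multiset.count_replicate]
  · simp

theorem exists_letter_counts {A : Type*} [DecidableEq A] [Fintype A] [Nontrivial A] {f : A → ℝ}
    (hf : ∀ a, 0 < f a) (hs : ∑ a, f a = 1) (o : A) {d : ℕ} (hd : 0 < d) :
    ∃ (q m : ℕ) (C : A → ℕ) (g : A → ℝ), d ∣ q ∧ d ∣ m ∧ 0 < m ∧ q = m + ∑ a, C a ∧ m < C o ∧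
      (∀ a, 1 < C a) ∧ (∀ a, 0 < g a) ∧ ∑ a, g a = 1 ∧ ∀ a, (q : ℝ) * f a = C a + m * g a := by
  obtain ⟨m, hm⟩ : ∃ m, m = d * Fintype.card A := ⟨_, rfl⟩
  have hm0 : 0 < m := hm ▸ Nat.mul_pos hd Fintype.card_pos
  have hmA : Fintype.card A ≤ m := hm ▸ Nat.le_mul_of_pos_left _ hd
  have hmR : (0 : ℝ) < m := by exact_mod_cast hm0
  obtain ⟨k, hk⟩ : ∃ k : ℕ, ∀ a, (2 * m + 3 : ℝ) < k * f a := by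
    choose k hk using fun a => exists_nat_gt ((2 * m + 3 : ℝ) / f a)
    refine ⟨∑ a, k a, fun a => ?_⟩
    rw [← div_lt_iff₀ (hf a)]
    refine (hk a).trans_le ?_
    exact_mod_cast Finset.single_le_sum (f := k) (fun _ _ => Nat.zero_le _) (Finset.mem_univ a)
  obtain ⟨q, hq⟩ : ∃ q, q = d * k := ⟨_, rfl⟩
  have hqf : ∀ a, (2 * m + 3 : ℝ) < q * f a := by
    intro a
    refine (hk a).trans_le (mul_le_mul_of_nonneg_right ?_ (hf a).le)
    exact_mod_cast hq ▸ Nat.le_mul_of_pos_left _ hd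
  have hD : ∀ a, ∃ D : ℕ, (D : ℝ) < q * f a ∧ (q : ℝ) * f a ≤ D + 1 := by
    intro a
    have hpos : 0 < (q : ℝ) * f a := lt_trans (by positivity) (hqf a)
    have h1 : 0 < ⌈(q : ℝ) * f a⌉₊ := Nat.ceil_pos.2 hpos
    refine ⟨⌈(q : ℝ) * f a⌉₊ - 1, Nat.lt_ceil.1 (by omega), ?_⟩
    rw [Nat.cast_sub h1]
    simpa using Nat.le_ceil _
  choose D hD1 hD2 using hD
  let S := Finset.univ.erase o
  have hsplit : ∀ h : A → ℝ, ∑ a, h a = h o + ∑ a ∈ S, h a := fun h =>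
    (Finset.add_sum_erase _ h (Finset.mem_univ o)).symm
  have hqs : (q : ℝ) = q * f o + ∑ a ∈ S, q * f a := by
    rw [← hsplit fun a => (q : ℝ) * f a, ← Finset.mul_sum, hs, mul_one]
  have hDS : (∑ a ∈ S, (D a : ℝ)) ≤ ∑ a ∈ S, q * f a := Finset.sum_le_sum fun a _ => (hD1 a).le
  have hDS' : ∑ a ∈ S, q * f a ≤ ∑ a ∈ S, (D a : ℝ) + (m - 1) := by
    have h1 : ∑ a ∈ S, q * f a ≤ ∑ a ∈ S, ((D a : ℝ) + 1) := Finset.sum_le_sum fun a _ => hD2 a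
    have h2 : S.card + 1 ≤ m := by
      rw [Finset.card_erase_add_one (Finset.mem_univ o)]
      exact hmA
    have h3 : (S.card : ℝ) + 1 ≤ m := by exact_mod_cast h2
    rw [Finset.sum_add_distrib] at h1
    simp only [Finset.sum_const, nsmul_eq_mul, mul_one] at h1
    linarith
  have hle : m + ∑ a ∈ S, D a ≤ q := by
    have : (m : ℝ) + ∑ a ∈ S, (D a : ℝ) ≤ q := by linarith [hqf o]
    exact_mod_cast this
  let C : A → ℕ := Function.update D o (q - (m + ∑ a ∈ S, D a))
  have hCo : (C o : ℝ) = q - (m + ∑ a ∈ S, (D a : ℝ)) := by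
    simp only [C, Function.update_self]
    rw [Nat.cast_sub hle]
    push_cast
    rfl
  have hCa : ∀ a ≠ o, C a = D a := fun a ha => Function.update_of_ne ha _ _
  have hCS : ∑ a ∈ S, (C a : ℝ) = ∑ a ∈ S, (D a : ℝ) :=
    Finset.sum_congr rfl fun a ha => by rw [hCa a (Finset.ne_of_mem_erase ha)]
  have hCo' : (m + 3 : ℝ) < C o := by linarith [hqf o]
  have hsum : (q : ℝ) = m + ∑ a, (C a : ℝ) := by rw [hsplit, hCS, hCo]; ring
  have hmo : m < C o := by
    have : (m : ℝ) < C o := by linarith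
    exact_mod_cast this
  refine ⟨q, m, C, fun a => (q * f a - C a) / m, hq ▸ dvd_mul_right _ _, hm ▸ dvd_mul_right _ _,
    hm0, by exact_mod_cast hsum, hmo, fun a => ?_, fun a => ?_, ?_, fun a => ?_⟩
  · have : (1 : ℝ) < C a := by
      by_cases ha : a = o
      · rw [ha]; linarith
      · rw [hCa a ha]; linarith [hqf a, hD2 a]
    exact_mod_cast this
  · refine div_pos ?_ hmR
    by_cases ha : a = o
    · rw [ha]; linarith
    · rw [hCa a ha]; linarith [hD1 a]
  · rw [← Finset.sum_div, Finset.sum_sub_distrib, ← Finset.mul_sum, hs, mul_one, hsum]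
    field_simp
    ring
  · field_simp
    ring

theorem exists_pattern {A : Type*} [DecidableEq A] [Fintype A] {f : A → ℝ}
    (hf : ∀ a, 0 < f a) (hs : ∑ a, f a = 1) {o l : A} (hl : l ≠ o) {d : ℕ} (hd : 0 < d) :
    ∃ (q : ℕ) (c : ℕ → Option A) (m : ℕ) (g : A → ℝ), ((∀ a, 0 < g a) ∧ ∑ a, g a = 1) ∧
      m = ((Finset.range q).filter fun t => c t = none).card ∧ 2 ≤ q ∧ c 0 ≠ none ∧
      c (q - 1) ≠ none ∧ 0 < m ∧ 2 * m ≤ q ∧ d ∣ q ∧ d ∣ m ∧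
      (∀ a, (q : ℝ) * f a = (((Finset.range q).filter fun t => c t = some a).card : ℝ) + m * g a) ∧
      ∃ R ≤ q, (∀ t < R, c t = some o) ∧
        ∀ t, 0 < t → t < q → ∃ u, t ≤ u ∧ u < t + R ∧ u < q ∧ ∃ a, a ≠ o ∧ c u = some a := by
  have : Nontrivial A := ⟨l, o, hl⟩
  obtain ⟨q, m, C, g, hdq, hdm, hm, hqC, hmo, hC, hg, hgs, hfreq⟩ := exists_letter_counts hf hs o hd
  obtain ⟨K, hK, -⟩ := exists_list_count_eq fun a => if a = o then 0 else if a = l then C l - 2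
    else C a
  obtain ⟨W, hW⟩ : ∃ W, W = K ++ [l] := ⟨_, rfl⟩
  have hWo : ∀ a ∈ W, a ≠ o := by
    rintro a ha rfl
    rw [hW, List.mem_append, List.mem_singleton] at ha
    rcases ha with ha | ha
    · have := List.count_pos_iff.2 ha
      simp [hK] at this
    · exact hl ha.symm
  have hWc : ∀ a, C a = (if a = o then C o else 0) + (if a = l then 1 else 0) + W.count a := by
    intro a
    have := hC a
    rw [hW, List.count_append, hK]
    by_cases h1 : a = o
    · subst h1
      simp [hl, hl.symm]
    · by_cases h2 : a = l
      · subst h2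
        simp [h1]
        omega
      · simp [h1, h2, Ne.symm h2]
  have hlen : q = C o + (1 + (m + W.length)) := by
    have h1 : W.length = ∑ a, W.count a := by
      rw [← Multiset.coe_card, ← Multiset.sum_count_eq_card (s := Finset.univ) (by simp)]
      simp
    have h2 : ∑ a, C a = C o + 1 + W.length := by
      rw [Finset.sum_congr rfl fun a _ => hWc a, Finset.sum_add_distrib, Finset.sum_add_distrib, h1]
      simp
    omega
  have hWpos : 0 < W.length := by simp [hW]
  let c : ℕ → Option A := fun t => if t < C o then some o else if t = C o then some l else
    if t < C o + (1 + m) then none else W[t - (C o + (1 + m))]?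
  have hc1 : ∀ t < C o, c t = some o := fun t ht => by simp [c, ht]
  have hc2 : c (C o) = some l := by simp [c]
  have hc3 : ∀ t < m, c (C o + (1 + t)) = none := by
    intro t ht
    simp only [c]
    rw [if_neg (by omega), if_neg (by omega), if_pos (by omega)]
  have hc4 : ∀ t, c (C o + (1 + (m + t))) = W[t]? := by
    intro t
    simp only [c]
    rw [if_neg (by omega), if_neg (by omega), if_neg (by omega)]
    congr 1
    omega
  have hc5 : ∀ u, C o + (1 + m) ≤ u → u < q → ∃ a, a ≠ o ∧ c u = some a := by
    intro u hu huq
    obtain ⟨t, rfl⟩ := Nat.exists_eq_add_of_le hu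
    have ht : t < W.length := by omega
    refine ⟨W[t], hWo _ (List.getElem_mem ht), ?_⟩
    rw [show C o + (1 + m) + t = C o + (1 + (m + t)) by ring, hc4, List.getElem?_eq_getElem ht]
  have hcount : ∀ z : Option A, ((Finset.range q).filter fun t => c t = z).card =
      (if some o = z then C o else 0) + ((if some l = z then 1 else 0) +
        ((if none = z then m else 0) +
          ∑ i ∈ Finset.range W.length, if W[i]? = z then 1 else 0)) := by
    intro z
    rw [Finset.card_filter, hlen, Finset.sum_range_add, Finset.sum_range_add, Finset.sum_range_add]
    congr 1
    · rw [Finset.sum_congr rfl fun t ht => by rw [hc1 t (Finset.mem_range.1 ht)]]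
      simp
    congr 1
    · rw [Finset.sum_range_one, add_zero, hc2]
    congr 1
    · rw [Finset.sum_congr rfl fun t ht => by rw [hc3 t (Finset.mem_range.1 ht)]]
      simp
    · simp only [hc4]
  refine ⟨q, c, m, g, ⟨hg, hgs⟩, ?_, by omega, ?_, ?_, hm, by omega, hdq, hdm, fun a => ?_, C o,
    by omega, hc1, fun t ht htq => ?_⟩
  · rw [hcount]
    simp
  · simp [hc1 0 (by omega)]
  · obtain ⟨a, -, ha⟩ := hc5 (q - 1) (by omega) (by omega)
    simp [ha]
  · rw [hfreq a, hcount, sum_range_getElem?_eq_count, hWc a]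
    simp [eq_comm, add_assoc]
  · rcases le_or_gt t (C o) with h1 | h1
    · exact ⟨C o, h1, by omega, by omega, l, hl, hc2⟩
    · rcases le_or_gt (C o + (1 + m)) t with h2 | h2
      · exact ⟨t, le_rfl, by omega, htq, hc5 t h2 htq⟩
      · exact ⟨C o + (1 + m), h2.le, by omega, by omega, hc5 _ le_rfl (by omega)⟩

theorem Tower.exists_of_freq {A : Type*} [DecidableEq A] [Fintype A] {f : A → ℝ}
    (hf : ∀ a, 0 < f a) (hs : ∑ a, f a = 1) {o l : A} (hl : l ≠ o) :
    ∃ T : Tower A, T.f 0 = f := by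
  choose q c m g hg h using fun (n : ℕ) (v : {v : A → ℝ // (∀ a, 0 < v a) ∧ ∑ a, v a = 1}) =>
    exists_pattern v.2.1 v.2.2 hl n.succ_pos
  let F : ℕ → {v : A → ℝ // (∀ a, 0 < v a) ∧ ∑ a, v a = 1} := fun n =>
    n.rec ⟨f, hf, hs⟩ fun n v => ⟨g n v, hg n v⟩
  obtain ⟨X, hX⟩ := exists_sequence_of_patterns o (fun n => q n (F n)) (fun n => c n (F n))
  choose h1 h2 h3 h4 h5 h6 h7 h8 h9 h10 using h
  exact ⟨{
    q := fun n => q n (F n)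
    c := fun n => c n (F n)
    f := fun n => (F n).1
    o := o
    X := X
    m := fun n => m n (F n)
    m_eq := fun n => h1 n _
    two_le := fun n => h2 n _
    head := fun n => h3 n _
    last := fun n => h4 n _
    m_pos := fun n => h5 n _
    two_mul_m_le := fun n => h6 n _
    dvd_q := fun n => h7 n _
    dvd_m := fun n => h8 n _
    f_nonneg := fun n a => ((F n).2.1 a).le
    sum_f := fun n => (F n).2.2
    freq := fun n => h9 n _
    marker := fun n => h10 n _
    X_eq := hX }, rfl⟩

namespace Tower

variable {A : Type*} [DecidableEq A] [Fintype A] (T : Tower A)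

theorem dvd_P {d : ℕ} (hd : 0 < d) : d ∣ T.P d := by
  obtain ⟨n, rfl⟩ := Nat.exists_eq_succ_of_ne_zero hd.ne'
  exact T.P_succ n ▸ Dvd.dvd.mul_left (T.dvd_q n) _

theorem dvd_M {d : ℕ} (hd : 0 < d) : d ∣ T.M d := by
  obtain ⟨n, rfl⟩ := Nat.exists_eq_succ_of_ne_zero hd.ne'
  exact T.M_succ n ▸ Dvd.dvd.mul_left (T.dvd_m n) _

theorem exists_P_mul_f_zero_eq (n : ℕ) (a : A) :
    ∃ r : ℕ, (T.P n : ℝ) * T.f 0 a = r + T.M n * T.f n a := by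
  induction n with
  | zero => exact ⟨0, by simp [P, M]⟩
  | succ n ih =>
    obtain ⟨r, hr⟩ := ih
    refine ⟨r * T.q n + T.M n * ((Finset.range (T.q n)).filter fun t => T.c n t = some a).card, ?_⟩
    rw [P_succ, M_succ]
    push_cast
    linear_combination (T.q n : ℝ) * hr + (T.M n : ℝ) * T.freq n a

theorem one_mem_span : (1 : ℝ) ∈ Submodule.span ℚ (Set.range (T.f 0)) :=
  T.sum_f 0 ▸ Submodule.sum_mem _ fun a _ => Submodule.subset_span ⟨a, rfl⟩

theorem f_mem_span (n : ℕ) (a : A) : T.f n a ∈ Submodule.span ℚ (Set.range (T.f 0)) := by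
  obtain ⟨r, hr⟩ := T.exists_P_mul_f_zero_eq n a
  have hM : (T.M n : ℝ) ≠ 0 := by exact_mod_cast (T.M_pos n).ne'
  have h : T.f n a = (T.P n / T.M n : ℚ) • T.f 0 a - (r / T.M n : ℚ) • (1 : ℝ) := by
    simp only [Rat.smul_def]
    push_cast
    field_simp
    linarith
  rw [h]
  exact sub_mem (Submodule.smul_mem _ _ (Submodule.subset_span ⟨a, rfl⟩))
    (Submodule.smul_mem _ _ T.one_mem_span)

/-- The real numbers all of whose quotients by positive integers lie in a given subgroup. -/
def divisiblePart (J : AddSubgroup ℝ) : Submodule ℚ ℝ where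
  carrier := {v | ∀ d : ℕ, 0 < d → v / d ∈ J}
  zero_mem' := fun d _ => by simp
  add_mem' := fun hv hw d hd => by
    rw [add_div]
    exact add_mem (hv d hd) (hw d hd)
  smul_mem' := fun c v hv d hd => by
    have h := zsmul_mem (hv (c.den * d) (Nat.mul_pos c.pos hd)) c.num
    convert h using 1
    rw [Rat.smul_def, zsmul_eq_mul]
    nth_rewrite 1 [Rat.cast_def]
    push_cast
    ring

theorem coe_eq_span {J : AddSubgroup ℝ} (hJ : ∀ n a, T.f n a / T.P n ∈ J)
    (hJ' : ∀ v ∈ J, ∃ n, ∃ G : ℕ → A → ℤ,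
      v = (∑ r ∈ Finset.range (T.P n), ∑ a, (G r a : ℝ) * T.f n a) / T.P n) :
    (J : Set ℝ) = Submodule.span ℚ (Set.range (T.f 0)) := by
  refine Set.Subset.antisymm (fun v hv => ?_) ?_
  · obtain ⟨n, G, rfl⟩ := hJ' v hv
    have h : (∑ r ∈ Finset.range (T.P n), ∑ a, (G r a : ℝ) * T.f n a) / T.P n =
        (1 / T.P n : ℚ) • ∑ r ∈ Finset.range (T.P n), ∑ a, (G r a : ℚ) • T.f n a := by
      simp only [Rat.smul_def]
      push_cast
      ring
    rw [h]
    exact Submodule.smul_mem _ _ (Submodule.sum_mem _ fun r _ => Submodule.sum_mem _ fun a _ =>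
      Submodule.smul_mem _ _ (T.f_mem_span n a))
  · have hinv : ∀ d : ℕ, 0 < d → (1 : ℝ) / d ∈ J := by
      intro d hd
      obtain ⟨k, hk⟩ := T.dvd_P hd
      have h1 : (1 : ℝ) / T.P d ∈ J := by
        rw [← T.sum_f d, Finset.sum_div]
        exact sum_mem fun a _ => hJ d a
      have hP : ((d * k : ℕ) : ℝ) ≠ 0 := by exact_mod_cast hk ▸ (T.P_pos d).ne'
      have h2 := nsmul_mem h1 k
      rw [hk, nsmul_eq_mul] at h2
      convert h2 using 1
      push_cast at hP ⊢
      have := right_ne_zero_of_mul hP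
      have := left_ne_zero_of_mul hP
      field_simp
    have hle : Submodule.span ℚ (Set.range (T.f 0)) ≤ divisiblePart J := by
      refine Submodule.span_le.2 ?_
      rintro _ ⟨a, rfl⟩ d hd
      obtain ⟨r, hr⟩ := T.exists_P_mul_f_zero_eq d a
      obtain ⟨k, hk⟩ := T.dvd_M hd
      have hP : (T.P d : ℝ) ≠ 0 := by exact_mod_cast (T.P_pos d).ne'
      have hd' : (d : ℝ) ≠ 0 := by exact_mod_cast hd.ne'
      have h := add_mem (nsmul_mem (hinv (d * T.P d) (Nat.mul_pos hd (T.P_pos d))) r)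
        (nsmul_mem (hJ d a) k)
      convert h using 1
      rw [hk] at hr
      simp only [nsmul_eq_mul]
      push_cast at hr ⊢
      field_simp
      linarith
    intro v hv
    simpa using hle hv 1 one_pos

end Tower

/-- The integrals of the integer-valued functions depending on finitely many coordinates. -/
noncomputable def localIntegrals {A : Type*} [Fintype A] [TopologicalSpace A] [DiscreteTopology A]
    [MeasurableSpace A] [BorelSpace A] (μ : ProbabilityMeasure (ℤ → A)) : AddSubgroup ℝ where
  carrier := {r | ∃ L : ℕ, ∃ F : (ℤ → A) → ℤ, IsLocal L F ∧ r = ∫ z, (F z : ℝ) ∂μ.toMeasure}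
  zero_mem' := ⟨0, fun _ => 0, fun _ _ _ => rfl, by simp⟩
  add_mem' := by
    rintro _ _ ⟨L, F, hF, rfl⟩ ⟨L', F', hF', rfl⟩
    refine ⟨max L L', F + F', fun z z' h => ?_, ?_⟩
    · simp only [Pi.add_apply]
      rw [hF z z' fun i hi => h i (hi.trans (by exact_mod_cast le_max_left L L')),
        hF' z z' fun i hi => h i (hi.trans (by exact_mod_cast le_max_right L L'))]
    · rw [← integral_add (hF.integrable μ) (hF'.integrable μ)]
      simp
  neg_mem' := by
    rintro _ ⟨L, F, hF, rfl⟩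
    refine ⟨L, -F, fun z z' h => by simp only [Pi.neg_apply, hF z z' h], ?_⟩
    rw [← integral_neg]
    simp

theorem setOf_integral_comap_eq {A : Type*} [Fintype A] [TopologicalSpace A] [DiscreteTopology A]
    [MeasurableSpace A] [BorelSpace A] {μ : ProbabilityMeasure (ℤ → A)} {X : Set (ℤ → A)}
    (hX : IsClosed X) (hμ : μ.toMeasure X = 1) :
    {r : ℝ | ∃ f : C(X, ℤ), r = ∫ z, ((f z : ℤ) : ℝ)
      ∂(μ.toMeasure.comap (Subtype.val : X → (ℤ → A)))} = localIntegrals μ := by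
  have hae : ∀ᵐ z ∂μ.toMeasure, z ∈ X := (mem_ae_iff_prob_eq_one hX.measurableSet).2 hμ
  have hint : ∀ F : (ℤ → A) → ℤ, ∫ z : X, (F z : ℝ) ∂(μ.toMeasure.comap Subtype.val) =
      ∫ z, (F z : ℝ) ∂μ.toMeasure := by
    intro F
    rw [integral_subtype_comap hX.measurableSet fun z => (F z : ℝ),
      Measure.restrict_eq_self_of_ae_mem hae]
  ext r
  constructor
  · rintro ⟨f, rfl⟩
    obtain ⟨L, F, hF, hf⟩ := exists_isLocal_of_continuous hX f
    refine ⟨L, F, hF, ?_⟩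
    rw [← hint]
    simp only [hf]
  · rintro ⟨L, F, hF, rfl⟩
    exact ⟨⟨fun z => F z, hF.continuous.comp continuous_subtype_val⟩, (hint F).symm⟩

/-- The subshift generated by a tower is uniquely ergodic, with letter frequencies `T.f 0`, and the
integrals of its continuous integer-valued functions form the rational span of these. -/
theorem Tower.exists_unique_isInvariantOn {A : Type*} [DecidableEq A] [Fintype A]
    [TopologicalSpace A] [DiscreteTopology A] [MeasurableSpace A] [BorelSpace A] (T : Tower A) :
    ∃ μ : ProbabilityMeasure (ℤ → A), IsInvariantOn (closure (zOrbit shift (T.X 0))) μ ∧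
      (∀ ν, IsInvariantOn (closure (zOrbit shift (T.X 0))) ν → ν = μ) ∧
      (∀ a, μ.toMeasure {z | z ∈ closure (zOrbit shift (T.X 0)) ∧ z 0 = a} =
        ENNReal.ofReal (T.f 0 a)) ∧
      (localIntegrals μ : Set ℝ) = Submodule.span ℚ (Set.range (T.f 0)) := by
  obtain ⟨μ, hμ, hμX⟩ := exists_invariant_probabilityMeasure (continuous_shift (A := A)) (T.X 0)
    (isClosed_closure (s := zOrbit shift (T.X 0)))
    fun n => iterate_shift n (T.X 0) ▸ shiftBy_mem_closure (T.X 0) n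
  have hinv : IsInvariantOn (closure (zOrbit shift (T.X 0))) μ :=
    ⟨fun B hB => by rw [← Measure.map_apply continuous_shift.measurable hB, hμ], hμX⟩
  refine ⟨μ, hinv, fun ν hν => ext_of_integral_isLocal fun L F hF => ?_, fun a => ?_,
    T.coe_eq_span (fun n a => ?_) ?_⟩
  · obtain ⟨n, G, h⟩ := T.exists_hasUniformMean_of_isLocal hF
    rw [integral_eq_of_hasUniformMean hν hF h, integral_eq_of_hasUniformMean hinv hF h]
  · have hF : IsLocal 0 fun z : ℤ → A => (if z 0 = a then 1 else 0 : ℤ) := fun z z' h => by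
      simp only [h 0 (by simp)]
    have h := integral_eq_of_hasUniformMean hinv hF (α := T.f 0 a)
      (by simpa [shiftBy] using T.hasUniformMean_letter a)
    have hm : MeasurableSet {z : ℤ → A | z 0 = a} :=
      measurableSet_eq_fun (measurable_pi_apply 0) measurable_const
    have hind : (fun z : ℤ → A => ((if z 0 = a then 1 else 0 : ℤ) : ℝ)) =
        {z : ℤ → A | z 0 = a}.indicator 1 := by
      funext z
      by_cases hz : z 0 = a <;> simp [hz]
    rw [hind, integral_indicator_one hm] at h
    have hae : ∀ᵐ z ∂μ.toMeasure, z ∈ closure (zOrbit shift (T.X 0)) :=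
      (mem_ae_iff_prob_eq_one isClosed_closure.measurableSet).2 hμX
    rw [← h, ofReal_measureReal]
    exact measure_congr (hae.mono fun z hz => propext (and_iff_right hz))
  · obtain ⟨L, F, hF, h⟩ := T.exists_isLocal_hasUniformMean n a
    exact ⟨L, F, hF, (integral_eq_of_hasUniformMean hinv hF h).symm⟩
  · rintro _ ⟨L, F, hF, rfl⟩
    obtain ⟨n, G, h⟩ := T.exists_hasUniformMean_of_isLocal hF
    exact ⟨n, G, integral_eq_of_hasUniformMean hinv hF h⟩

theorem exists_rational_translate_mem_Ioc (x : ℝ) {δ : ℝ} (hδ : 0 < δ) :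
    ∃ y : ℝ, (∃ q : ℚ, y - x = q) ∧ 0 < y ∧ y ≤ δ := by
  obtain ⟨q, h1, h2⟩ := exists_rat_btwn (show -x < δ - x by linarith)
  exact ⟨x + q, ⟨q, by ring⟩, by linarith, by linarith⟩

theorem stmt12 (N : ℕ) (hN : 2 ≤ N) (x : Fin (N - 1) → ℝ) :
    ∃ y : Fin (N - 1) → ℝ,
      (∀ i, (∃ q : ℚ, y i - x i = (q : ℝ)) ∧ 0 < y i ∧ y i ≤ 1 / (N : ℝ)) ∧
      ∃ X : Set (ℤ → Fin N), IsRegularToeplitzSubshift X ∧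
        ∃ μ : ProbabilityMeasure (ℤ → Fin N), IsInvariantOn X μ ∧
          (∀ ν : ProbabilityMeasure (ℤ → Fin N), IsInvariantOn X ν → ν = μ) ∧
          (∀ i : Fin (N - 1),
            μ.toMeasure {z : ℤ → Fin N | z ∈ X ∧ z 0 = Fin.castLE (Nat.sub_le N 1) i} =
              ENNReal.ofReal (y i)) ∧
          {r : ℝ | ∃ f : C(X, ℤ),
              r = ∫ z, ((f z : ℤ) : ℝ)
                ∂(μ.toMeasure.comap (Subtype.val : X → (ℤ → Fin N)))} =
            (Submodule.span ℚ ({1} ∪ Set.range x) : Set ℝ) := by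
  obtain ⟨n, rfl⟩ := Nat.exists_eq_add_of_le' hN
  have hN0 : (0 : ℝ) < 1 / ((n + 2 : ℕ) : ℝ) := by positivity
  choose y hy using fun i => exists_rational_translate_mem_Ioc (x i) hN0
  have hsum : ∑ i, y i < 1 := by
    calc ∑ i, y i ≤ ∑ _i : Fin (n + 2 - 1), 1 / ((n + 2 : ℕ) : ℝ) :=
          Finset.sum_le_sum fun i _ => (hy i).2.2
      _ < 1 := by
        simp only [Finset.sum_const, Finset.card_univ, Fintype.card_fin, nsmul_eq_mul]
        rw [mul_one_div, div_lt_one (by positivity)]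
        exact_mod_cast (by omega : n + 2 - 1 < n + 2)
  let f : Fin (n + 2) → ℝ := Fin.snoc (α := fun _ => ℝ) (n := n + 1) y (1 - ∑ i, y i)
  have hfc : ∀ i : Fin (n + 1), f (Fin.castSucc i) = y i := fun i =>
    Fin.snoc_castSucc (α := fun _ => ℝ) _ _ i
  have hfl : f (Fin.last (n + 1)) = 1 - ∑ i, y i := Fin.snoc_last (α := fun _ => ℝ) _ _
  have hf : ∀ a, 0 < f a := by
    intro a
    refine Fin.lastCases ?_ (fun i => ?_) a
    · rw [hfl]; linarith
    · rw [hfc]; exact (hy i).2.1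
  have hs : ∑ a, f a = 1 := by
    rw [Fin.sum_univ_castSucc, hfl]
    simp only [hfc]
    exact add_sub_cancel _ _
  obtain ⟨T, hT⟩ := Tower.exists_of_freq hf hs (o := 0) (l := 1) (by simp)
  obtain ⟨μ, hμ, huniq, hfreq, hJ⟩ := T.exists_unique_isInvariantOn
  refine ⟨y, hy, closure (zOrbit shift (T.X 0)), ⟨T.X 0, T.isRegularToeplitz, rfl⟩, μ, hμ, huniq,
    fun i => ?_, ?_⟩
  · rw [← hfc, ← hT]
    exact hfreq _
  · rw [setOf_integral_comap_eq isClosed_closure hμ.2, hJ, hT]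
    have h1f : (1 : ℝ) ∈ Submodule.span ℚ (Set.range f) := hT ▸ T.one_mem_span
    have hyx : ∀ i, ∃ q : ℚ, y i = x i + q • (1 : ℝ) := fun i => by
      obtain ⟨q, hq⟩ := (hy i).1
      exact ⟨q, by rw [Rat.smul_def]; linarith⟩
    have hyV : ∀ i, y i ∈ Submodule.span ℚ ({1} ∪ Set.range x) := by
      intro i
      obtain ⟨q, hq⟩ := hyx i
      rw [hq]
      exact add_mem (Submodule.subset_span (Or.inr ⟨i, rfl⟩))
        (Submodule.smul_mem _ _ (Submodule.subset_span (Or.inl rfl)))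
    congr 1
    refine le_antisymm (Submodule.span_le.2 ?_) (Submodule.span_le.2 ?_)
    · rintro _ ⟨a, rfl⟩
      refine Fin.lastCases ?_ (fun i => ?_) a
      · rw [hfl]
        exact sub_mem (Submodule.subset_span (Or.inl rfl)) (sum_mem fun i _ => hyV i)
      · rw [hfc]
        exact hyV i
    · rintro _ (rfl | ⟨i, rfl⟩)
      · exact h1f
      · obtain ⟨q, hq⟩ := hyx i
        rw [show x i = f (Fin.castSucc (n := n + 1) i) - q • (1 : ℝ) by rw [hfc, hq]; ring]
        exact sub_mem (Submodule.subset_span ⟨_, rfl⟩) (Submodule.smul_mem _ _ h1f)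
end

section
/- The equivalence relation F_2 on ℝ is not smooth: there is no Borel measurable map f : ℝ → (ℕ → Bool) such that for all x, y ∈ ℝ, x F_2 y if and only if f(x) = f(y). -/
/-- The equivalence relation `F₂` on `ℝ`: `x F₂ y` iff some `M ∈ GL(2,ℚ)` carries the
row vector `(x,1)` to `(y,1)`. -/
def F2 (x y : ℝ) : Prop :=
  ∃ M : GL (Fin 2) ℚ,
    Matrix.vecMul ![x, 1]
      ((M : Matrix (Fin 2) (Fin 2) ℚ).map (fun q : ℚ => (q : ℝ))) = ![y, 1]

/-- An integral affine map of slope two moves points inside their `F₂`-class. -/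
lemma F2_two_mul_add_int (x : ℝ) (n : ℤ) : F2 x (2 * x + n) := by
  refine ⟨Matrix.GeneralLinearGroup.mkOfDetNeZero !![2, 0; (n : ℚ), 1] (by simp), ?_⟩
  ext i
  fin_cases i <;>
    simp [Matrix.GeneralLinearGroup.mkOfDetNeZero, Matrix.vecMul, dotProduct, Fin.sum_univ_two,
      mul_comm]

/-- Every `F₂`-class is countable. -/
lemma countable_setOf_F2 (x : ℝ) : {y : ℝ | F2 x y}.Countable := by
  have : Countable (GL (Fin 2) ℚ) :=
    have : Countable (Matrix (Fin 2) (Fin 2) ℚ) :=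
      inferInstanceAs (Countable (Fin 2 → Fin 2 → ℚ))
    Units.val_injective.countable
  refine (Set.countable_range fun M : GL (Fin 2) ℚ => Matrix.vecMul ![x, 1]
    ((M : Matrix (Fin 2) (Fin 2) ℚ).map (fun q : ℚ => (q : ℝ))) 0).mono ?_
  rintro y ⟨M, hM⟩
  exact ⟨M, by simp only [hM, Matrix.cons_val_zero]⟩

theorem stmt13 :
    ¬ ∃ f : ℝ → (ℕ → Bool), Measurable f ∧ ∀ x y : ℝ, (F2 x y ↔ f x = f y) := by
  rintro ⟨f, hf, hF⟩
  have : Fact (0 < (1 : ℝ)) := ⟨one_pos⟩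
  let lift : AddCircle (1 : ℝ) → ℝ := fun y => AddCircle.measurableEquivIco 1 0 y
  have lift_meas : Measurable lift :=
    measurable_subtype_coe.comp (AddCircle.measurableEquivIco 1 0).measurable
  have coe_lift (y) : (lift y : AddCircle (1 : ℝ)) = y :=
    (AddCircle.equivIco 1 0).symm_apply_apply y
  have lift_inj : Function.Injective lift := Function.LeftInverse.injective coe_lift
  have invariant : (f ∘ lift) ∘ (fun y : AddCircle (1 : ℝ) => 2 • y) = f ∘ lift := by
    funext y
    have h : ((lift (2 • y) - 2 * lift y : ℝ) : AddCircle (1 : ℝ)) = 0 := by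
      rw [AddCircle.coe_sub, two_mul, AddCircle.coe_add, coe_lift, coe_lift, two_nsmul, sub_self]
    obtain ⟨n, hn⟩ := (AddCircle.coe_eq_zero_iff (1 : ℝ)).1 h
    have hn' : lift (2 • y) = 2 * lift y + n := by
      rw [zsmul_eq_mul, mul_one] at hn
      linarith
    refine ((hF _ _).1 ?_).symm
    rw [hn']
    exact F2_two_mul_add_int _ _
  obtain ⟨c, hc⟩ := (AddCircle.ergodic_nsmul (T := 1) one_lt_two).toPreErgodic
    |>.ae_eq_const_of_ae_eq_comp (hf.comp lift_meas) invariant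
  obtain ⟨y₀, hy₀⟩ := hc.exists
  have countable_fiber : {y | f (lift y) = c}.Countable := by
    refine ((countable_setOf_F2 (lift y₀)).preimage lift_inj).mono fun y hy => ?_
    exact (hF _ _).2 (hy₀.trans hy.symm)
  have : MeasureTheory.NullSingletonClass
      (MeasureTheory.volume : MeasureTheory.Measure (AddCircle (1 : ℝ))) :=
    ⟨fun x => by rw [← Metric.closedBall_zero, AddCircle.volume_closedBall]; simp⟩
  have null := countable_fiber.measure_zero (MeasureTheory.volume : MeasureTheory.Measure _)
  obtain ⟨y, hy, hy'⟩ := (hc.and (MeasureTheory.measure_eq_zero_iff_ae_notMem.1 null)).exists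
  exact hy' hy
end

section
/- For every integer n ≥ 4, the equivalence relation F_n on ℝ^{n−1} is not hyperfinite: there is no Borel measurable map f : ℝ^{n−1} → (ℕ → Bool) such that for all x, y ∈ ℝ^{n−1}, x F_n y if and only if f(x) E_0 f(y). -/
/-- Extend `x ∈ ℝ^{n-1}` to the row vector `(x_1, …, x_{n-1}, 1) ∈ ℝ^n`. -/
def extend1 {N : ℕ} (x : Fin (N - 1) → ℝ) : Fin N → ℝ :=
  fun i => if h : (i : ℕ) < N - 1 then x ⟨i, h⟩ else 1

/-- The equivalence relation `F_n` on `ℝ^{n-1}`. -/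
def FN (N : ℕ) (x y : Fin (N - 1) → ℝ) : Prop :=
  ∃ M : GL (Fin N) ℚ,
    Matrix.vecMul (extend1 x)
      ((M : Matrix (Fin N) (Fin N) ℚ).map (fun q : ℚ => (q : ℝ))) = extend1 y

/-- The equivalence relation `E₀` of eventual equality on `ℕ → Bool`. -/
def E0 (x y : ℕ → Bool) : Prop := ∃ n : ℕ, ∀ m ≥ n, x m = y m


open MeasureTheory Filter Topology

/-- The coordinate shear `m ↦ m + k m_j e_i`. -/
def shear {G : Type*} [AddCommGroup G] (i j : Fin 2) (k : ℤ) (m : Fin 2 → G) : Fin 2 → G :=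
  fun l => if l = i then m i + k • m j else m l

section Shear

variable {G : Type*} [AddCommGroup G]

theorem shear_neg_shear {i j : Fin 2} (h : i ≠ j) (k : ℤ) (m : Fin 2 → G) :
    shear i j (-k) (shear i j k m) = m := by
  funext l
  by_cases hl : l = i
  · subst hl
    simp [shear, h.symm]
  · simp [shear, hl]

/-- The coordinate shear as an additive equivalence. -/
def shearEquiv {i j : Fin 2} (h : i ≠ j) (k : ℤ) : (Fin 2 → G) ≃+ (Fin 2 → G) where
  toFun := shear i j k
  invFun := shear i j (-k)
  left_inv := shear_neg_shear h k
  right_inv m := by simpa using shear_neg_shear h (-k) m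
  map_add' x y := by
    funext l
    by_cases hl : l = i
    · simp only [shear, hl, if_true, Pi.add_apply, smul_add]
      abel
    · simp [shear, hl]

end Shear

/-- The indicator function of the cone of nonzero `m` with `|m i| ≤ |m j|`. -/
noncomputable def coneInd (i j : Fin 2) (m : Fin 2 → ℤ) : ℝ :=
  if m ≠ 0 ∧ |m i| ≤ |m j| then 1 else 0

theorem coneInd_nonneg (i j : Fin 2) (m : Fin 2 → ℤ) : 0 ≤ coneInd i j m := by
  unfold coneInd; split_ifs <;> norm_num

theorem coneInd_le_one (i j : Fin 2) (m : Fin 2 → ℤ) : coneInd i j m ≤ 1 := by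
  unfold coneInd; split_ifs <;> norm_num

theorem fin_two_ne_zero {i j : Fin 2} (h : i ≠ j) {m : Fin 2 → ℤ} (hm : m ≠ 0) :
    m i ≠ 0 ∨ m j ≠ 0 := by
  by_contra! hc
  apply hm
  funext l
  have : l = i ∨ l = j := by omega
  rcases this with rfl | rfl
  exacts [hc.1, hc.2]

theorem coneInd_shear_add_le {i j : Fin 2} (h : i ≠ j) (m : Fin 2 → ℤ) :
    coneInd i j (shear i j (-3) m) + coneInd i j (shear i j 3 m) ≤ coneInd j i m := by
  have hz : ∀ k, shear i j k m ≠ 0 → m ≠ 0 := by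
    rintro k hk rfl
    apply hk
    funext l
    simp [shear]
  have hi : ∀ k, shear i j k m i = m i + k * m j := fun k => by simp [shear]
  have hj : ∀ k, shear i j k m j = m j := fun k => by simp [shear, h.symm]
  unfold coneInd
  simp only [hi, hj]
  by_cases hm : m = 0
  · subst hm
    have h1 : ∀ k, shear i j k (0 : Fin 2 → ℤ) = 0 := fun k => by
      by_contra h1
      exact hz k h1 rfl
    simp [h1]
  · have hm' := fin_two_ne_zero h hm
    split_ifs with h1 h2 h3 h4 h5 h6 <;> norm_num <;> grind

theorem one_le_coneInd_add {i j : Fin 2} {m : Fin 2 → ℤ} (hm : m ≠ 0) :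
    1 ≤ coneInd i j m + coneInd j i m := by
  unfold coneInd
  rcases le_total |m i| |m j| with h | h <;> simp [hm, h] <;> split_ifs <;> norm_num

/-- One ping-pong step: the mass of a cone is controlled by that of the opposite cone. -/
theorem two_mul_tsum_cone_le {a : (Fin 2 → ℤ) → ℂ} (ha : Summable fun m => ‖a m‖ ^ 2) {E : ℝ}
    {i j : Fin 2} (h : i ≠ j)
    (hE : ∀ k ∈ ({3, -3} : Set ℤ), ∃ e ≤ E, HasSum (fun m => ‖a (shear i j k m) - a m‖ ^ 2) e) :
    2 * ∑' m, coneInd i j m * ‖a m‖ ^ 2 ≤ 3 / 2 * ∑' m, coneInd j i m * ‖a m‖ ^ 2 + 6 * E := by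
  have hs : ∀ D : (Fin 2 → ℤ) → ℝ, (∀ m, 0 ≤ D m) → (∀ m, D m ≤ 1) →
      Summable fun m => D m * ‖a m‖ ^ 2 := fun D h0 h1 =>
    Summable.of_nonneg_of_le (fun m => mul_nonneg (h0 m) (by positivity))
      (fun m => mul_le_of_le_one_left (by positivity) (h1 m)) ha
  have key : ∀ k ∈ ({3, -3} : Set ℤ), ∑' m, coneInd i j m * ‖a m‖ ^ 2 ≤
      3 / 2 * ∑' m, coneInd i j (shear i j (-k) m) * ‖a m‖ ^ 2 + 3 * E := by
    intro k hk
    obtain ⟨e, heE, he⟩ := hE k hk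
    have hs' := hs (fun m => coneInd i j (shear i j (-k) m)) (fun m => coneInd_nonneg _ _ _)
      (fun m => coneInd_le_one _ _ _)
    have hre : HasSum (fun m => coneInd i j m * ‖a (shear i j k m)‖ ^ 2)
        (∑' m, coneInd i j (shear i j (-k) m) * ‖a m‖ ^ 2) :=
      ((shearEquiv (G := ℤ) h k).toEquiv.hasSum_iff.mpr hs'.hasSum).congr_fun fun m => by
        simp [shearEquiv, shear_neg_shear h]
    have hle := hasSum_le (fun m => ?_) (hs _ (coneInd_nonneg i j) (coneInd_le_one i j)).hasSum
      ((hre.mul_left (3 / 2)).add (he.mul_left 3))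
    · linarith
    · have h0 := coneInd_nonneg i j m
      have h1 := coneInd_le_one i j m
      have hn : ‖a m‖ ≤ ‖a (shear i j k m)‖ + ‖a (shear i j k m) - a m‖ := by
        rw [norm_sub_rev]
        exact norm_le_norm_add_norm_sub' _ _
      have hsq : ‖a m‖ ^ 2 ≤
          3 / 2 * ‖a (shear i j k m)‖ ^ 2 + 3 * ‖a (shear i j k m) - a m‖ ^ 2 := by
        nlinarith [norm_nonneg (a m),
          sq_nonneg (‖a (shear i j k m)‖ - 2 * ‖a (shear i j k m) - a m‖)]
      nlinarith [mul_le_mul_of_nonneg_left hsq h0, sq_nonneg ‖a (shear i j k m) - a m‖]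
  have h3 := key 3 (by simp)
  have h3' := key (-3) (by simp)
  rw [neg_neg] at h3'
  have hsum := (hs (fun m => coneInd i j (shear i j (-3) m)) (fun m => coneInd_nonneg _ _ _)
      (fun m => coneInd_le_one _ _ _)).hasSum.add (hs (fun m => coneInd i j (shear i j 3 m))
      (fun m => coneInd_nonneg _ _ _) (fun m => coneInd_le_one _ _ _)).hasSum
  have hle := hasSum_le (fun m => by
    rw [← add_mul]
    exact mul_le_mul_of_nonneg_right (coneInd_shear_add_le h m) (by positivity)) hsum
    (hs _ (coneInd_nonneg j i) (coneInd_le_one j i)).hasSum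
  linarith

/-- Spectral gap on `ℓ²(ℤ² ∖ {0})`: a vector almost invariant under shears is small. -/
theorem tsum_sq_ne_zero_le {a : (Fin 2 → ℤ) → ℂ} {s : ℝ} (ha : HasSum (fun m => ‖a m‖ ^ 2) s)
    {E : ℝ} (hE : ∀ i j : Fin 2, i ≠ j → ∀ k ∈ ({3, -3} : Set ℤ), ∃ e ≤ E,
      HasSum (fun m => ‖a (shear i j k m) - a m‖ ^ 2) e) :
    s - ‖a 0‖ ^ 2 ≤ 24 * E := by
  have h01 : (0 : Fin 2) ≠ 1 := by decide
  have h1 := two_mul_tsum_cone_le ha.summable h01 (hE _ _ h01)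
  have h2 := two_mul_tsum_cone_le ha.summable h01.symm (hE _ _ h01.symm)
  have hs : ∀ i j : Fin 2, Summable fun m => coneInd i j m * ‖a m‖ ^ 2 := fun i j =>
    Summable.of_nonneg_of_le (fun m => mul_nonneg (coneInd_nonneg _ _ _) (by positivity))
      (fun m => mul_le_of_le_one_left (by positivity) (coneInd_le_one _ _ _)) ha.summable
  have hle := hasSum_le (fun m => ?_) ha
    (((hs 0 1).hasSum.add (hs 1 0).hasSum).add (hasSum_ite_eq (0 : Fin 2 → ℤ) (‖a 0‖ ^ 2)))
  · linarith
  · by_cases hm : m = 0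
    · subst hm
      simp [coneInd]
    · simp only [hm, if_false, add_zero, ← add_mul]
      exact le_mul_of_one_le_left (by positivity) (one_le_coneInd_add hm)

theorem E0.symm {x y : ℕ → Bool} (h : E0 x y) : E0 y x :=
  h.imp fun _ hN m hm => (hN m hm).symm

theorem E0.trans {x y z : ℕ → Bool} (h : E0 x y) (h' : E0 y z) : E0 x z := by
  obtain ⟨N, hN⟩ := h
  obtain ⟨M, hM⟩ := h'
  exact ⟨max N M, fun m hm => (hN m (le_of_max_le_left hm)).trans (hM m (le_of_max_le_right hm))⟩

/-- A sequence of events, all of whose finite conjunctions (with prescribed truth values) have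
probability near `0` or `1`, is almost determined. -/
theorem exists_bits_measure_pos {X : Type*} [MeasurableSpace X] (μ : Measure X)
    [IsProbabilityMeasure μ] (g : X → ℕ → Bool) (hg : Measurable g)
    (hgap : ∀ P : Set (ℕ → Bool), MeasurableSet P →
      μ.real (g ⁻¹' P) * (1 - μ.real (g ⁻¹' P)) ≤ 1 / 10) :
    ∃ z, 0 < μ (g ⁻¹' {z}) := by
  have dich : ∀ P : Set (ℕ → Bool), MeasurableSet P → 1 / 5 ≤ μ.real (g ⁻¹' P) →
      4 / 5 ≤ μ.real (g ⁻¹' P) := by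
    intro P hP h
    have := hgap P hP
    by_contra! h'
    nlinarith
  have hbit : ∀ k, ∃ b : Bool, 4 / 5 ≤ μ.real (g ⁻¹' {y | y k = b}) := by
    intro k
    have hm : ∀ b : Bool, MeasurableSet {y : ℕ → Bool | y k = b} := fun b =>
      measurableSet_eq_fun (measurable_pi_apply k) measurable_const
    by_cases h : 1 / 5 ≤ μ.real (g ⁻¹' {y | y k = true})
    · exact ⟨true, dich _ (hm _) h⟩
    · refine ⟨false, dich _ (hm _) ?_⟩
      have hc : g ⁻¹' {y | y k = false} = (g ⁻¹' {y | y k = true})ᶜ := by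
        ext x; simp
      rw [hc, probReal_compl_eq_one_sub (hg (hm _))]
      linarith
  choose z hz using hbit
  have hmeas : ∀ n, MeasurableSet {y : ℕ → Bool | ∀ k < n, y k = z k} := fun n => by
    have : {y : ℕ → Bool | ∀ k < n, y k = z k} = ⋂ k, ⋂ (_ : k < n), {y | y k = z k} := by
      ext; simp
    rw [this]
    exact .iInter fun k => .iInter fun _ =>
      measurableSet_eq_fun (measurable_pi_apply k) measurable_const
  have hfin : ∀ n, 4 / 5 ≤ μ.real (g ⁻¹' {y | ∀ k < n, y k = z k}) := by
    intro n
    induction n with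
    | zero => simp; norm_num
    | succ n ih =>
      refine dich _ (hmeas _) ?_
      have hi : g ⁻¹' {y | ∀ k < n + 1, y k = z k} =
          g ⁻¹' {y | ∀ k < n, y k = z k} ∩ g ⁻¹' {y | y n = z n} := by
        ext x
        exact Nat.forall_lt_succ_right
      have hm := hg (measurableSet_eq_fun (measurable_pi_apply n) (measurable_const (a := z n)))
      have h1 := measureReal_union_add_inter (μ := μ)
        (s := g ⁻¹' {y | ∀ k < n, y k = z k}) (t := g ⁻¹' {y | y n = z n}) hm
      have h2 := measureReal_le_one (μ := μ)
        (s := g ⁻¹' {y | ∀ k < n, y k = z k} ∪ g ⁻¹' {y | y n = z n})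
      have h3 := hz n
      rw [hi]
      linarith
  refine ⟨z, ?_⟩
  have hInter : g ⁻¹' {z} = ⋂ n, g ⁻¹' {y | ∀ k < n, y k = z k} := by
    ext x
    simp only [Set.mem_preimage, Set.mem_singleton_iff, Set.mem_iInter, Set.mem_ofPred_eq]
    exact ⟨fun h n k _ => congrFun h k, fun h => funext fun k => h (k + 1) k (Nat.lt_succ_self k)⟩
  have hlim := tendsto_measure_iInter_atTop (μ := μ)
    (s := fun n => g ⁻¹' {y | ∀ k < n, y k = z k}) (fun n => (hg (hmeas n)).nullMeasurableSet)
    (fun m n hmn x hx k hk => hx k (hk.trans_le hmn)) ⟨0, measure_ne_top _ _⟩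
  rw [← hInter] at hlim
  refine lt_of_lt_of_le (b := ENNReal.ofReal (4 / 5)) (by simp) (ge_of_tendsto' hlim fun n => ?_)
  rw [Function.comp_apply, ← ofReal_measureReal]
  exact ENNReal.ofReal_le_ofReal (hfin n)

/-- Under expansion, a homomorphism into `E0` sends a set of positive measure to one class. -/
theorem exists_E0_class_measure_pos {X ι : Type*} [MeasurableSpace X] [Finite ι] (μ : Measure X)
    [IsProbabilityMeasure μ] (T : ι → X → X) (hT : ∀ i, Measurable (T i)) (C : ℝ) (hC : 0 < C)
    (hexp : ∀ A, MeasurableSet A → ∀ E, (∀ i, μ.real (symmDiff (T i ⁻¹' A) A) ≤ E) →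
      μ.real A * (1 - μ.real A) ≤ C * E)
    (g : X → ℕ → Bool) (hg : Measurable g) (hE : ∀ i x, E0 (g x) (g (T i x))) :
    ∃ z, 0 < μ {x | E0 z (g x)} := by
  have hbad : ∀ i, ∀ᶠ N in atTop, μ.real {x | ∃ m ≥ N, g x m ≠ g (T i x) m} ≤ 1 / (10 * C) := by
    intro i
    have hmeas : ∀ N, MeasurableSet {x | ∃ m ≥ N, g x m ≠ g (T i x) m} := fun N => by
      have : {x | ∃ m ≥ N, g x m ≠ g (T i x) m} =
          ⋃ m, ⋃ (_ : m ≥ N), {x | g x m = g (T i x) m}ᶜ := by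
        ext; simp
      rw [this]
      exact .iUnion fun m => .iUnion fun _ => (measurableSet_eq_fun
        ((measurable_pi_apply m).comp hg)
        ((measurable_pi_apply m).comp (hg.comp (hT i)))).compl
    have hlim := tendsto_measure_iInter_atTop (μ := μ)
      (s := fun N => {x | ∃ m ≥ N, g x m ≠ g (T i x) m}) (fun N => (hmeas N).nullMeasurableSet)
      (fun M N hMN x ⟨m, hm, hx⟩ => ⟨m, hMN.trans hm, hx⟩) ⟨0, measure_ne_top _ _⟩
    have hempty : ⋂ N, {x | ∃ m ≥ N, g x m ≠ g (T i x) m} = ∅ := by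
      ext x
      obtain ⟨N, hN⟩ := hE i x
      simp only [Set.mem_iInter, Set.mem_ofPred_eq, Set.mem_empty_iff_false, iff_false, not_forall]
      exact ⟨N, fun ⟨m, hm, hx⟩ => hx (hN m hm)⟩
    rw [hempty, measure_empty] at hlim
    have hreal := (ENNReal.tendsto_toReal ENNReal.zero_ne_top).comp hlim
    exact hreal.eventually (ge_mem_nhds (by simp; positivity))
  obtain ⟨N, hN⟩ := (eventually_all.mpr hbad).exists
  have hg' : Measurable fun x m => g x (N + m) :=
    measurable_pi_lambda _ fun m => (measurable_pi_apply (N + m)).comp hg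
  obtain ⟨z, hz⟩ := exists_bits_measure_pos μ (fun x m => g x (N + m)) hg' fun P hP => by
    refine (hexp _ (hg' hP) (1 / (10 * C)) fun i => le_trans (measureReal_mono ?_) (hN i)).trans
      (le_of_eq (by field_simp))
    intro x hx
    by_contra hc
    simp only [Set.mem_ofPred_eq, not_exists, not_and, not_not] at hc
    have heq : (fun m => g x (N + m)) = fun m => g (T i x) (N + m) :=
      funext fun m => hc _ (Nat.le_add_right N m)
    simp [Set.mem_symmDiff, heq] at hx
  refine ⟨fun m => z (m - N), hz.trans_le (measure_mono fun x hx => ⟨N, fun m hm => ?_⟩)⟩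
  rw [← show (fun m => g x (N + m)) = z from hx]
  simp [Nat.add_sub_cancel' hm]

section Torus

open UnitAddTorus

/-- The circle carries its normalised Haar measure, as in Mathlib's theory of Fourier series. -/
noncomputable local instance : MeasureSpace UnitAddCircle := ⟨AddCircle.haarAddCircle⟩

local instance : Measure.IsAddHaarMeasure (volume : Measure UnitAddCircle) :=
  inferInstanceAs (Measure.IsAddHaarMeasure AddCircle.haarAddCircle)

local instance : IsProbabilityMeasure (volume : Measure UnitAddCircle) :=
  inferInstanceAs (IsProbabilityMeasure AddCircle.haarAddCircle)

theorem continuous_shear {G : Type*} [AddCommGroup G] [TopologicalSpace G]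
    [IsTopologicalAddGroup G] (i j : Fin 2) (k : ℤ) :
    Continuous (shear i j k : (Fin 2 → G) → Fin 2 → G) := by
  refine continuous_pi fun l => ?_
  unfold shear
  split_ifs <;> fun_prop

theorem measurePreserving_shear {i j : Fin 2} (h : i ≠ j) (k : ℤ) :
    MeasurePreserving (shear i j k : UnitAddTorus (Fin 2) → UnitAddTorus (Fin 2)) := by
  let φ : UnitAddTorus (Fin 2) →+ UnitAddTorus (Fin 2) :=
    AddMonoidHom.mk' (shear i j k) (map_add (shearEquiv h k))
  exact AddMonoidHom.measurePreserving (f := φ) (continuous_shear i j k)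
    (shearEquiv (G := UnitAddCircle) h k).surjective rfl

theorem mFourier_shear {i j : Fin 2} (h : i ≠ j) (k : ℤ) (m : Fin 2 → ℤ)
    (t : UnitAddTorus (Fin 2)) : mFourier m (shear i j k t) = mFourier (shear j i k m) t := by
  have hprod : ∀ F : Fin 2 → ℂ, ∏ l, F l = F i * F j := fun F => by
    have : (i = 0 ∧ j = 1) ∨ (i = 1 ∧ j = 0) := by omega
    rcases this with ⟨rfl, rfl⟩ | ⟨rfl, rfl⟩ <;> simp [Fin.prod_univ_two, mul_comm]
  simp only [mFourier, ContinuousMap.coe_mk, hprod, shear, if_true, h, h.symm, if_false]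
  simp only [fourier_apply, smul_add, smul_smul, add_smul, AddCircle.toCircle_add, smul_eq_mul,
    Circle.coe_mul, mul_assoc]
  rw [mul_comm (m i) k, mul_comm (AddCircle.toCircle (m j • t j) : ℂ)]

theorem mFourierCoeff_comp_shear {i j : Fin 2} (h : i ≠ j) (k : ℤ)
    (g : UnitAddTorus (Fin 2) → ℂ) (m : Fin 2 → ℤ) :
    mFourierCoeff (fun t => g (shear i j k t)) m = mFourierCoeff g (shear j i (-k) m) := by
  have hemb : MeasurableEmbedding
      (shear i j k : UnitAddTorus (Fin 2) → UnitAddTorus (Fin 2)) :=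
    (continuous_shear i j k).measurableEmbedding (shearEquiv h k).injective
  unfold mFourierCoeff
  refine Eq.trans (integral_congr_ae (.of_forall fun t => ?_))
    ((measurePreserving_shear h k).integral_comp hemb
      fun t => mFourier (-shear j i (-k) m) t • g t)
  have hneg : shear j i k (-shear j i (-k) m) = -m := by
    rw [show -shear j i (-k) m = shear j i (-k) (-m) from
      (map_neg (shearEquiv (G := ℤ) h.symm (-k)) m).symm]
    simpa using shear_neg_shear h.symm (-k) (-m)
  simp only [mFourier_shear h, hneg]

theorem hasSum_sq_mFourierCoeff_of_memLp {d : Type*} [Fintype d] {g : UnitAddTorus d → ℂ}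
    (hg : MemLp g 2) : HasSum (fun m => ‖mFourierCoeff g m‖ ^ 2) (∫ t, ‖g t‖ ^ 2) := by
  have hc : ∀ m, mFourierCoeff (hg.toLp g) m = mFourierCoeff g m := fun m =>
    integral_congr_ae (hg.coeFn_toLp.mono fun t ht => by simp only [ht])
  have hi : ∫ t, ‖hg.toLp g t‖ ^ 2 = ∫ t, ‖g t‖ ^ 2 :=
    integral_congr_ae (hg.coeFn_toLp.mono fun t ht => by simp only [ht])
  simpa only [hc, hi] using hasSum_sq_mFourierCoeff (hg.toLp g)

/-- Expansion for the shears acting on the two-dimensional torus. -/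
theorem torus_expansion {A : Set (UnitAddTorus (Fin 2))} (hA : MeasurableSet A) {E : ℝ}
    (hE : ∀ i j : Fin 2, i ≠ j → ∀ k ∈ ({3, -3} : Set ℤ),
      volume.real (symmDiff (shear i j k ⁻¹' A) A) ≤ E) :
    volume.real A * (1 - volume.real A) ≤ 24 * E := by
  set g : UnitAddTorus (Fin 2) → ℂ := A.indicator 1
  have hg : MemLp g 2 := (memLp_const (1 : ℂ)).indicator hA
  have hnorm : ∀ B : Set (UnitAddTorus (Fin 2)), MeasurableSet B → ∀ u : UnitAddTorus (Fin 2) → ℂ,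
      (∀ t, ‖u t‖ ^ 2 = B.indicator 1 t) → ∫ t, ‖u t‖ ^ 2 = volume.real B := fun B hB u hu => by
    simp only [hu]
    exact integral_indicator_one hB
  have hsum := hasSum_sq_mFourierCoeff_of_memLp hg
  rw [hnorm A hA g fun t => by by_cases ht : t ∈ A <;> simp [g, ht]] at hsum
  have h0 : ‖mFourierCoeff g 0‖ ^ 2 = volume.real A ^ 2 := by
    have : mFourierCoeff g 0 = (volume.real A : ℂ) := by
      simp only [mFourierCoeff, neg_zero, mFourier_zero, ContinuousMap.one_apply, one_smul, g]
      rw [integral_indicator hA]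
      simp [Measure.real]
    rw [this]
    simp
  have key := tsum_sq_ne_zero_le hsum (E := E) fun i j hij k hk => by
    have hmp := measurePreserving_shear hij.symm (-k)
    have hgT : MemLp (fun t => g (shear j i (-k) t)) 2 := hg.comp_measurePreserving hmp
    refine ⟨_, hE j i hij.symm (-k) (by rcases hk with rfl | rfl <;> simp), ?_⟩
    have hd := hasSum_sq_mFourierCoeff_of_memLp (hgT.sub hg)
    rw [hnorm (symmDiff (shear j i (-k) ⁻¹' A) A) ((hmp.measurable hA).symmDiff hA) _
      fun t => by
        by_cases ht : t ∈ A <;> by_cases ht' : shear j i (-k) t ∈ A <;>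
          simp [g, ht, ht', Set.mem_symmDiff]] at hd
    refine hd.congr_fun fun m => ?_
    have hint : ∀ {u : UnitAddTorus (Fin 2) → ℂ}, MemLp u 2 →
        Integrable fun t => mFourier (-m) t • u t := fun {u} hu =>
      (hu.integrable one_le_two).bdd_mul (c := 1)
        (mFourier (-m)).continuous.aestronglyMeasurable
        (.of_forall fun t => ((mFourier (-m)).norm_coe_le_norm t).trans mFourier_norm.le)
    have hsub : mFourierCoeff ((fun t => g (shear j i (-k) t)) - g) m =
        mFourierCoeff g (shear i j k m) - mFourierCoeff g m := by
      have := mFourierCoeff_comp_shear hij.symm (-k) g m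
      rw [neg_neg] at this
      rw [← this]
      unfold mFourierCoeff
      rw [← integral_sub (hint hgT) (hint hg)]
      simp only [Pi.sub_apply, smul_sub]
    rw [hsub]
  rw [h0] at key
  linarith


theorem FN_of_transvection {n : ℕ} {x y : Fin (n - 1) → ℝ} {i j : Fin n} (h : i ≠ j) (q : ℚ)
    (hxy : ∀ l, extend1 y l = extend1 x l + if l = j then (q : ℝ) * extend1 x i else 0) :
    FN n x y := by
  refine ⟨Matrix.GeneralLinearGroup.mkOfDetNeZero (Matrix.transvection i j q)
    (by simp [Matrix.det_transvection_of_ne i j h]), ?_⟩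
  funext l
  rw [hxy]
  have hmap : ((Matrix.GeneralLinearGroup.mkOfDetNeZero (Matrix.transvection i j q)
      (by simp [Matrix.det_transvection_of_ne i j h]) : Matrix (Fin n) (Fin n) ℚ)).map
        (fun q : ℚ => (q : ℝ)) = 1 + Matrix.single i j (q : ℝ) := by
    change (1 + Matrix.single i j q).map (Rat.castHom ℝ) = _
    rw [Matrix.map_add _ (map_add _), Matrix.map_one _ (map_zero _) (map_one _), Matrix.map_single]
    rfl
  rw [hmap, Matrix.vecMul_add, Matrix.vecMul_one, Pi.add_apply]
  congr 1
  simp [Matrix.vecMul, dotProduct, Matrix.single_apply, eq_comm, mul_comm, ite_and]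

theorem extend1_injective {n : ℕ} : Function.Injective (extend1 (N := n)) := by
  intro x y h
  funext l
  have := congrFun h ⟨l, by omega⟩
  simpa [extend1] using this

theorem countable_setOf_FN (n : ℕ) (x : Fin (n - 1) → ℝ) : {y | FN n x y}.Countable := by
  have hc : Countable (GL (Fin n) ℚ) := by
    have : Countable (Matrix (Fin n) (Fin n) ℚ) := inferInstanceAs (Countable (Fin n → Fin n → ℚ))
    exact (Units.val_injective (α := Matrix (Fin n) (Fin n) ℚ)).countable
  refine Set.countable_of_injective_of_countable_image (f := extend1) extend1_injective.injOn ?_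
  refine (Set.countable_range fun M : GL (Fin n) ℚ => Matrix.vecMul (extend1 x)
    ((M : Matrix (Fin n) (Fin n) ℚ).map (fun q : ℚ => (q : ℝ)))).mono ?_
  rintro _ ⟨y, ⟨M, hM⟩, rfl⟩
  exact ⟨M, hM⟩

/-- Lift a point of the torus to the unit square and pad it by zeros. -/
noncomputable def torusLift (n : ℕ) (t : UnitAddTorus (Fin 2)) : Fin (n - 1) → ℝ :=
  fun l => if h : (l : ℕ) < 2 then (AddCircle.equivIco 1 0 (t ⟨l, h⟩) : ℝ) else 0

theorem measurable_torusLift (n : ℕ) : Measurable (torusLift n) := by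
  refine measurable_pi_lambda _ fun l => ?_
  unfold torusLift
  split_ifs with h
  · exact measurable_subtype_coe.comp
      ((AddCircle.measurableEquivIco 1 0).measurable.comp (measurable_pi_apply _))
  · exact measurable_const

theorem torusLift_injective {n : ℕ} (hn : 3 ≤ n) : Function.Injective (torusLift n) := by
  intro s t h
  funext l
  have hl := congrFun h ⟨l, by omega⟩
  simp only [torusLift, l.isLt, dif_pos] at hl
  exact (AddCircle.equivIco 1 0).injective (Subtype.ext hl)

theorem exists_equivIco_add_zsmul (s t : UnitAddCircle) (k : ℤ) : ∃ q : ℤ,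
    (AddCircle.equivIco 1 0 (s + k • t) : ℝ) =
      AddCircle.equivIco 1 0 s + k * AddCircle.equivIco 1 0 t + q := by
  have h : (((AddCircle.equivIco 1 0 (s + k • t) : ℝ) -
      (AddCircle.equivIco 1 0 s + k • (AddCircle.equivIco 1 0 t : ℝ)) : ℝ) : UnitAddCircle) = 0 := by
    rw [AddCircle.coe_sub, AddCircle.coe_add, AddCircle.coe_zsmul]
    simp only [AddCircle.coe_equivIco, sub_self]
  obtain ⟨q, hq⟩ := (AddCircle.coe_eq_zero_iff 1).mp h
  refine ⟨q, ?_⟩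
  simp only [zsmul_eq_mul, mul_one] at hq
  linarith

theorem E0_torusLift_shear {n : ℕ} (hn : 3 ≤ n) {f : (Fin (n - 1) → ℝ) → ℕ → Bool}
    (hf : ∀ x y, FN n x y → E0 (f x) (f y)) {i j : Fin 2} (h : i ≠ j) (k : ℤ)
    (t : UnitAddTorus (Fin 2)) : E0 (f (torusLift n t)) (f (torusLift n (shear i j k t))) := by
  obtain ⟨q, hq⟩ := exists_equivIco_add_zsmul (t i) (t j) k
  have hin : (i : ℕ) < n - 1 := by omega
  have hjn : (j : ℕ) < n - 1 := by omega
  have hi1 : (i : ℕ) ≤ 1 := by omega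
  have hj1 : (j : ℕ) ≤ 1 := by omega
  let a : Fin n := ⟨i, by omega⟩
  let b : Fin n := ⟨j, by omega⟩
  let c : Fin n := ⟨n - 1, by omega⟩
  let y : Fin (n - 1) → ℝ := fun l => torusLift n t l +
    if (l : ℕ) = i then (k : ℝ) * AddCircle.equivIco 1 0 (t j) else 0
  refine (hf _ y ?_).trans (hf _ _ ?_)
  · refine FN_of_transvection (i := b) (j := a) (by simp [a, b, Fin.ext_iff]; omega) k fun l => ?_
    by_cases hl : (l : ℕ) < n - 1
    · by_cases hli : (l : ℕ) = i <;>
        simp [extend1, hl, hli, hin, hjn, hi1, hj1, a, b, y, torusLift, Fin.ext_iff]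
    · have hli : (l : ℕ) ≠ i := by omega
      simp [extend1, hl, hli, a, Fin.ext_iff]
  · refine FN_of_transvection (i := c) (j := a) (by simp [a, c, Fin.ext_iff]; omega) q fun l => ?_
    by_cases hl : (l : ℕ) < n - 1
    · by_cases hli : (l : ℕ) = i
      · simp [extend1, hli, hin, hi1, a, c, y, torusLift, shear, Fin.ext_iff, hq]
      · simp [extend1, hl, hli, a, y, torusLift, shear, Fin.ext_iff]
    · have hli : (l : ℕ) ≠ i := by omega
      simp [extend1, hl, hli, a, Fin.ext_iff]


local instance : NullSingletonClass (volume : Measure UnitAddCircle) := by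
  have : Nontrivial UnitAddCircle :=
    have : Nontrivial (Set.Ico (0 : ℝ) (0 + 1)) :=
      ⟨⟨0, by norm_num⟩, ⟨1 / 2, by norm_num⟩, by simp⟩
    (AddCircle.equivIco (1 : ℝ) 0).nontrivial
  have : (𝓝[≠] (0 : UnitAddCircle)).NeBot := inferInstance
  infer_instance

theorem FN_not_reducible_E0 {n : ℕ} (hn : 3 ≤ n) :
    ¬ ∃ f : (Fin (n - 1) → ℝ) → (ℕ → Bool), Measurable f ∧
      ∀ x y : Fin (n - 1) → ℝ, (FN n x y ↔ E0 (f x) (f y)) := by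
  rintro ⟨f, hfm, hf⟩
  obtain ⟨z, hz⟩ := exists_E0_class_measure_pos
    (ι := {p : Fin 2 × Fin 2 // p.1 ≠ p.2} × ({3, -3} : Set ℤ))
    (volume : Measure (UnitAddTorus (Fin 2)))
    (fun p => shear p.1.1.1 p.1.1.2 p.2)
    (fun p => (continuous_shear _ _ _).measurable) 24 (by norm_num)
    (fun A hA E hE => torus_expansion hA fun i j hij k hk => hE (⟨(i, j), hij⟩, ⟨k, hk⟩))
    (fun t => f (torusLift n t)) (hfm.comp (measurable_torusLift n))
    (fun p t => E0_torusLift_shear hn (fun x y => (hf x y).mp) p.1.2 _ t)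
  refine hz.ne' (Set.Countable.measure_zero ?_ _)
  obtain ⟨t, ht⟩ := nonempty_of_measure_ne_zero hz.ne'
  refine ((countable_setOf_FN n (torusLift n t)).preimage (torusLift_injective hn)).mono
    fun s hs => ?_
  exact (hf _ _).mpr (ht.symm.trans hs)

end Torus

theorem stmt14 (n : ℕ) (hn : 4 ≤ n) :
    ¬ ∃ f : (Fin (n - 1) → ℝ) → (ℕ → Bool), Measurable f ∧
      ∀ x y : Fin (n - 1) → ℝ, (FN n x y ↔ E0 (f x) (f y)) :=
  FN_not_reducible_E0 (by omega)
end

section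
/- For every integer n ≥ 5, the equivalence relation F_n on ℝ^{n−1} is not treeable: there is no Borel set G ⊆ ℝ^{n−1} × ℝ^{n−1} such that G is symmetric and irreflexive, G is contained in F_n, and for every x ∈ ℝ^{n−1} the graph whose vertex set is the F_n-equivalence class of x and whose edge relation is given by G is connected and acyclic (i.e., is a tree). -/
open MeasureTheory

namespace SimpleGraph
variable {V : Type*} (T : SimpleGraph V)

/-- The vertices lying on every walk from `u` to `v`. -/
def sep (u v : V) : Set V := {w | ∀ p : T.Walk u v, w ∈ p.support}

variable {T}

theorem sep_comm (u v : V) : T.sep u v = T.sep v u := by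
  ext w
  constructor <;> intro h p <;> simpa using h p.reverse

theorem sep_subset_union (u v w : V) : T.sep u w ⊆ T.sep u v ∪ T.sep v w := by
  intro z hz
  by_contra hcon
  simp only [sep, Set.mem_union, Set.mem_ofPred_eq, not_or, not_forall] at hcon
  obtain ⟨⟨p, hp⟩, q, hq⟩ := hcon
  have := hz (p.append q)
  rw [Walk.mem_support_append_iff] at this
  tauto

theorem sep_finite {u v : V} (h : T.Reachable u v) : (T.sep u v).Finite := by
  obtain ⟨p⟩ := h
  exact (List.finite_toSet p.support).subset fun w hw => hw p

theorem reachable_of_mem_sep {u v w : V} (h : T.Reachable u v) (hw : w ∈ T.sep u v) :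
    T.Reachable u w := by
  classical
  obtain ⟨p⟩ := h
  exact ⟨p.takeUntil w (hw p)⟩

theorem IsAcyclic.support_subset_sep (hT : T.IsAcyclic) {u v : V} {p : T.Walk u v}
    (hp : p.IsPath) {w : V} (hw : w ∈ p.support) : w ∈ T.sep u v := by
  classical
  intro q
  have : p = q.bypass := congrArg Subtype.val
    ((hT.subsingleton_path u v).elim ⟨p, hp⟩ ⟨q.bypass, q.bypass_isPath⟩)
  exact q.support_bypass_subset_support (this ▸ hw)

/-- A walk out of a finite set of vertices has an exit point. -/
theorem exists_isPath_inter {s : Set V} {u w : V} (p : T.Walk w u) (hu : u ∈ s) :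
    ∃ m ∈ s, ∃ q : T.Walk w m, q.IsPath ∧ ∀ z ∈ q.support, z ∈ s → z = m := by
  classical
  induction p with
  | nil => exact ⟨_, hu, .nil, by simp, by simp⟩
  | @cons a b c h p ih =>
    by_cases ha : a ∈ s
    · exact ⟨a, ha, .nil, by simp, by simp⟩
    · obtain ⟨m, hm, q, -, hq⟩ := ih hu
      refine ⟨m, hm, (Walk.cons h q).bypass, Walk.bypass_isPath _, fun z hz hzs => ?_⟩
      have := Walk.support_bypass_subset_support _ hz
      rw [Walk.support_cons, List.mem_cons] at this
      rcases this with rfl | h'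
      · exact absurd hzs ha
      · exact hq z h' hzs

theorem IsAcyclic.exists_median (hT : T.IsAcyclic) {u v w : V} (huv : T.Reachable u v)
    (huw : T.Reachable u w) : (T.sep u v ∩ T.sep u w ∩ T.sep v w).Nonempty := by
  classical
  obtain ⟨p, hp⟩ := huv.exists_isPath
  obtain ⟨r⟩ := huw.symm
  obtain ⟨m, hm, q, hq, hqm⟩ :=
    exists_isPath_inter (s := {z | z ∈ p.support}) r p.start_mem_support
  have key : ∀ {a : V} (t : T.Walk m a), t.IsPath → (∀ z ∈ t.support, z ∈ p.support) →
      m ∈ T.sep a w := by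
    intro a t ht hts
    rw [sep_comm]
    refine hT.support_subset_sep (p := q.append t) ?_ ?_
    · rw [Walk.isPath_def, Walk.support_append, List.nodup_append']
      refine ⟨hq.support_nodup, ht.support_nodup.tail, ?_⟩
      intro z hz hz'
      have hzm := hqm z hz (hts z (List.mem_of_mem_tail hz'))
      subst hzm
      have := ht.support_nodup
      rw [← Walk.cons_tail_support, List.nodup_cons] at this
      exact this.1 hz'
    · simp [Walk.mem_support_append_iff]
  refine ⟨m, ⟨hT.support_subset_sep hp hm, ?_⟩, ?_⟩
  · exact key (p.takeUntil m hm).reverse (hp.takeUntil hm).reverse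
      fun z hz => p.support_takeUntil_subset_support hm (by simpa using hz)
  · exact key (p.dropUntil m hm) (hp.dropUntil hm) fun z hz =>
      p.support_dropUntil_subset_support hm hz

end SimpleGraph

/-- A Borel forest `T` on `V` together with a probability space `X` mapped into `V` by `pt`, such
that the component of almost every point `pt x` is injectively parametrized by a countable set
`Q`, through maps `ev · q` that are measurable in `x`. -/
structure OrbitChart {X V Q : Type*} [MeasurableSpace X] [MeasurableSpace V]
    (μ : Measure X) (T : SimpleGraph V) (pt : X → V) (ev : X → Q → V) : Prop where
  acyclic : T.IsAcyclic
  measurableSet_adj : MeasurableSet {p : V × V | T.Adj p.1 p.2}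
  measurable_pt : Measurable pt
  measurable_ev : ∀ q, Measurable fun x => ev x q
  injective : ∀ᵐ x ∂μ, Function.Injective (ev x)
  range : ∀ᵐ x ∂μ, Set.range (ev x) = {v | T.Reachable (pt x) v}

namespace OrbitChart

variable {X V Q : Type*} {T : SimpleGraph V} {pt : X → V} {ev : X → Q → V}

/-- The points `x` such that some walk with `n` edges from `ev x p` to `ev x r` through points of
the chart avoids `ev x q`. -/
def avoiding (T : SimpleGraph V) (ev : X → Q → V) (q r : Q) : ℕ → Q → Set X
  | 0, p => {x | ev x p = ev x r} ∩ {x | ev x p = ev x q}ᶜ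
  | n + 1, p => {x | ev x p = ev x q}ᶜ ∩
      ⋃ p', ({x | T.Adj (ev x p) (ev x p')} ∩ avoiding T ev q r n p')

theorem exists_mem_avoiding_iff {x : X} (hx : Set.range (ev x) = {v | T.Reachable (pt x) v})
    (p q r : Q) : (∃ n, x ∈ avoiding T ev q r n p) ↔ ev x q ∉ T.sep (ev x p) (ev x r) := by
  constructor
  · rintro ⟨n, hn⟩
    suffices ∃ w : T.Walk (ev x p) (ev x r), ev x q ∉ w.support by
      obtain ⟨w, hw⟩ := this
      exact fun h => hw (h w)
    induction n generalizing p with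
    | zero =>
      obtain ⟨h1, h2⟩ := hn
      simp only [Set.mem_ofPred_eq, Set.mem_compl_iff] at h1 h2
      rw [← h1]
      exact ⟨.nil, by simpa using Ne.symm h2⟩
    | succ n ih =>
      obtain ⟨h1, h2⟩ := hn
      simp only [Set.mem_iUnion, Set.mem_inter_iff, Set.mem_ofPred_eq, Set.mem_compl_iff] at h1 h2
      obtain ⟨p', h2, h3⟩ := h2
      obtain ⟨w, hw⟩ := ih p' h3
      exact ⟨.cons h2 w, by simpa using ⟨Ne.symm h1, hw⟩⟩
  · intro h
    simp only [SimpleGraph.sep, Set.mem_ofPred_eq, not_forall] at h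
    obtain ⟨w, hw⟩ := h
    generalize hv : ev x p = v at w hw
    generalize hu : ev x r = u at w hw
    induction w generalizing p with
    | nil =>
      refine ⟨0, ?_, ?_⟩
      · simp [hv, hu]
      · simpa [hv, eq_comm] using hw
    | @cons a b c hadj w ih =>
      simp only [SimpleGraph.Walk.support_cons, List.mem_cons, not_or] at hw
      have hb : b ∈ Set.range (ev x) := by
        have ha : T.Reachable (pt x) a := by
          have : a ∈ Set.range (ev x) := ⟨p, hv⟩
          rwa [hx] at this
        rw [hx]
        exact ha.trans hadj.reachable
      obtain ⟨p', rfl⟩ := hb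
      obtain ⟨n, hn⟩ := ih p' rfl hu hw.2
      refine ⟨n + 1, ?_, ?_⟩
      · simpa [hv, eq_comm] using hw.1
      · simp only [Set.mem_iUnion, Set.mem_inter_iff, Set.mem_ofPred_eq]
        exact ⟨p', hv ▸ hadj, hn⟩

variable [MeasurableSpace X] [MeasurableSpace V] {μ : Measure X}

theorem measurableSet_avoiding [Countable Q] [MeasurableEq V] (h : OrbitChart μ T pt ev) (q r : Q)
    (n : ℕ) (p : Q) : MeasurableSet (avoiding T ev q r n p) := by
  have heq : ∀ p p' : Q, MeasurableSet {x | ev x p = ev x p'} := fun p p' =>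
    measurableSet_eq_fun (h.measurable_ev p) (h.measurable_ev p')
  induction n generalizing p with
  | zero => exact (heq p r).inter (heq p q).compl
  | succ n ih =>
    refine (heq p q).compl.inter (MeasurableSet.iUnion fun p' => MeasurableSet.inter ?_ (ih p'))
    exact h.measurableSet_adj.preimage ((h.measurable_ev p).prodMk (h.measurable_ev p'))

theorem nullMeasurableSet_mem_sep_ev [Countable Q] [MeasurableEq V] (h : OrbitChart μ T pt ev)
    (p q r : Q) : NullMeasurableSet {x | ev x q ∈ T.sep (ev x p) (ev x r)} μ := by
  have hm : MeasurableSet (⋃ n, avoiding T ev q r n p)ᶜ :=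
    (MeasurableSet.iUnion fun n => h.measurableSet_avoiding q r n p).compl
  refine hm.nullMeasurableSet.congr ?_
  filter_upwards [h.range] with x hx
  have := exists_mem_avoiding_iff hx p q r
  refine propext ?_
  change x ∈ (⋃ n, avoiding T ev q r n p)ᶜ ↔ ev x q ∈ T.sep (ev x p) (ev x r)
  rw [Set.mem_compl_iff, Set.mem_iUnion, this, not_not]

theorem nullMeasurableSet_mem_sep [Countable Q] [MeasurableEq V] (h : OrbitChart μ T pt ev)
    {α β : X → V} (hα : Measurable α) (hβ : Measurable β)
    (hαr : ∀ᵐ x ∂μ, T.Reachable (pt x) (α x)) (hβr : ∀ᵐ x ∂μ, T.Reachable (pt x) (β x)) (q : Q) :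
    NullMeasurableSet {x | ev x q ∈ T.sep (α x) (β x)} μ := by
  have hm : NullMeasurableSet (⋃ p, ⋃ r, ({x | ev x q ∈ T.sep (ev x p) (ev x r)} ∩
      ({x | ev x p = α x} ∩ {x | ev x r = β x}))) μ := by
    refine NullMeasurableSet.iUnion fun p => NullMeasurableSet.iUnion fun r =>
      (h.nullMeasurableSet_mem_sep_ev p q r).inter (MeasurableSet.nullMeasurableSet ?_)
    exact (measurableSet_eq_fun (h.measurable_ev p) hα).inter
      (measurableSet_eq_fun (h.measurable_ev r) hβ)
  refine hm.congr ?_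
  filter_upwards [h.range, hαr, hβr] with x hx hα hβ
  refine propext ?_
  change (x ∈ ⋃ p, ⋃ r, _) ↔ ev x q ∈ T.sep (α x) (β x)
  simp only [Set.mem_iUnion, Set.mem_inter_iff, Set.mem_ofPred_eq]
  constructor
  · rintro ⟨p, r, h1, h2, h3⟩
    rwa [← h2, ← h3]
  · intro h1
    have h2 : α x ∈ Set.range (ev x) := by rw [hx]; exact hα
    have h3 : β x ∈ Set.range (ev x) := by rw [hx]; exact hβ
    obtain ⟨p, hp⟩ := h2
    obtain ⟨r, hr⟩ := h3
    exact ⟨p, r, by rwa [hp, hr], hp, hr⟩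

theorem aemeasurable_ncard [Countable Q] (h : OrbitChart μ T pt ev) {Z : X → Set V}
    (hZ : ∀ᵐ x ∂μ, Z x ⊆ Set.range (ev x))
    (hm : ∀ q, NullMeasurableSet {x | ev x q ∈ Z x} μ) :
    AEMeasurable (fun x => ((Z x).ncard : ℝ)) μ := by
  have h1 : AEMeasurable (fun x => (∑' q : Q,
      Set.indicator {x | ev x q ∈ Z x} (fun _ => (1 : ENNReal)) x).toReal) μ :=
    (AEMeasurable.tsum fun q => aemeasurable_const.indicator₀ (hm q)).ennreal_toReal
  refine h1.congr ?_
  filter_upwards [hZ, h.injective] with x hx hinj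
  have h2 : ∑' q : Q, Set.indicator {x | ev x q ∈ Z x} (fun _ => (1 : ENNReal)) x =
      ∑' q : Q, Set.indicator (ev x ⁻¹' Z x) (fun _ => (1 : ENNReal)) q := rfl
  rw [h2, ← tsum_subtype, ENNReal.tsum_set_one,
    Set.encard_preimage_of_injective_subset_range hinj hx, Set.ncard]
  generalize (Z x).encard = c
  cases c <;> simp

end OrbitChart

/-- A measure preserving map of `X` that moves almost every point within its component. -/
structure IsInner {X V : Type*} [MeasurableSpace X] (μ : Measure X) (T : SimpleGraph V)
    (pt : X → V) (γ : X → X) : Prop where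
  measurePreserving : MeasurePreserving γ μ μ
  reachable : ∀ᵐ x ∂μ, T.Reachable (pt x) (pt (γ x))

namespace IsInner

variable {X V : Type*} [MeasurableSpace X] {μ : Measure X} {T : SimpleGraph V} {pt : X → V}

theorem id : IsInner μ T pt id := ⟨.id μ, .of_forall fun _ => .rfl⟩

theorem comp {γ δ : X → X} (hγ : IsInner μ T pt γ) (hδ : IsInner μ T pt δ) :
    IsInner μ T pt (γ ∘ δ) := by
  refine ⟨hγ.1.comp hδ.1, ?_⟩
  filter_upwards [hδ.2, hδ.1.quasiMeasurePreserving.ae hγ.2] with x h1 h2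
  exact h1.trans h2

theorem iterate {γ : X → X} (hγ : IsInner μ T pt γ) (k : ℕ) : IsInner μ T pt γ^[k] := by
  induction k with
  | zero => exact .id
  | succ k ih => exact ih.comp hγ

end IsInner

namespace OrbitChart

theorem div_max_le {N N' ℓ ℓ' R L : ℝ} (hL : 0 < L) (hN : 0 ≤ N) (hR : 0 ≤ R) (hNℓ : N ≤ ℓ)
    (hNN : N' ≤ N + R) (hℓ : ℓ ≤ ℓ' + R) :
    N' / max ℓ' L ≤ N / max ℓ L + 2 * R / L := by
  set M := max ℓ L
  set M' := max ℓ' L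
  have hM : 0 < M := lt_max_of_lt_right hL
  have hM' : 0 < M' := lt_max_of_lt_right hL
  have hMM : M ≤ M' + R := by
    refine max_le (hℓ.trans ?_) ?_
    · gcongr; exact le_max_left _ _
    · have : L ≤ M' := le_max_right _ _
      linarith
  have h1 : N / M ≤ 1 := div_le_one_of_le₀ (hNℓ.trans (le_max_left _ _)) hM.le
  have h2 : N' / M' ≤ N / M + 2 * R / M' := by
    rw [div_le_iff₀ hM', add_mul, div_mul_cancel₀ _ hM'.ne']
    have : N = N / M * M := by field_simp
    nlinarith [div_nonneg hN hM.le]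
  have h3 : 2 * R / M' ≤ 2 * R / L := by gcongr; exact le_max_right _ _
  linarith

variable {X V Q : Type*} {T : SimpleGraph V} {pt : X → V} {ev : X → Q → V}

/-- The proportion of the vertices between `pt x` and `pt (γ x)` whose label lies in `W`, damped
when there are fewer than `L` such vertices. -/
noncomputable def ratio (T : SimpleGraph V) (pt : X → V) (ev : X → Q → V) (L : ℝ) (γ : X → X)
    (W : Set Q) (x : X) : ℝ :=
  ((T.sep (pt x) (pt (γ x)) ∩ ev x '' W).ncard : ℝ) / max ((T.sep (pt x) (pt (γ x))).ncard : ℝ) L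

/-- The distance between `pt x` and `pt (γ x)` on the scale `L / 2`, truncated at `1`. -/
noncomputable def displacement (T : SimpleGraph V) (pt : X → V) (L : ℝ) (γ : X → X) (x : X) : ℝ :=
  min 1 (2 * ((T.sep (pt x) (pt (γ x))).ncard : ℝ) / L)

theorem ratio_nonneg {γ : X → X} {L : ℝ} (hL : 0 < L) (W : Set Q) (x : X) :
    0 ≤ ratio T pt ev L γ W x :=
  div_nonneg (Nat.cast_nonneg _) (le_max_of_le_right hL.le)

theorem displacement_nonneg {γ : X → X} {L : ℝ} (hL : 0 < L) (x : X) :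
    0 ≤ displacement T pt L γ x := le_min zero_le_one (by positivity)

variable [MeasurableSpace X] {μ : Measure X}

theorem ae_ncard_inter_le {γ : X → X} (hγ : IsInner μ T pt γ) (W : Set Q) :
    ∀ᵐ x ∂μ, (T.sep (pt x) (pt (γ x)) ∩ ev x '' W).ncard ≤ (T.sep (pt x) (pt (γ x))).ncard := by
  filter_upwards [hγ.2] with x hx
  exact Set.ncard_le_ncard Set.inter_subset_left (SimpleGraph.sep_finite hx)

theorem ae_ratio_le_one {γ : X → X} (hγ : IsInner μ T pt γ) {L : ℝ} (hL : 0 < L) (W : Set Q) :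
    ∀ᵐ x ∂μ, ratio T pt ev L γ W x ≤ 1 := by
  filter_upwards [ae_ncard_inter_le (ev := ev) hγ W] with x hx
  refine div_le_one_of_le₀ (le_max_of_le_left (by exact_mod_cast hx)) (le_max_of_le_right hL.le)

theorem ae_ratio_comp_le {σ γ : X → X} (hσ : IsInner μ T pt σ)
    (hγ : IsInner μ T pt γ) (hc : Function.Commute σ γ) {L : ℝ} (hL : 0 < L) {W W' : Set Q}
    (hW : ∀ᵐ x ∂μ, ev (γ x) '' W ⊆ ev x '' W') :
    ∀ᵐ x ∂μ, ratio T pt ev L σ W (γ x) ≤ ratio T pt ev L σ W' x +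
      (displacement T pt L γ x + displacement T pt L γ (σ x)) := by
  filter_upwards [hW, hσ.2, hγ.2, (hγ.comp hσ).2, ae_ncard_inter_le (ev := ev) hσ W',
    hγ.1.quasiMeasurePreserving.ae (ae_ratio_le_one (ev := ev) hσ hL W)] with x hW h1 h2 h3 hle h4
  simp only [Function.comp_apply] at h3
  have e : σ (γ x) = γ (σ x) := hc x
  set a := pt x
  set b := pt (γ x) with hb
  set c := pt (γ (σ x)) with hcdef
  set d := pt (σ x)
  have fab : (T.sep a b).Finite := SimpleGraph.sep_finite h2
  have fdc : (T.sep d c).Finite := SimpleGraph.sep_finite (h1.symm.trans h3)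
  have fad : (T.sep a d).Finite := SimpleGraph.sep_finite h1
  have fbc : (T.sep b c).Finite := SimpleGraph.sep_finite (h2.symm.trans h3)
  have hN : (T.sep b c ∩ ev (γ x) '' W).ncard ≤
      (T.sep a d ∩ ev x '' W').ncard + ((T.sep a b).ncard + (T.sep d c).ncard) := by
    refine (Set.ncard_le_ncard (t := (T.sep a d ∩ ev x '' W') ∪ (T.sep a b ∪ T.sep d c)) ?_
      ((fad.inter_of_left _).union (fab.union fdc))).trans
      ((Set.ncard_union_le _ _).trans (by gcongr; exact Set.ncard_union_le _ _))
    rintro v ⟨hv, hvW⟩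
    rcases SimpleGraph.sep_subset_union b a c hv with hv | hv
    · right; left; rwa [SimpleGraph.sep_comm]
    · rcases SimpleGraph.sep_subset_union a d c hv with hv | hv
      · left; exact ⟨hv, hW hvW⟩
      · right; right; exact hv
  have hℓ : (T.sep a d).ncard ≤
      (T.sep b c).ncard + ((T.sep a b).ncard + (T.sep d c).ncard) := by
    refine (Set.ncard_le_ncard (t := (T.sep b c) ∪ (T.sep a b ∪ T.sep d c)) ?_
      (fbc.union (fab.union fdc))).trans
      ((Set.ncard_union_le _ _).trans (by gcongr; exact Set.ncard_union_le _ _))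
    intro v hv
    rcases SimpleGraph.sep_subset_union a b d hv with hv | hv
    · right; left; exact hv
    · rcases SimpleGraph.sep_subset_union b c d hv with hv | hv
      · left; exact hv
      · right; right; rwa [SimpleGraph.sep_comm]
  have key := div_max_le (N := (T.sep a d ∩ ev x '' W').ncard)
    (N' := (T.sep b c ∩ ev (γ x) '' W).ncard) (ℓ := (T.sep a d).ncard) (ℓ' := (T.sep b c).ncard)
    (R := (T.sep a b).ncard + (T.sep d c).ncard) hL (Nat.cast_nonneg _) (by positivity)
    (by exact_mod_cast hle) (by exact_mod_cast hN)
    (by exact_mod_cast hℓ)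
  have hr : ratio T pt ev L σ W (γ x) =
      ((T.sep b c ∩ ev (γ x) '' W).ncard : ℝ) / max ((T.sep b c).ncard : ℝ) L := by
    simp only [ratio, e, hb, hcdef]
  have h0 : 0 ≤ ratio T pt ev L σ W' x := ratio_nonneg hL W' x
  rw [hr] at h4 ⊢
  change _ ≤ ((T.sep a d ∩ ev x '' W').ncard : ℝ) / max ((T.sep a d).ncard : ℝ) L +
    (min 1 (2 * ((T.sep a b).ncard : ℝ) / L) + min 1 (2 * ((T.sep d c).ncard : ℝ) / L))
  change 0 ≤ ((T.sep a d ∩ ev x '' W').ncard : ℝ) / max ((T.sep a d).ncard : ℝ) L at h0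
  have p1 : 0 ≤ 2 * ((T.sep a b).ncard : ℝ) / L := by positivity
  have p2 : 0 ≤ 2 * ((T.sep d c).ncard : ℝ) / L := by positivity
  rw [mul_add, add_div] at key
  rcases min_cases 1 (2 * ((T.sep a b).ncard : ℝ) / L) with h5 | h5 <;>
  rcases min_cases 1 (2 * ((T.sep d c).ncard : ℝ) / L) with h6 | h6 <;>
  linarith

variable [MeasurableSpace V]

theorem ae_sep_subset (h : OrbitChart μ T pt ev) {γ δ : X → X} (hγ : IsInner μ T pt γ)
    (hδ : IsInner μ T pt δ) :
    ∀ᵐ x ∂μ, T.sep (pt (γ x)) (pt (δ x)) ⊆ Set.range (ev x) := by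
  filter_upwards [h.range, hγ.2, hδ.2] with x h1 h2 h3 v hv
  rw [h1]
  exact h2.trans (SimpleGraph.reachable_of_mem_sep (h2.symm.trans h3) hv)

theorem aemeasurable_ncard_sep [Countable Q] [MeasurableEq V] (h : OrbitChart μ T pt ev)
    {γ δ : X → X} (hγ : IsInner μ T pt γ) (hδ : IsInner μ T pt δ) :
    AEMeasurable (fun x => ((T.sep (pt (γ x)) (pt (δ x))).ncard : ℝ)) μ :=
  h.aemeasurable_ncard (h.ae_sep_subset hγ hδ) fun q =>
    h.nullMeasurableSet_mem_sep (h.measurable_pt.comp hγ.1.measurable)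
      (h.measurable_pt.comp hδ.1.measurable) hγ.2 hδ.2 q

theorem aemeasurable_ncard_sep_inter [Countable Q] [MeasurableEq V] (h : OrbitChart μ T pt ev)
    {γ : X → X} (hγ : IsInner μ T pt γ) (W : Set Q) :
    AEMeasurable (fun x => ((T.sep (pt x) (pt (γ x)) ∩ ev x '' W).ncard : ℝ)) μ := by
  refine h.aemeasurable_ncard ?_ fun q => ?_
  · filter_upwards [h.ae_sep_subset .id hγ] with x hx
    exact Set.inter_subset_left.trans hx
  · have h1 : NullMeasurableSet ({x | ev x q ∈ T.sep (pt x) (pt (γ x))} ∩ {_x | q ∈ W}) μ :=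
      (h.nullMeasurableSet_mem_sep h.measurable_pt
        (h.measurable_pt.comp hγ.1.measurable) (.of_forall fun _ => .rfl) hγ.2 q).inter
        (MeasurableSet.const _).nullMeasurableSet
    refine h1.congr ?_
    filter_upwards [h.injective] with x hx
    refine propext ?_
    change (ev x q ∈ T.sep (pt x) (pt (γ x)) ∧ q ∈ W) ↔
      (ev x q ∈ T.sep (pt x) (pt (γ x)) ∧ ev x q ∈ ev x '' W)
    rw [hx.mem_set_image]

theorem integrable_ratio [IsFiniteMeasure μ] [Countable Q] [MeasurableEq V]
    (h : OrbitChart μ T pt ev)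
    {γ : X → X} (hγ : IsInner μ T pt γ) {L : ℝ} (hL : 0 < L) (W : Set Q) :
    Integrable (ratio T pt ev L γ W) μ := by
  refine Integrable.of_bound (C := 1) ?_ ?_
  · exact ((h.aemeasurable_ncard_sep_inter hγ W).div
      ((h.aemeasurable_ncard_sep .id hγ).max aemeasurable_const)).aestronglyMeasurable
  · filter_upwards [ae_ratio_le_one (ev := ev) hγ hL W] with x hx
    rwa [Real.norm_of_nonneg (ratio_nonneg hL W x)]

theorem aestronglyMeasurable_displacement [Countable Q] [MeasurableEq V]
    (h : OrbitChart μ T pt ev) {γ : X → X} (hγ : IsInner μ T pt γ) (L : ℝ) :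
    AEStronglyMeasurable (displacement T pt L γ) μ :=
  (aemeasurable_const.min
      (((h.aemeasurable_ncard_sep .id hγ).const_mul 2).div_const L)).aestronglyMeasurable

theorem integrable_displacement [IsFiniteMeasure μ] [Countable Q] [MeasurableEq V]
    (h : OrbitChart μ T pt ev) {γ : X → X} (hγ : IsInner μ T pt γ) {L : ℝ} (hL : 0 < L) :
    Integrable (displacement T pt L γ) μ := by
  refine Integrable.of_bound (C := 1) (h.aestronglyMeasurable_displacement hγ L) ?_
  refine .of_forall fun x => ?_
  rw [Real.norm_of_nonneg (displacement_nonneg hL x)]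
  exact min_le_left _ _

theorem tendsto_integral_displacement [IsFiniteMeasure μ] [Countable Q] [MeasurableEq V]
    (h : OrbitChart μ T pt ev) {γ : X → X} (hγ : IsInner μ T pt γ) :
    Filter.Tendsto (fun L : ℕ => ∫ x, displacement T pt (L + 1 : ℝ) γ x ∂μ) Filter.atTop
      (nhds 0) := by
  have := tendsto_integral_of_dominated_convergence (μ := μ)
    (F := fun (L : ℕ) x => displacement T pt (L + 1 : ℝ) γ x) (f := fun _ => 0) (fun _ => (1 : ℝ))
    (fun L => h.aestronglyMeasurable_displacement hγ _) (integrable_const _)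
    (fun L => .of_forall fun x => ?_) (.of_forall fun x => ?_)
  · simpa using this
  · rw [Real.norm_of_nonneg (displacement_nonneg (by positivity) x)]
    exact min_le_left _ _
  · have h1 : Filter.Tendsto (fun L : ℕ => 2 * ((T.sep (pt x) (pt (γ x))).ncard : ℝ) / (L + 1 : ℝ))
        Filter.atTop (nhds 0) := by
      simpa [div_eq_mul_inv] using
        (tendsto_one_div_add_atTop_nhds_zero_nat (𝕜 := ℝ)).const_mul
          (2 * ((T.sep (pt x) (pt (γ x))).ncard : ℝ))
    simpa [displacement] using (tendsto_const_nhds (x := (1 : ℝ))).min h1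

theorem integral_ratio_le [IsFiniteMeasure μ] [Countable Q] [MeasurableEq V]
    (h : OrbitChart μ T pt ev) {σ γ : X → X} (hσ : IsInner μ T pt σ)
    (hγ : IsInner μ T pt γ) (hc : Function.Commute σ γ) {L : ℝ} (hL : 0 < L) {W W' : Set Q}
    (hW : ∀ᵐ x ∂μ, ev (γ x) '' W ⊆ ev x '' W') :
    ∫ x, ratio T pt ev L σ W x ∂μ ≤ ∫ x, ratio T pt ev L σ W' x ∂μ +
      2 * ∫ x, displacement T pt L γ x ∂μ := by
  have i1 := h.integrable_ratio hσ hL W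
  have i2 := h.integrable_ratio hσ hL W'
  have i3 := h.integrable_displacement hγ hL
  have e1 : ∫ x, ratio T pt ev L σ W (γ x) ∂μ = ∫ x, ratio T pt ev L σ W x ∂μ := by
    conv_rhs => rw [← hγ.1.map_eq]
    exact (integral_map hγ.1.aemeasurable
      (by rw [hγ.1.map_eq]; exact i1.aestronglyMeasurable)).symm
  have e2 : ∫ x, displacement T pt L γ (σ x) ∂μ = ∫ x, displacement T pt L γ x ∂μ := by
    conv_rhs => rw [← hσ.1.map_eq]
    exact (integral_map hσ.1.aemeasurable
      (by rw [hσ.1.map_eq]; exact i3.aestronglyMeasurable)).symm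
  have i4 : Integrable (fun x => displacement T pt L γ (σ x)) μ :=
    hσ.1.integrable_comp_of_integrable i3
  have i5 : Integrable (fun x => ratio T pt ev L σ W (γ x)) μ :=
    hγ.1.integrable_comp_of_integrable i1
  calc ∫ x, ratio T pt ev L σ W x ∂μ = ∫ x, ratio T pt ev L σ W (γ x) ∂μ := e1.symm
    _ ≤ ∫ x, (ratio T pt ev L σ W' x +
        (displacement T pt L γ x + displacement T pt L γ (σ x))) ∂μ :=
      integral_mono_ae i5 (i2.add (i3.add i4)) (ae_ratio_comp_le hσ hγ hc hL hW)
    _ = _ := by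
      have i34 : Integrable (fun x => displacement T pt L γ x + displacement T pt L γ (σ x)) μ :=
        i3.add i4
      rw [integral_add i2 i34, integral_add i3 i4, e2, two_mul]

theorem integral_ratio_add_le [IsFiniteMeasure μ] [Countable Q] [MeasurableEq V]
    (h : OrbitChart μ T pt ev) {σ : X → X} (hσ : IsInner μ T pt σ) {L : ℝ} (hL : 0 < L)
    {A B C : Set Q} (hAB : Disjoint A B) (hAC : Disjoint A C) (hBC : Disjoint B C) :
    ∫ x, ratio T pt ev L σ A x ∂μ + ∫ x, ratio T pt ev L σ B x ∂μ +
      ∫ x, ratio T pt ev L σ C x ∂μ ≤ ∫ x, ratio T pt ev L σ Set.univ x ∂μ := by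
  have iA := h.integrable_ratio hσ hL A
  have iB := h.integrable_ratio hσ hL B
  have iC := h.integrable_ratio hσ hL C
  have iAB : Integrable (fun x => ratio T pt ev L σ A x + ratio T pt ev L σ B x) μ := iA.add iB
  rw [← integral_add iA iB, ← integral_add iAB iC]
  refine integral_mono_ae ((iA.add iB).add iC) (h.integrable_ratio hσ hL Set.univ) ?_
  filter_upwards [h.injective, hσ.2] with x hx hr
  have fS : (T.sep (pt x) (pt (σ x))).Finite := SimpleGraph.sep_finite hr
  have hd : ∀ {A B : Set Q}, Disjoint A B → Disjoint (T.sep (pt x) (pt (σ x)) ∩ ev x '' A)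
      (T.sep (pt x) (pt (σ x)) ∩ ev x '' B) := fun hAB =>
    ((Set.disjoint_image_iff hx).2 hAB).mono Set.inter_subset_right Set.inter_subset_right
  simp only [ratio, ← add_div]
  refine div_le_div_of_nonneg_right ?_ (le_max_of_le_right hL.le)
  norm_cast
  rw [← Set.ncard_union_eq (hd hAB) (fS.inter_of_left _) (fS.inter_of_left _),
    ← Set.ncard_union_eq ((hd hAC).union_left (hd hBC))
      ((fS.inter_of_left _).union (fS.inter_of_left _)) (fS.inter_of_left _)]
  refine Set.ncard_le_ncard ?_ (fS.inter_of_left _)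
  rintro v ((⟨h1, h2⟩ | ⟨h1, h2⟩) | ⟨h1, h2⟩) <;>
    exact ⟨h1, Set.image_mono (Set.subset_univ _) h2⟩

theorem integral_ratio_univ_le [IsFiniteMeasure μ] [Countable Q] [MeasurableEq V]
    (h : OrbitChart μ T pt ev) {σ : X → X} (hσ : IsInner μ T pt σ) {L : ℝ} (hL : 0 < L)
    {A B : Set Q} (hAB : A ∪ B = Set.univ) :
    ∫ x, ratio T pt ev L σ Set.univ x ∂μ ≤
      ∫ x, ratio T pt ev L σ A x ∂μ + ∫ x, ratio T pt ev L σ B x ∂μ := by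
  have iA := h.integrable_ratio hσ hL A
  have iB := h.integrable_ratio hσ hL B
  rw [← integral_add iA iB]
  refine integral_mono (h.integrable_ratio hσ hL Set.univ) (iA.add iB) fun x => ?_
  simp only [ratio, ← add_div]
  refine div_le_div_of_nonneg_right ?_ (le_max_of_le_right hL.le)
  norm_cast
  rw [← hAB, Set.image_union, Set.inter_union_distrib_left]
  exact Set.ncard_union_le _ _

/-- If commuting with `τ` there is a ping-pong pair acting on the labels of the chart, then the
distances between `pt x` and `pt (τ^[k] x)` are bounded in probability, uniformly in `k`. -/
theorem exists_forall_measureReal_le [IsProbabilityMeasure μ] [Countable Q] [MeasurableEq V]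
    (h : OrbitChart μ T pt ev) {τ : X → X} (hτ : IsInner μ T pt τ) {γ : Fin 2 → Fin 2 → X → X}
    (hγ : ∀ i j, IsInner μ T pt (γ i j)) (hc : ∀ i j, Function.Commute τ (γ i j))
    {D : Fin 2 → Set Q} {E : Fin 2 → Fin 2 → Set Q}
    (hD : D 0 ∪ D 1 = Set.univ) (hDE : ∀ i j, Disjoint (D i) (E i j))
    (hE : ∀ i, Disjoint (E i 0) (E i 1))
    (hγE : ∀ i j, ∀ᵐ x ∂μ, ev (γ i j x) '' D i ⊆ ev x '' E i j) :
    ∃ L : ℕ, ∀ k, μ.real {x | L < (T.sep (pt x) (pt (τ^[k] x))).ncard} ≤ 1 / 10 := by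
  have hlim : ∀ᶠ L : ℕ in Filter.atTop, ∀ i j,
      ∫ x, displacement T pt (L + 1 : ℝ) (γ i j) x ∂μ < 1 / 100 := by
    simp only [Filter.eventually_all]
    exact fun i j => (h.tendsto_integral_displacement (hγ i j)).eventually_lt_const (by norm_num)
  obtain ⟨L, hLd⟩ := hlim.exists
  have hL : (0 : ℝ) < L + 1 := by positivity
  refine ⟨L + 1, fun k => ?_⟩
  have hσ := hτ.iterate k
  have hcσ : ∀ i j, Function.Commute τ^[k] (γ i j) := fun i j => (hc i j).iterate_left k
  have hsmall : ∫ x, ratio T pt ev (L + 1 : ℝ) τ^[k] Set.univ x ∂μ ≤ 1 / 10 := by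
    have h1 := h.integral_ratio_univ_le hσ hL hD
    have h2 := fun i => h.integral_ratio_add_le hσ hL (hDE i 0) (hDE i 1) (hE i)
    have h3 := fun i j => h.integral_ratio_le hσ (hγ i j) (hcσ i j) hL (hγE i j)
    linarith [h2 0, h2 1, h3 0 0, h3 0 1, h3 1 0, h3 1 1, hLd 0 0, hLd 0 1, hLd 1 0, hLd 1 1]
  have hmarkov := mul_meas_ge_le_integral_of_nonneg (μ := μ)
    (.of_forall fun x => ratio_nonneg hL Set.univ x) (h.integrable_ratio hσ hL Set.univ) 1
  rw [one_mul] at hmarkov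
  refine le_trans (ENNReal.toReal_mono (by finiteness) (measure_mono_ae ?_)) (hmarkov.trans hsmall)
  filter_upwards [h.ae_sep_subset .id hσ] with x hsub hx
  change T.sep (pt x) (pt (τ^[k] x)) ⊆ Set.range (ev x) at hsub
  change L + 1 < (T.sep (pt x) (pt (τ^[k] x))).ncard at hx
  change 1 ≤ ratio T pt ev (L + 1 : ℝ) τ^[k] Set.univ x
  rw [ratio, Set.image_univ, Set.inter_eq_left.2 hsub, max_eq_left (by exact_mod_cast hx.le),
    div_self]
  exact_mod_cast (Nat.zero_lt_of_lt hx).ne'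

end OrbitChart

theorem sum_measureReal_le_of_card_le {X ι : Type*} [MeasurableSpace X] {μ : Measure X}
    [IsProbabilityMeasure μ] {s : Finset ι} {B : ι → Set X} {L : ℕ}
    (hB : ∀ i ∈ s, NullMeasurableSet (B i) μ)
    (h : ∀ᵐ x ∂μ, ∀ F ⊆ s, (∀ i ∈ F, x ∈ B i) → F.card ≤ L) :
    ∑ i ∈ s, μ.real (B i) ≤ L := by
  classical
  have h1 : ∑ i ∈ s, μ (B i) ≤ L := by
    calc ∑ i ∈ s, μ (B i) = ∑ i ∈ s, ∫⁻ x, (B i).indicator 1 x ∂μ :=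
          Finset.sum_congr rfl fun i hi => (lintegral_indicator_one₀ (hB i hi)).symm
      _ = ∫⁻ x, ∑ i ∈ s, (B i).indicator 1 x ∂μ :=
          (lintegral_finsetSum' _ fun i hi => aemeasurable_one.indicator₀ (hB i hi)).symm
      _ ≤ ∫⁻ _x, (L : ENNReal) ∂μ := by
          refine lintegral_mono_ae ?_
          filter_upwards [h] with x hx
          have := hx (s.filter fun i => x ∈ B i) (Finset.filter_subset _ _) (by simp)
          simp only [Set.indicator_apply, Pi.one_apply, Finset.sum_boole]
          exact_mod_cast this
      _ = L := by simp
  have h2 := ENNReal.toReal_mono (by simp) h1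
  rwa [ENNReal.toReal_sum (by simp), ENNReal.toReal_natCast] at h2

namespace OrbitChart

variable {X V Q : Type*} {T : SimpleGraph V} {pt : X → V} {ev : X → Q → V} {τ : X → X}

/-- The vertices separating `pt (τ^[k] x)` from `pt (τ^[l] x)`. -/
def between (T : SimpleGraph V) (pt : X → V) (τ : X → X) (k l : ℕ) (x : X) : Set V :=
  T.sep (pt (τ^[k] x)) (pt (τ^[l] x))

/-- The points `x` such that `between T pt τ k l x` has at most `L` elements, one of them being
`ev x q`. -/
def hits (T : SimpleGraph V) (pt : X → V) (ev : X → Q → V) (τ : X → X) (L k l : ℕ) (q : Q) :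
    Set X :=
  {x | ev x q ∈ between T pt τ k l x} ∩ {x | (between T pt τ k l x).ncard ≤ L}

theorem between_iterate (k l m : ℕ) (x : X) :
    between T pt τ k l (τ^[m] x) = between T pt τ (k + m) (l + m) x := by
  simp only [between, Function.iterate_add_apply]

variable [MeasurableSpace X] {μ : Measure X}

theorem ae_finite_between (hτ : IsInner μ T pt τ) (k l : ℕ) :
    ∀ᵐ x ∂μ, (between T pt τ k l x).Finite := by
  filter_upwards [(hτ.iterate k).2, (hτ.iterate l).2] with x h1 h2
  exact SimpleGraph.sep_finite (h1.symm.trans h2)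

variable [MeasurableSpace V]

theorem ae_between_subset_range (h : OrbitChart μ T pt ev) (hτ : IsInner μ T pt τ) (k l : ℕ) :
    ∀ᵐ x ∂μ, between T pt τ k l x ⊆ Set.range (ev x) :=
  h.ae_sep_subset (hτ.iterate k) (hτ.iterate l)

variable [Countable Q] [MeasurableEq V]

theorem nullMeasurableSet_ncard_between_le (h : OrbitChart μ T pt ev) (hτ : IsInner μ T pt τ)
    (L k l : ℕ) : NullMeasurableSet {x | (between T pt τ k l x).ncard ≤ L} μ := by
  have := nullMeasurableSet_le (h.aemeasurable_ncard_sep (hτ.iterate k) (hτ.iterate l))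
    (aemeasurable_const (b := (L : ℝ)))
  simpa only [Nat.cast_le, between] using this

theorem nullMeasurableSet_mem_between (h : OrbitChart μ T pt ev) (hτ : IsInner μ T pt τ)
    (k l : ℕ) (q : Q) : NullMeasurableSet {x | ev x q ∈ between T pt τ k l x} μ :=
  h.nullMeasurableSet_mem_sep (h.measurable_pt.comp (hτ.iterate k).1.measurable)
    (h.measurable_pt.comp (hτ.iterate l).1.measurable) (hτ.iterate k).2 (hτ.iterate l).2 q

theorem nullMeasurableSet_hits (h : OrbitChart μ T pt ev) (hτ : IsInner μ T pt τ)
    (L k l : ℕ) (q : Q) : NullMeasurableSet (hits T pt ev τ L k l q) μ :=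
  (h.nullMeasurableSet_mem_between hτ k l q).inter (h.nullMeasurableSet_ncard_between_le hτ L k l)

theorem sum_measureReal_hits_le [IsProbabilityMeasure μ] (h : OrbitChart μ T pt ev)
    (hτ : IsInner μ T pt τ)
    (hfree : ∀ᵐ x ∂μ, ∀ q, Function.Injective fun j => ev (τ^[j] x) q) (L e N : ℕ) (q : Q) :
    ∑ k ∈ Finset.range N, μ.real (hits T pt ev τ L k (k + e) q) ≤ L := by
  have h1 : ∀ k, μ.real (hits T pt ev τ L k (k + e) q) =
      μ.real (τ^[N - k] ⁻¹' hits T pt ev τ L k (k + e) q) := fun k =>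
    ((hτ.iterate (N - k)).1.measureReal_preimage (h.nullMeasurableSet_hits hτ L k _ q)).symm
  simp only [h1]
  refine sum_measureReal_le_of_card_le (fun k _ =>
    (h.nullMeasurableSet_hits hτ L k _ q).preimage
      (hτ.iterate (N - k)).1.quasiMeasurePreserving) ?_
  filter_upwards [hfree, ae_finite_between hτ N (N + e)] with x hx hfin F hF hFx
  have key : ∀ k ∈ F, ev (τ^[N - k] x) q ∈ between T pt τ N (N + e) x ∧
      (between T pt τ N (N + e) x).ncard ≤ L := by
    intro k hk
    obtain ⟨h2, h3⟩ := hFx k hk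
    have hkN : k < N := Finset.mem_range.1 (hF hk)
    have e1 : k + (N - k) = N := by omega
    have e2 : k + e + (N - k) = N + e := by omega
    simp only [Set.mem_ofPred_eq, between_iterate, e1, e2] at h2 h3
    exact ⟨h2, h3⟩
  rcases F.eq_empty_or_nonempty with rfl | ⟨k, hk⟩
  · simp
  refine le_trans ?_ (key k hk).2
  rw [← Set.ncard_coe_finset]
  refine Set.ncard_le_ncard_of_injOn (fun k => ev (τ^[N - k] x) q) (fun k hk => (key k hk).1) ?_
    hfin
  intro a ha b hb hab
  have h1 := hx q hab
  have h2 := Finset.mem_range.1 (hF ha)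
  have h3 := Finset.mem_range.1 (hF hb)
  omega

theorem sum_sum_measureReal_hits_le [IsProbabilityMeasure μ] (h : OrbitChart μ T pt ev)
    (hτ : IsInner μ T pt τ)
    (hfree : ∀ᵐ x ∂μ, ∀ q, Function.Injective fun j => ev (τ^[j] x) q) (L : ℕ) {M N : ℕ}
    (hNM : N ≤ M) (q : Q) :
    ∑ l ∈ Finset.Ico M (2 * M), ∑ k ∈ Finset.range N, μ.real (hits T pt ev τ L k l q) ≤
      2 * M * L := by
  rw [Finset.sum_comm]
  calc ∑ k ∈ Finset.range N, ∑ l ∈ Finset.Ico M (2 * M), μ.real (hits T pt ev τ L k l q)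
      ≤ ∑ k ∈ Finset.range N, ∑ e ∈ Finset.range (2 * M),
          μ.real (hits T pt ev τ L k (k + e) q) := by
        refine Finset.sum_le_sum fun k hk => ?_
        have hk := Finset.mem_range.1 hk
        rw [Finset.range_eq_Ico,
          Finset.sum_Ico_add (fun l => μ.real (hits T pt ev τ L k l q)) 0 (2 * M) k]
        exact Finset.sum_le_sum_of_subset_of_nonneg
          (Finset.Ico_subset_Ico (by omega) (by omega)) fun _ _ _ => measureReal_nonneg
    _ = ∑ e ∈ Finset.range (2 * M), ∑ k ∈ Finset.range N,
          μ.real (hits T pt ev τ L k (k + e) q) := Finset.sum_comm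
    _ ≤ ∑ e ∈ Finset.range (2 * M), (L : ℝ) :=
        Finset.sum_le_sum fun e _ => h.sum_measureReal_hits_le hτ hfree L e N q
    _ = 2 * M * L := by simp

theorem nullMeasurableSet_between_subset (h : OrbitChart μ T pt ev) (hτ : IsInner μ T pt τ)
    (k l : ℕ) (K : Finset Q) : NullMeasurableSet {x | between T pt τ k l x ⊆ ev x '' K} μ := by
  have h1 : NullMeasurableSet (⋂ q : {q // q ∉ K}, {x | ev x q ∈ between T pt τ k l x}ᶜ) μ :=
    .iInter fun q => (h.nullMeasurableSet_mem_between hτ k l q).compl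
  refine h1.congr ?_
  filter_upwards [h.ae_between_subset_range hτ k l, h.injective] with x hx hinj
  refine propext ?_
  change (x ∈ ⋂ q : {q // q ∉ K}, {x | ev x q ∈ between T pt τ k l x}ᶜ) ↔
    between T pt τ k l x ⊆ ev x '' K
  simp only [Set.mem_iInter, Set.mem_compl_iff, Set.mem_ofPred_eq, Subtype.forall]
  constructor
  · intro h1 v hv
    obtain ⟨q, rfl⟩ := hx hv
    by_contra hq
    exact h1 q (fun hqK => hq ⟨q, hqK, rfl⟩) hv
  · intro h1 q hq hqv
    exact hq (by simpa using (hinj.mem_set_image).1 (h1 hqv))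

theorem exists_finset_measureReal_le [IsProbabilityMeasure μ] (h : OrbitChart μ T pt ev)
    (hτ : IsInner μ T pt τ) (k l : ℕ) {ε : ℝ} (hε : 0 < ε) :
    ∃ K : Finset Q, μ.real {x | between T pt τ k l x ⊆ ev x '' K}ᶜ ≤ ε := by
  classical
  have hdir : Directed (· ⊆ ·) fun K : Finset Q => {x | between T pt τ k l x ⊆ ev x '' K} := by
    refine Monotone.directed_le fun K K' hK x hx => ?_
    exact Set.Subset.trans hx (Set.image_mono (by exact_mod_cast hK))
  have h1 : μ (⋃ K : Finset Q, {x | between T pt τ k l x ⊆ ev x '' K}) = 1 := by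
    have h2 : ∀ᵐ x ∂μ, x ∈ ⋃ K : Finset Q, {x | between T pt τ k l x ⊆ ev x '' K} := by
      filter_upwards [h.ae_between_subset_range hτ k l, ae_finite_between hτ k l,
        h.injective] with x h3 h4 h5
      refine Set.mem_iUnion.2 ⟨(h4.preimage h5.injOn).toFinset, fun v hv => ?_⟩
      obtain ⟨q, rfl⟩ := h3 hv
      exact ⟨q, by simpa using hv, rfl⟩
    rw [measure_congr (Filter.eventuallyEq_univ (s := ⋃ K : Finset Q, _).2 h2), measure_univ]
  rw [hdir.measure_iUnion] at h1
  have h2 : (1 - ENNReal.ofReal ε) < ⨆ K : Finset Q, μ {x | between T pt τ k l x ⊆ ev x '' K} := by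
    rw [h1]
    exact ENNReal.sub_lt_self (by simp) (by simp) (by simpa using hε)
  obtain ⟨K, hK⟩ := lt_iSup_iff.1 h2
  refine ⟨K, ?_⟩
  refine ENNReal.toReal_le_of_le_ofReal hε.le ?_
  rw [prob_compl_eq_one_sub₀ (h.nullMeasurableSet_between_subset hτ k l K)]
  exact tsub_le_iff_tsub_le.1 hK.le

/-- One step of the choice of an increasing sequence of finite sets of labels. -/
theorem exists_finset_forall_measureReal_le [IsProbabilityMeasure μ] (h : OrbitChart μ T pt ev)
    (hτ : IsInner μ T pt τ) (N : ℕ) (K : Finset Q) {ε : ℝ} (hε : 0 < ε) :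
    ∃ K' : Finset Q, K ⊆ K' ∧
      ∀ k < N, μ.real {x | between T pt τ 0 k x ⊆ ev x '' K'}ᶜ ≤ ε := by
  classical
  choose f hf using fun k => h.exists_finset_measureReal_le hτ 0 k hε
  refine ⟨K ∪ (Finset.range N).biUnion f, Finset.subset_union_left, fun k hk => ?_⟩
  refine (measureReal_mono ?_).trans (hf k)
  refine Set.compl_subset_compl.2 fun x hx => ?_
  refine Set.Subset.trans hx (Set.image_mono ?_)
  have : f k ⊆ K ∪ (Finset.range N).biUnion f :=
    (Finset.subset_biUnion_of_mem f (Finset.mem_range.2 hk)).trans Finset.subset_union_right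
  exact_mod_cast this

/-- Choosing for every `l` the best `k`, the interval from `τ^[k] x` to `τ^[l] x` rarely meets a
finite set of labels that is small compared to the number of candidates for `k`. -/
theorem exists_sum_measureReal_biUnion_le [IsProbabilityMeasure μ] (h : OrbitChart μ T pt ev)
    (hτ : IsInner μ T pt τ)
    (hfree : ∀ᵐ x ∂μ, ∀ q, Function.Injective fun j => ev (τ^[j] x) q) (L : ℕ) {M N : ℕ}
    (hN : 0 < N) (hNM : N ≤ M) (K : Finset Q) (hK : 20 * L * K.card ≤ N) :
    ∃ κ : ℕ → ℕ, (∀ l, κ l < N) ∧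
      ∑ l ∈ Finset.Ico M (2 * M), μ.real (⋃ q ∈ K, hits T pt ev τ L (κ l) l q) ≤ M / 10 := by
  choose κ hκ hmin using fun l => (Finset.range N).exists_min_image
    (fun k => μ.real (⋃ q ∈ K, hits T pt ev τ L k l q)) ⟨0, Finset.mem_range.2 hN⟩
  refine ⟨κ, fun l => Finset.mem_range.1 (hκ l), ?_⟩
  have h1 : ∀ l, N * μ.real (⋃ q ∈ K, hits T pt ev τ L (κ l) l q) ≤
      ∑ q ∈ K, ∑ k ∈ Finset.range N, μ.real (hits T pt ev τ L k l q) := by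
    intro l
    rw [Finset.sum_comm]
    have h2 := (Finset.range N).card_nsmul_le_sum _ _ (hmin l)
    rw [Finset.card_range, nsmul_eq_mul] at h2
    exact h2.trans (Finset.sum_le_sum fun k _ => measureReal_biUnion_finset_le _ _)
  have h2 : N * ∑ l ∈ Finset.Ico M (2 * M), μ.real (⋃ q ∈ K, hits T pt ev τ L (κ l) l q) ≤
      K.card * (2 * M * L) := by
    rw [Finset.mul_sum]
    refine (Finset.sum_le_sum fun l _ => h1 l).trans ?_
    rw [Finset.sum_comm, ← nsmul_eq_mul]
    exact Finset.sum_le_card_nsmul _ _ _ fun q _ =>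
      h.sum_sum_measureReal_hits_le hτ hfree L hNM q
  have h3 : (20 * L * K.card : ℝ) ≤ N := by exact_mod_cast hK
  have h4 : (0 : ℝ) < N := by exact_mod_cast hN
  refine le_of_mul_le_mul_left (h2.trans ?_) h4
  have h5 : (0 : ℝ) ≤ M := Nat.cast_nonneg M
  nlinarith

theorem measureReal_compl_ncard_between_le (h : OrbitChart μ T pt ev)
    (hτ : IsInner μ T pt τ) {L : ℕ}
    (hL : ∀ k, μ.real {x | L < (T.sep (pt x) (pt (τ^[k] x))).ncard} ≤ 1 / 10) {k l : ℕ}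
    (hkl : k ≤ l) : μ.real {x | (between T pt τ k l x).ncard ≤ L}ᶜ ≤ 1 / 10 := by
  have h1 := (hτ.iterate k).1.measureReal_preimage
    (h.nullMeasurableSet_ncard_between_le hτ L 0 (l - k)).compl
  have h2 : τ^[k] ⁻¹' {x | (between T pt τ 0 (l - k) x).ncard ≤ L}ᶜ =
      {x | (between T pt τ k l x).ncard ≤ L}ᶜ := by
    ext x
    simp [between_iterate, Nat.sub_add_cancel hkl]
  rw [← h2, h1]
  refine le_trans (le_of_eq ?_) (hL (l - k))
  congr 1
  ext x
  simp [between]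

/-- The points at which the median of `x`, `τ^[k] x` and `τ^[l] x` has a label in `K' \ K` and
`x` is close to `τ^[l] x`. -/
def good (T : SimpleGraph V) (pt : X → V) (ev : X → Q → V) (τ : X → X) (L k l : ℕ)
    (K K' : Finset Q) : Set X :=
  ({x | between T pt τ 0 k x ⊆ ev x '' K'} ∩ {x | (between T pt τ k l x).ncard ≤ L}) ∩
    ((⋃ q ∈ K, hits T pt ev τ L k l q)ᶜ ∩ {x | (between T pt τ 0 l x).ncard ≤ L})

theorem nullMeasurableSet_good (h : OrbitChart μ T pt ev) (hτ : IsInner μ T pt τ) (L k l : ℕ)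
    (K K' : Finset Q) : NullMeasurableSet (good T pt ev τ L k l K K') μ :=
  ((h.nullMeasurableSet_between_subset hτ 0 k K').inter
    (h.nullMeasurableSet_ncard_between_le hτ L k l)).inter
    ((NullMeasurableSet.biUnion K.countable_toSet fun q _ =>
      h.nullMeasurableSet_hits hτ L k l q).compl.inter
      (h.nullMeasurableSet_ncard_between_le hτ L 0 l))

theorem le_measureReal_good [IsProbabilityMeasure μ] (h : OrbitChart μ T pt ev)
    (hτ : IsInner μ T pt τ) {L : ℕ}
    (hL : ∀ k, μ.real {x | L < (T.sep (pt x) (pt (τ^[k] x))).ncard} ≤ 1 / 10) {k l : ℕ}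
    (hkl : k ≤ l) {K K' : Finset Q}
    (hK' : μ.real {x | between T pt τ 0 k x ⊆ ev x '' K'}ᶜ ≤ 1 / 10) :
    7 / 10 - μ.real (⋃ q ∈ K, hits T pt ev τ L k l q) ≤ μ.real (good T pt ev τ L k l K K') := by
  have h1 := h.measureReal_compl_ncard_between_le hτ hL hkl
  have h2 := h.measureReal_compl_ncard_between_le hτ hL (Nat.zero_le l)
  have h3 := probReal_compl_eq_one_sub₀ (h.nullMeasurableSet_good hτ L k l K K')
  rw [good, Set.compl_inter, Set.compl_inter, Set.compl_inter, compl_compl, ← good] at h3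
  have h4 := measureReal_union_le (μ := μ)
    ({x | between T pt τ 0 k x ⊆ ev x '' K'}ᶜ ∪ {x | (between T pt τ k l x).ncard ≤ L}ᶜ)
    ((⋃ q ∈ K, hits T pt ev τ L k l q) ∪ {x | (between T pt τ 0 l x).ncard ≤ L}ᶜ)
  have h5 := measureReal_union_le (μ := μ)
    {x | between T pt τ 0 k x ⊆ ev x '' K'}ᶜ {x | (between T pt τ k l x).ncard ≤ L}ᶜ
  have h6 := measureReal_union_le (μ := μ)
    (⋃ q ∈ K, hits T pt ev τ L k l q) {x | (between T pt τ 0 l x).ncard ≤ L}ᶜ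
  linarith

theorem sum_measureReal_good_le [IsProbabilityMeasure μ] (h : OrbitChart μ T pt ev)
    (hτ : IsInner μ T pt τ) (L l J : ℕ) (κ : ℕ → ℕ) {K : ℕ → Finset Q} (hK : Monotone K) :
    ∑ i ∈ Finset.range J, μ.real (good T pt ev τ L (κ i) l (K i) (K (i + 1))) ≤ L := by
  refine sum_measureReal_le_of_card_le (fun i _ => h.nullMeasurableSet_good hτ L _ l _ _) ?_
  filter_upwards [h.injective, ae_all_iff.2 fun k => (hτ.iterate k).2] with x hinj hr F _ hF
  have key : ∀ i ∈ F, ∃ q, q ∈ K (i + 1) ∧ q ∉ K i ∧ ev x q ∈ between T pt τ 0 l x := by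
    intro i hi
    obtain ⟨⟨h1, h2⟩, h3, -⟩ := hF i hi
    obtain ⟨v, ⟨hv1, hv2⟩, hv3⟩ := h.acyclic.exists_median (hr (κ i)) (hr l)
    obtain ⟨q, hq, rfl⟩ := h1 hv1
    refine ⟨q, by exact_mod_cast hq, fun hqK => h3 ?_, hv2⟩
    exact Set.mem_biUnion hqK ⟨hv3, h2⟩
  rcases F.eq_empty_or_nonempty with rfl | ⟨i, hi⟩
  · simp
  have : Nonempty Q := ⟨(key i hi).choose⟩
  choose! f hf1 hf2 hf3 using key
  refine le_trans ?_ (hF i hi).2.2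
  rw [← Set.ncard_coe_finset]
  refine Set.ncard_le_ncard_of_injOn (fun i => ev x (f i)) hf3 ?_ (SimpleGraph.sep_finite (hr l))
  have hlt : ∀ a ∈ F, ∀ b ∈ F, a < b → f a ≠ f b := fun a ha b hb hab he =>
    hf2 b hb (he ▸ hK hab (hf1 a ha))
  intro a ha b hb hab
  rcases lt_trichotomy a b with h1 | h1 | h1
  · exact absurd (hinj hab) (hlt a ha b hb h1)
  · exact h1
  · exact absurd (hinj hab).symm (hlt b hb a ha h1)

/-- In a forest, a map with infinite orbits cannot have displacements that are bounded in
probability uniformly in time. -/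
theorem false_of_forall_measureReal_le [IsProbabilityMeasure μ] (h : OrbitChart μ T pt ev)
    (hτ : IsInner μ T pt τ)
    (hfree : ∀ᵐ x ∂μ, ∀ q, Function.Injective fun j => ev (τ^[j] x) q) {L : ℕ}
    (hL : ∀ k, μ.real {x | L < (T.sep (pt x) (pt (τ^[k] x))).ncard} ≤ 1 / 10) : False := by
  choose f hfK hf using fun K : Finset Q => h.exists_finset_forall_measureReal_le hτ
    (20 * L * K.card + 1) K (ε := 1 / 10) (by norm_num)
  let K : ℕ → Finset Q := fun i => f^[i] ∅
  have hKs : ∀ i, K (i + 1) = f (K i) := fun i => Function.iterate_succ_apply' f i ∅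
  have hK : Monotone K := monotone_nat_of_le_succ fun i => by rw [hKs]; exact hfK (K i)
  let J := 2 * L + 1
  let M := 20 * L * (K J).card + 1
  have hM : (0 : ℝ) < M := by positivity
  have hNM : ∀ i < J, 20 * L * (K i).card + 1 ≤ M := fun i hi =>
    Nat.succ_le_succ (Nat.mul_le_mul_left _ (Finset.card_le_card (hK hi.le)))
  have hch : ∀ i : ℕ, ∃ κ : ℕ → ℕ, i < J → (∀ l, κ l < 20 * L * (K i).card + 1) ∧
      ∑ l ∈ Finset.Ico M (2 * M), μ.real (⋃ q ∈ K i, hits T pt ev τ L (κ l) l q) ≤ M / 10 := by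
    intro i
    by_cases hi : i < J
    · obtain ⟨κ, hκ⟩ := h.exists_sum_measureReal_biUnion_le hτ hfree L (Nat.succ_pos _) (hNM i hi)
        (K i) (Nat.le_succ _)
      exact ⟨κ, fun _ => hκ⟩
    · exact ⟨0, fun h => absurd h hi⟩
  choose κ hκ using hch
  obtain ⟨l, hl, hsum⟩ : ∃ l ∈ Finset.Ico M (2 * M), ∑ i ∈ Finset.range J,
      μ.real (⋃ q ∈ K i, hits T pt ev τ L (κ i l) l q) ≤ J / 10 := by
    refine Finset.exists_le_of_sum_le (Finset.nonempty_Ico.2 (by omega)) ?_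
    rw [Finset.sum_comm, Finset.sum_const, Nat.card_Ico, nsmul_eq_mul]
    refine (Finset.sum_le_card_nsmul _ _ (M / 10 : ℝ) fun i hi =>
      (hκ i (Finset.mem_range.1 hi)).2).trans (le_of_eq ?_)
    rw [Finset.card_range, nsmul_eq_mul, show 2 * M - M = M by omega]
    ring
  have hlow : ∑ i ∈ Finset.range J, (7 / 10 - μ.real (⋃ q ∈ K i, hits T pt ev τ L (κ i l) l q)) ≤
      ∑ i ∈ Finset.range J, μ.real (good T pt ev τ L (κ i l) l (K i) (K (i + 1))) := by
    refine Finset.sum_le_sum fun i hi => ?_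
    have hi := Finset.mem_range.1 hi
    have hκl := (hκ i hi).1 l
    have := hNM i hi
    refine h.le_measureReal_good hτ hL (by have := (Finset.mem_Ico.1 hl).1; omega) ?_
    rw [hKs]
    exact hf (K i) _ hκl
  have hup := h.sum_measureReal_good_le hτ L l J (fun i => κ i l) hK
  rw [Finset.sum_sub_distrib, Finset.sum_const, Finset.card_range, nsmul_eq_mul] at hlow
  have hJ : (J : ℝ) = 2 * L + 1 := by simp [J]
  have hL0 : (0 : ℝ) ≤ L := Nat.cast_nonneg L
  linarith

end OrbitChart

namespace Torus

variable {ι : Type*}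

/-- The coordinates in `[0, 1)` of a point of the torus. -/
noncomputable def lift (x : ι → UnitAddCircle) (i : ι) : ℝ := AddCircle.equivIco 1 0 (x i)

@[simp]
theorem coe_lift (x : ι → UnitAddCircle) (i : ι) : (lift x i : UnitAddCircle) = x i :=
  AddCircle.coe_equivIco

theorem lift_injective : Function.Injective (lift (ι := ι)) := fun x y h => by
  ext i
  rw [← coe_lift x, ← coe_lift y, h]

theorem measurable_lift : Measurable (lift (ι := ι)) :=
  measurable_pi_lambda _ fun i =>
    measurable_subtype_coe.comp ((AddCircle.measurableEquivIco 1 0).measurable.comp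
      (measurable_pi_apply i))

section Shear

variable [DecidableEq ι]

/-- The automorphism of the torus adding `c` times the `i`-th coordinate to the `j`-th one. -/
def shear (i j : ι) (c : ℤ) (x : ι → UnitAddCircle) : ι → UnitAddCircle :=
  x + Pi.single j (c • x i)

theorem commute_shear {i j k l : ι} (hjk : j ≠ k) (hil : i ≠ l) (c c' : ℤ) :
    Function.Commute (shear i j c) (shear k l c') := fun x => by
  simp only [shear, Pi.add_apply, Pi.single_eq_of_ne hil, Pi.single_eq_of_ne hjk.symm, add_zero]
  abel

theorem iterate_shear_apply {i j : ι} (hij : i ≠ j) (c : ℤ) (x : ι → UnitAddCircle) (k : ℕ) :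
    (shear i j c)^[k] x j = x j + (k * c : ℤ) • x i := by
  have h : ∀ k : ℕ, (shear i j c)^[k] x i = x i := fun k => by
    induction k with
    | zero => rfl
    | succ k ih => simp [Function.iterate_succ_apply', shear, Pi.single_eq_of_ne hij, ih]
  induction k with
  | zero => simp
  | succ k ih =>
    rw [Function.iterate_succ_apply', shear, Pi.add_apply, Pi.single_eq_same, h, ih]
    push_cast
    rw [add_mul, one_mul, add_smul, add_assoc]

theorem exists_lift_shear (i j : ι) (c : ℤ) (x : ι → UnitAddCircle) :
    ∃ t : ℤ, lift (shear i j c x) = lift x + Pi.single j (c * lift x i + t) := by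
  have h1 : ((lift (shear i j c x) j - (lift x j + c * lift x i) : ℝ) : UnitAddCircle) = 0 := by
    rw [AddCircle.coe_sub, AddCircle.coe_add, ← zsmul_eq_mul, AddCircle.coe_zsmul]
    simp [shear]
  obtain ⟨t, ht⟩ := (AddCircle.coe_eq_zero_iff _).1 h1
  refine ⟨t, funext fun k => ?_⟩
  by_cases hk : k = j
  · subst hk
    simp only [zsmul_eq_mul, mul_one] at ht
    simp only [Pi.add_apply, Pi.single_eq_same]
    linarith
  · simp [lift, shear, Pi.single_eq_of_ne hk]

end Shear

instance : IsProbabilityMeasure (volume : Measure UnitAddCircle) := ⟨by simp⟩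

variable [Fintype ι]

theorem measurePreserving_of_surjective {κ : Type*} [Fintype κ]
    (f : (ι → UnitAddCircle) →+ (κ → UnitAddCircle)) (hf : Continuous f)
    (hs : Function.Surjective f) : MeasurePreserving f :=
  AddMonoidHom.measurePreserving hf hs (by simp)

theorem volume_setOf_sum_zsmul_eq (a : ι → ℤ) (ha : a ≠ 0) (c : UnitAddCircle) :
    volume {x : ι → UnitAddCircle | ∑ i, a i • x i = c} = 0 := by
  classical
  obtain ⟨j, hj⟩ := Function.ne_iff.1 ha
  let f : (ι → UnitAddCircle) →+ UnitAddCircle :=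
    ∑ i, (zsmulAddGroupHom (a i)).comp (Pi.evalAddMonoidHom _ i)
  have hf : ∀ x, f x = ∑ i, a i • x i := fun x => by simp [f]
  have hfc : Continuous f := by
    simp only [funext hf]
    fun_prop
  have hs : Function.Surjective f := by
    intro y
    obtain ⟨y, rfl⟩ := QuotientAddGroup.mk_surjective y
    refine ⟨Pi.single j ((y / a j : ℝ) : UnitAddCircle), ?_⟩
    rw [hf, Finset.sum_eq_single j]
    · rw [Pi.single_eq_same, ← AddCircle.coe_zsmul, zsmul_eq_mul,
        mul_div_cancel₀ _ (by exact_mod_cast hj)]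
    · intro i _ hij
      rw [Pi.single_eq_of_ne hij, smul_zero]
    · simp
  have hp : MeasurePreserving f := AddMonoidHom.measurePreserving hfc hs (by simp)
  have : {x : ι → UnitAddCircle | ∑ i, a i • x i = c} = f ⁻¹' {c} := by
    ext x
    simp [hf]
  rw [this, hp.measure_preimage (MeasurableSet.singleton c).nullMeasurableSet]
  have := AddCircle.volume_closedBall 1 (x := c) 0
  simpa using this

theorem ae_sum_mul_lift_ne (a : ι → ℚ) (ha : a ≠ 0) (c : ℚ) :
    ∀ᵐ x : ι → UnitAddCircle, ∑ i, (a i : ℝ) * lift x i + c ≠ 0 := by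
  obtain ⟨D, hD⟩ := IsLocalization.exist_integer_multiples_of_finite (nonZeroDivisors ℤ) a
  choose b hb using hD
  have hD0 : (D : ℤ) ≠ 0 := nonZeroDivisors.coe_ne_zero D
  have hbD : ∀ i, (b i : ℚ) = (D : ℤ) * a i := fun i => by
    simpa [Submonoid.smul_def] using hb i
  have hb0 : b ≠ 0 := by
    rintro rfl
    refine ha (funext fun i => ?_)
    simpa [hD0] using hbD i
  filter_upwards [measure_eq_zero_iff_ae_notMem.1
    (volume_setOf_sum_zsmul_eq b hb0 ((-((D : ℤ) * c) : ℝ) : UnitAddCircle))] with x hx h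
  refine hx ?_
  have h2 : ∑ i, (b i : ℝ) * lift x i = -((D : ℤ) * c) := by
    have hbD' : ∀ i, (b i : ℝ) = (D : ℤ) * a i := fun i => by exact_mod_cast hbD i
    simp only [hbD', mul_assoc, ← Finset.mul_sum]
    linear_combination ((D : ℤ) : ℝ) * h
  rw [← h2]
  simp only [← coe_lift x, ← AddCircle.coe_zsmul, zsmul_eq_mul]
  exact (map_sum (QuotientAddGroup.mk' (AddSubgroup.zmultiples (1 : ℝ))) _ _).symm

/-- For almost every point of the torus, the coordinates together with `1` are linearly
independent over `ℚ`. -/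
theorem ae_forall_eq_zero : ∀ᵐ x : ι → UnitAddCircle,
    ∀ (a : ι → ℚ) (c : ℚ), ∑ i, (a i : ℝ) * lift x i + c = 0 → a = 0 ∧ c = 0 := by
  have h1 : ∀ᵐ x : ι → UnitAddCircle, ∀ p : (ι → ℚ) × ℚ, p.1 ≠ 0 →
      ∑ i, (p.1 i : ℝ) * lift x i + p.2 ≠ 0 := by
    refine ae_all_iff.2 fun p => ?_
    by_cases hp : p.1 = 0
    · exact .of_forall fun x h => absurd hp h
    · filter_upwards [ae_sum_mul_lift_ne p.1 hp p.2] with x hx _ using hx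
  filter_upwards [h1] with x hx a c h
  by_cases ha : a = 0
  · subst ha
    exact ⟨rfl, by simpa using h⟩
  · exact absurd h (hx (a, c) ha)


variable [DecidableEq ι]

theorem measurePreserving_shear {i j : ι} (hij : i ≠ j) (c : ℤ) :
    MeasurePreserving (shear i j c) := by
  let f : (ι → UnitAddCircle) →+ (ι → UnitAddCircle) := .id _ +
    (AddMonoidHom.single (fun _ => UnitAddCircle) j).comp
      ((zsmulAddGroupHom c).comp (Pi.evalAddMonoidHom _ i))
  have hf : ⇑f = shear i j c := rfl
  rw [← hf]
  refine measurePreserving_of_surjective f ?_ fun y => ⟨shear i j (-c) y, ?_⟩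
  · rw [hf]
    unfold shear
    exact continuous_id.add ((continuous_single j).comp (by fun_prop))
  · rw [hf]
    simp [shear, Pi.single_eq_of_ne hij, add_assoc, ← Pi.single_add]

theorem injective_iterate_shear {i j : ι} (hij : i ≠ j) {c : ℤ} (hc : c ≠ 0)
    {x : ι → UnitAddCircle}
    (hx : ∀ (a : ι → ℚ) (c : ℚ), ∑ i, (a i : ℝ) * lift x i + c = 0 → a = 0 ∧ c = 0) :
    Function.Injective fun k => (shear i j c)^[k] x := by
  intro k l hkl
  have h1 := congrFun hkl j
  simp only [iterate_shear_apply hij, add_right_inj] at h1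
  rw [← sub_eq_zero, ← sub_smul, ← coe_lift x, ← AddCircle.coe_zsmul, AddCircle.coe_eq_zero_iff] at h1
  obtain ⟨t, ht⟩ := h1
  have h2 := (hx (Pi.single i ((k * c - l * c : ℤ) : ℚ)) (-t : ℤ) ?_).1
  · have h3 := congrFun h2 i
    rw [Pi.single_eq_same, Pi.zero_apply, Int.cast_eq_zero, ← sub_mul] at h3
    have := (mul_eq_zero.1 h3).resolve_right hc
    omega
  · rw [Finset.sum_eq_single i]
    · simp only [zsmul_eq_mul, mul_one] at ht
      rw [Pi.single_eq_same]
      push_cast at ht ⊢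
      rw [ht]
      ring
    · intro b _ hb
      simp [Pi.single_eq_of_ne hb]
    · simp

end Torus

namespace FN

variable {m : ℕ}

theorem refl {n : ℕ} (x : Fin (n - 1) → ℝ) : FN n x x := ⟨1, by simp [Matrix.map_one]⟩

theorem trans {n : ℕ} {x y z : Fin (n - 1) → ℝ} (hxy : FN n x y) (hyz : FN n y z) :
    FN n x z := by
  obtain ⟨M, hM⟩ := hxy
  obtain ⟨M', hM'⟩ := hyz
  refine ⟨M * M', ?_⟩
  rw [← hM', ← hM, Matrix.vecMul_vecMul, Units.val_mul]
  congr 1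
  exact Matrix.map_mul (f := Rat.castHom ℝ)

theorem extend1_castSucc (x : Fin m → ℝ) (i : Fin m) :
    extend1 (N := m + 1) x i.castSucc = x i := by
  simp [extend1]

theorem extend1_last (x : Fin m → ℝ) : extend1 (N := m + 1) x (Fin.last m) = 1 := by
  simp [extend1]

/-- The image of `x` under the rational affine map with linear part `p.1` and translation part
`p.2`. -/
def affine (x : Fin m → ℝ) (p : GL (Fin m) ℚ × (Fin m → ℚ)) (j : Fin m) : ℝ :=
  ∑ i, x i * (p.1 i j : ℝ) + p.2 j

theorem iff_exists (x y : Fin m → ℝ) : FN (m + 1) x y ↔ ∃ M : GL (Fin (m + 1)) ℚ,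
    (∀ j : Fin m, ∑ i : Fin m, x i * (M i.castSucc j.castSucc : ℝ) +
      (M (Fin.last m) j.castSucc : ℝ) = y j) ∧
    ∑ i : Fin m, x i * (M i.castSucc (Fin.last m) : ℝ) + (M (Fin.last m) (Fin.last m) : ℝ) = 1 := by
  refine exists_congr fun M => ?_
  rw [funext_iff, Fin.forall_fin_succ']
  simp only [Matrix.vecMul, dotProduct, Fin.sum_univ_castSucc, extend1_castSucc, extend1_last,
    Matrix.map_apply, one_mul]

/-- The block matrix of an affine map acting on row vectors. -/
def affineMatrix (A : Matrix (Fin m) (Fin m) ℚ) (b : Fin m → ℚ) :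
    Matrix (Fin (m + 1)) (Fin (m + 1)) ℚ :=
  (Matrix.fromBlocks A 0 (Matrix.of fun _ => b) 1).submatrix finSumFinEquiv.symm finSumFinEquiv.symm

theorem det_affineMatrix (A : Matrix (Fin m) (Fin m) ℚ) (b : Fin m → ℚ) :
    (affineMatrix A b).det = A.det := by
  rw [affineMatrix, Matrix.det_submatrix_equiv_self, Matrix.det_fromBlocks_zero₁₂, Matrix.det_one,
    mul_one]

theorem self_affine (x : Fin m → ℝ) (p : GL (Fin m) ℚ × (Fin m → ℚ)) :
    FN (m + 1) x (affine x p) := by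
  rw [iff_exists]
  refine ⟨Matrix.GeneralLinearGroup.mkOfDetNeZero (affineMatrix p.1 p.2) ?_, ?_⟩
  · rw [det_affineMatrix]
    exact p.1.det_ne_zero
  · simp [Matrix.GeneralLinearGroup.mkOfDetNeZero, affineMatrix, affine]

theorem exists_affine {x y : Fin m → ℝ} (h : FN (m + 1) x y)
    (hx : ∀ (a : Fin m → ℚ) (c : ℚ), ∑ i, (a i : ℝ) * x i + c = 0 → a = 0 ∧ c = 0) :
    ∃ p, affine x p = y := by
  obtain ⟨M, h1, h2⟩ := (iff_exists x y).1 h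
  obtain ⟨h3, h4⟩ := hx (fun i => M i.castSucc (Fin.last m)) (M (Fin.last m) (Fin.last m) - 1) (by
    push_cast
    rw [← add_sub_assoc, sub_eq_zero, ← h2]
    simp only [mul_comm])
  let A : Matrix (Fin m) (Fin m) ℚ := Matrix.of fun i j => M i.castSucc j.castSucc
  let b : Fin m → ℚ := fun j => M (Fin.last m) j.castSucc
  have h5 : (M : Matrix (Fin (m + 1)) (Fin (m + 1)) ℚ) = affineMatrix A b := by
    ext i j
    induction i using Fin.lastCases <;> induction j using Fin.lastCases <;>
      simp [affineMatrix, A, b, sub_eq_zero.1 h4]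
    exact congrFun h3 _
  have hA : A.det ≠ 0 := by
    rw [← det_affineMatrix A b, ← h5]
    exact M.det_ne_zero
  refine ⟨(Matrix.GeneralLinearGroup.mkOfDetNeZero A hA, b), funext fun j => ?_⟩
  rw [← h1 j]
  rfl

theorem affine_injective {x : Fin m → ℝ}
    (hx : ∀ (a : Fin m → ℚ) (c : ℚ), ∑ i, (a i : ℝ) * x i + c = 0 → a = 0 ∧ c = 0) :
    Function.Injective (affine x) := by
  rintro ⟨A, b⟩ ⟨A', b'⟩ h
  have h1 : ∀ j, (fun i => A i j - A' i j) = 0 ∧ b j - b' j = 0 := fun j => by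
    refine hx _ _ ?_
    have := congrFun h j
    simp only [affine] at this
    simp only [Rat.cast_sub, sub_mul, Finset.sum_sub_distrib]
    simp only [mul_comm _ (x _)]
    linarith
  refine Prod.ext (Units.ext (Matrix.ext fun i j => ?_)) (funext fun j => sub_eq_zero.1 (h1 j).2)
  exact sub_eq_zero.1 (congrFun (h1 j).1 i)

theorem affine_left_injective (p : GL (Fin m) ℚ × (Fin m → ℚ)) :
    Function.Injective fun x => affine x p := by
  intro x y h
  have h1 : Matrix.vecMul x ((p.1 : Matrix (Fin m) (Fin m) ℚ).map (Rat.castHom ℝ)) =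
      Matrix.vecMul y ((p.1 : Matrix (Fin m) (Fin m) ℚ).map (Rat.castHom ℝ)) := by
    ext j
    have := congrFun h j
    simp only [affine, add_left_inj] at this
    exact this
  refine Matrix.vecMul_injective_of_isUnit ?_ h1
  exact p.1.isUnit.map (Rat.castHom ℝ).mapMatrix

/-- The row operation adding `c` times the `j`-th row to the `i`-th one. -/
def rowAdd {i j : Fin m} (hij : i ≠ j) (c : ℤ) : GL (Fin m) ℚ :=
  Matrix.GeneralLinearGroup.mkOfDetNeZero (Matrix.transvection i j (c : ℚ))
    (by rw [Matrix.det_transvection_of_ne i j hij]; exact one_ne_zero)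

theorem rowAdd_mul_apply {i j : Fin m} (hij : i ≠ j) (c : ℤ) (A : GL (Fin m) ℚ) (l k : Fin m) :
    (rowAdd hij c * A) l k = A l k + if l = i then c * A j k else 0 := by
  rw [Units.val_mul]
  change (Matrix.transvection i j (c : ℚ) * (A : Matrix (Fin m) (Fin m) ℚ)) l k = _
  by_cases hl : l = i
  · subst hl
    rw [Matrix.transvection_mul_apply_same, if_pos rfl]
  · rw [Matrix.transvection_mul_apply_of_ne _ _ _ _ hl, if_neg hl, add_zero]

theorem affine_add_single {i j : Fin m} (hij : i ≠ j) (c t : ℤ) (x : Fin m → ℝ)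
    (p : GL (Fin m) ℚ × (Fin m → ℚ)) :
    affine (x + Pi.single j (c * x i + t)) p =
      affine x (rowAdd hij c * p.1, p.2 + (t : ℚ) • p.1 j) := by
  ext k
  simp only [affine, rowAdd_mul_apply, Pi.add_apply, Pi.smul_apply, smul_eq_mul, add_mul,
    Finset.sum_add_distrib, Rat.cast_add, mul_add, Pi.single_apply, ite_mul, zero_mul,
    Finset.sum_ite_eq', Finset.mem_univ, if_true]
  have : ∀ l, x l * ((if l = i then (c : ℚ) * p.1 j k else 0 : ℚ) : ℝ) =
      if l = i then x l * (c * p.1 j k) else 0 := fun l => by split_ifs <;> simp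
  simp only [this, Finset.sum_ite_eq', Finset.mem_univ, if_true, Rat.cast_mul, Rat.cast_intCast]
  ring

theorem measurable_affine (p : GL (Fin m) ℚ × (Fin m → ℚ)) : Measurable fun x => affine x p := by
  unfold affine
  fun_prop

/-- A column in which the `i`-th and `j`-th rows of `A` do not both vanish. -/
noncomputable def lead (i j : Fin m) (A : GL (Fin m) ℚ) : Fin m :=
  @Classical.epsilon _ ⟨i⟩ fun k => A i k ≠ 0 ∨ A j k ≠ 0

theorem lead_spec (i j : Fin m) (A : GL (Fin m) ℚ) :
    A i (lead i j A) ≠ 0 ∨ A j (lead i j A) ≠ 0 := by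
  refine @Classical.epsilon_spec _ (fun k => A i k ≠ 0 ∨ A j k ≠ 0) ?_
  by_contra! h
  exact A.det_ne_zero (Matrix.det_eq_zero_of_row_eq_zero i fun k => (h k).1)

theorem rowAdd_mul_apply_of_ne {i j : Fin m} (hij : i ≠ j) (c : ℤ) (A : GL (Fin m) ℚ)
    {l : Fin m} (hl : l ≠ i) (k : Fin m) : (rowAdd hij c * A) l k = A l k := by
  rw [rowAdd_mul_apply, if_neg hl, add_zero]

theorem rowAdd_mul_apply_same {i j : Fin m} (hij : i ≠ j) (c : ℤ) (A : GL (Fin m) ℚ)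
    (k : Fin m) : (rowAdd hij c * A) i k = A i k + c * A j k := by
  rw [rowAdd_mul_apply, if_pos rfl]

theorem lead_rowAdd_mul {i j : Fin m} (hij : i ≠ j) (c : ℤ) (A : GL (Fin m) ℚ) :
    lead i j (rowAdd hij c * A) = lead i j A := by
  unfold lead
  congr 1
  ext k
  rw [rowAdd_mul_apply_same, rowAdd_mul_apply_of_ne hij c A hij.symm]
  by_cases h : A j k = 0 <;> simp [h]

/-- The affine maps whose linear part has rows `i` and `j` with quotient within `1` of `-c` in the
leading column. -/
def cone (i j : Fin m) (c : ℤ) : Set (GL (Fin m) ℚ × (Fin m → ℚ)) :=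
  {p | |p.1 i (lead i j p.1) + c * p.1 j (lead i j p.1)| ≤ |p.1 j (lead i j p.1)|}

theorem disjoint_cone (i j : Fin m) {c c' : ℤ} (hc : 3 ≤ |c - c'|) :
    Disjoint (cone i j c) (cone i j c') := by
  refine Set.disjoint_left.2 fun p h1 h2 => ?_
  simp only [cone, Set.mem_ofPred_eq] at h1 h2
  have h3 := lead_spec i j p.1
  set u := p.1 i (lead i j p.1)
  set v := p.1 j (lead i j p.1)
  have h4 : |((c - c' : ℤ) : ℚ)| * |v| ≤ 2 * |v| := by
    rw [← abs_mul]
    calc |((c - c' : ℤ) : ℚ) * v| = |(u + c * v) - (u + c' * v)| := by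
          congr 1
          push_cast
          ring
      _ ≤ |u + c * v| + |u + c' * v| := abs_sub _ _
      _ ≤ 2 * |v| := by linarith
  have h5 : (3 : ℚ) ≤ |((c - c' : ℤ) : ℚ)| := by exact_mod_cast hc
  have h6 : |v| = 0 := by nlinarith [abs_nonneg v]
  rw [h6, abs_nonpos_iff] at h1
  rw [abs_eq_zero] at h6
  rw [h6, mul_zero, add_zero] at h1
  exact h3.elim (· h1) (· h6)

theorem cone_union_cone (i j : Fin m) : cone i j 0 ∪ cone j i 0 = Set.univ := by
  refine Set.eq_univ_of_forall fun p => ?_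
  have h : lead j i p.1 = lead i j p.1 := by
    unfold lead
    simp only [or_comm]
  simp only [cone, Set.mem_union, Set.mem_ofPred_eq, h, Int.cast_zero, zero_mul, add_zero]
  exact le_total _ _

theorem rowAdd_mul_mem_cone {i j : Fin m} (hij : i ≠ j) (c : ℤ)
    {p : GL (Fin m) ℚ × (Fin m → ℚ)} (hp : p ∈ cone i j 0) (b : Fin m → ℚ) :
    (rowAdd hij c * p.1, b) ∈ cone i j (-c) := by
  simp only [cone, Set.mem_ofPred_eq, Int.cast_zero, zero_mul, add_zero] at hp ⊢
  rw [lead_rowAdd_mul, rowAdd_mul_apply_same, rowAdd_mul_apply_of_ne hij c p.1 hij.symm]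
  simpa using hp

open Torus

theorem exists_affine_lift_shear {i j : Fin m} (hij : i ≠ j) (c : ℤ) (x : Fin m → UnitAddCircle) :
    ∃ t : ℤ, ∀ p, affine (lift (shear i j c x)) p =
      affine (lift x) (rowAdd hij c * p.1, p.2 + (t : ℚ) • p.1 j) := by
  obtain ⟨t, ht⟩ := exists_lift_shear i j c x
  exact ⟨t, fun p => by rw [ht, affine_add_single hij]⟩

theorem affine_one (x : Fin m → ℝ) : affine x (1, 0) = x := by
  ext j
  simp [affine, Matrix.one_apply, apply_ite (Rat.cast : ℚ → ℝ)]

variable {T : SimpleGraph (Fin m → ℝ)}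

theorem isInner_shear (hT : ∀ x y, T.Reachable x y ↔ FN (m + 1) x y) {i j : Fin m} (hij : i ≠ j)
    (c : ℤ) : IsInner volume T lift (shear i j c) := by
  refine ⟨measurePreserving_shear hij c, .of_forall fun x => ?_⟩
  obtain ⟨t, ht⟩ := exists_affine_lift_shear hij c x
  rw [hT, ← affine_one (lift (shear i j c x)), ht]
  exact self_affine _ _

theorem orbitChart (hT : ∀ x y, T.Reachable x y ↔ FN (m + 1) x y) (hac : T.IsAcyclic)
    (hm : MeasurableSet {p : (Fin m → ℝ) × (Fin m → ℝ) | T.Adj p.1 p.2}) :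
    OrbitChart volume T lift fun x : Fin m → UnitAddCircle => affine (lift x) where
  acyclic := hac
  measurableSet_adj := hm
  measurable_pt := measurable_lift
  measurable_ev q := (measurable_affine q).comp measurable_lift
  injective := by
    filter_upwards [ae_forall_eq_zero (ι := Fin m)] with x hx using affine_injective hx
  range := by
    filter_upwards [ae_forall_eq_zero (ι := Fin m)] with x hx
    ext y
    rw [Set.mem_ofPred_eq, hT]
    constructor
    · rintro ⟨p, rfl⟩
      exact self_affine _ _
    · exact fun h => exists_affine h hx

instance : Countable (GL (Fin m) ℚ) :=
  have : Countable (Matrix (Fin m) (Fin m) ℚ) := inferInstanceAs (Countable (Fin m → Fin m → ℚ))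
  Units.val_injective.countable

theorem not_isAcyclic (hT : ∀ x y, T.Reachable x y ↔ FN (m + 1) x y)
    (hm : MeasurableSet {p : (Fin m → ℝ) × (Fin m → ℝ) | T.Adj p.1 p.2}) {a b c d : Fin m}
    (hab : a ≠ b) (hcd : c ≠ d) (hac : a ≠ c) (had : a ≠ d) (hbc : b ≠ c) (hbd : b ≠ d) :
    ¬ T.IsAcyclic := by
  intro hacyc
  have h := orbitChart hT hacyc hm
  have hτ := isInner_shear hT hcd 1
  let i : Fin 2 → Fin m := ![a, b]
  let j : Fin 2 → Fin m := ![b, a]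
  let s : Fin 2 → ℤ := ![3, -3]
  have hij : ∀ u, i u ≠ j u := Fin.forall_fin_two.2 ⟨hab, hab.symm⟩
  obtain ⟨L, hL⟩ := h.exists_forall_measureReal_le hτ (γ := fun u v => shear (i u) (j u) (s v))
    (fun u v => isInner_shear hT (hij u) (s v))
    (fun u v => commute_shear (by revert u; exact Fin.forall_fin_two.2 ⟨had.symm, hbd.symm⟩)
      (by revert u; exact Fin.forall_fin_two.2 ⟨hbc.symm, hac.symm⟩) 1 (s v))
    (D := fun u => cone (i u) (j u) 0) (E := fun u v => cone (i u) (j u) (-s v))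
    (cone_union_cone a b)
    (fun u v => disjoint_cone _ _ (by revert v; simp [Fin.forall_fin_two, s]))
    (fun u => disjoint_cone _ _ (by simp [s]))
    (fun u v => .of_forall fun x => by
      obtain ⟨t, ht⟩ := exists_affine_lift_shear (hij u) (s v) x
      rintro _ ⟨p, hp, rfl⟩
      exact ⟨_, rowAdd_mul_mem_cone (hij u) (s v) hp _, (ht p).symm⟩)
  refine h.false_of_forall_measureReal_le hτ ?_ hL
  filter_upwards [ae_forall_eq_zero (ι := Fin m)] with x hx q
  exact (affine_left_injective q).comp
    (lift_injective.comp (injective_iterate_shear hcd one_ne_zero hx))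

end FN

theorem stmt15 (n : ℕ) (hn : 5 ≤ n) :
    ¬ ∃ G : Set ((Fin (n - 1) → ℝ) × (Fin (n - 1) → ℝ)),
      MeasurableSet G ∧
      (∀ a b, (a, b) ∈ G → (b, a) ∈ G) ∧
      (∀ a, (a, a) ∉ G) ∧
      (∀ a b, (a, b) ∈ G → FN n a b) ∧
      (∀ x y, FN n x y →
        (SimpleGraph.fromRel (fun a b => (a, b) ∈ G)).Reachable x y) ∧
      (SimpleGraph.fromRel (fun a b => (a, b) ∈ G)).IsAcyclic := by
  rintro ⟨G, hG, hsymm, hirr, hGF, hFG, hacyc⟩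
  obtain ⟨m, rfl⟩ : ∃ m, n = m + 1 := ⟨n - 1, by omega⟩
  have hadj : ∀ x y, (SimpleGraph.fromRel (fun a b => (a, b) ∈ G)).Adj x y ↔ (x, y) ∈ G := by
    intro x y
    rw [SimpleGraph.fromRel_adj]
    refine ⟨fun h => h.2.elim id (hsymm _ _), fun h => ⟨?_, .inl h⟩⟩
    rintro rfl
    exact hirr _ h
  refine FN.not_isAcyclic (m := m) (T := SimpleGraph.fromRel (fun a b => (a, b) ∈ G))
    (fun x y => ⟨?_, hFG x y⟩) ?_ (a := ⟨0, by omega⟩) (b := ⟨1, by omega⟩) (c := ⟨2, by omega⟩)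
    (d := ⟨3, by omega⟩) ?_ ?_ ?_ ?_ ?_ ?_ hacyc
  · rintro ⟨w⟩
    induction w with
    | nil => exact FN.refl _
    | cons h _ ih => exact (hGF _ _ ((hadj _ _).1 h)).trans ih
  · have h : {p | (SimpleGraph.fromRel (fun a b => (a, b) ∈ G)).Adj p.1 p.2} = G :=
      Set.ext fun p => hadj p.1 p.2
    exact h.symm ▸ hG
  all_goals simp
end
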